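/- For every n ≥ 3 and every η > 0 there exists a finite set S of rotations in SO(n) such that for every Lebesgue measurable subset U ⊆ S^{n-1} one has μ(⋃_{γ∈S} γ(U)) ≥ min(1 − η, μ(U)/η) (the expansion property of the rotation action on the sphere). -/

import Mathlib

open MeasureTheory Set Metric
open scoped ENNReal

noncomputable section

/-- `n`-dimensional Euclidean space `ℝⁿ`. -/
abbrev EucSp (n : ℕ) : Type := EuclideanSpace ℝ (Fin n)

/-- The unit sphere `S^{n-1} ⊆ ℝⁿ`. -/
abbrev Sph (n : ℕ) : Type := Metric.sphere (0 : EucSp n) 1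

/-- A linear isometry of `ℝⁿ` is a rotation (an element of `SO(n)`) if it has determinant `1`. -/
def IsRotation {n : ℕ} (γ : EucSp n ≃ₗᵢ[ℝ] EucSp n) : Prop :=
  LinearMap.det (γ.toLinearEquiv.toLinearMap) = 1

/-- The action of a linear isometry of `ℝⁿ` on the unit sphere `S^{n-1}`. -/
def rotateSphere {n : ℕ} (γ : EucSp n ≃ₗᵢ[ℝ] EucSp n) (x : Sph n) : Sph n :=
  ⟨γ x, by
    have hx : ‖(x : EucSp n)‖ = 1 := by
      have h := x.2
      rwa [Metric.mem_sphere, dist_zero_right] at h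
    rw [Metric.mem_sphere, dist_zero_right, γ.norm_map]
    exact hx⟩

section
open Quaternion Finset
open scoped Classical

/-- The quaternion with the given coordinates. -/
def quat {R : Type*} [CommRing R] (a b c d : R) : ℍ[R] := ⟨a, b, c, d⟩

section quat
variable {R : Type*} [CommRing R] (a b c d : R)
@[simp] lemma re_quat : (quat a b c d).re = a := rfl
@[simp] lemma imI_quat : (quat a b c d).imI = b := rfl
@[simp] lemma imJ_quat : (quat a b c d).imJ = c := rfl
@[simp] lemma imK_quat : (quat a b c d).imK = d := rfl
end quat

/-- The coordinates of an integer quaternion. -/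
def quatCoords (y : ℍ[ℤ]) : ℤ × ℤ × ℤ × ℤ := (y.re, y.imI, y.imJ, y.imK)

lemma quatCoords_injective : Function.Injective quatCoords := by
  intro x y h
  simp only [quatCoords, Prod.mk.injEq] at h
  exact Quaternion.ext _ _ h.1 h.2.1 h.2.2.1 h.2.2.2

/-- The box of integer points with coordinates bounded by `r`. -/
noncomputable def intBox (r : ℤ) : Finset (ℤ × ℤ × ℤ × ℤ) :=
  Finset.Icc (-r) r ×ˢ Finset.Icc (-r) r ×ˢ Finset.Icc (-r) r ×ˢ Finset.Icc (-r) r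

lemma quatCoords_mem_intBox {y : ℍ[ℤ]} {r : ℤ} (hr : 0 ≤ r) (h : normSq y < (r + 1) ^ 2) :
    quatCoords y ∈ intBox r := by
  rw [normSq_def'] at h
  have key : ∀ a : ℤ, a ^ 2 < (r + 1) ^ 2 → -r ≤ a ∧ a ≤ r := fun a ha => by
    have := abs_lt_of_sq_lt_sq ha (by omega)
    rw [abs_lt] at this
    omega
  simp only [quatCoords, intBox, Finset.mem_product, Finset.mem_Icc]
  have h1 := sq_nonneg y.re
  have h2 := sq_nonneg y.imI
  have h3 := sq_nonneg y.imJ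
  have h4 := sq_nonneg y.imK
  exact ⟨key _ (by linarith), key _ (by linarith), key _ (by linarith), key _ (by linarith)⟩

lemma finite_normSq_eq (N : ℕ) : {y : ℍ[ℤ] | normSq y = N}.Finite := by
  refine Set.Finite.of_finite_image (f := quatCoords) ?_ quatCoords_injective.injOn
  refine (intBox N).finite_toSet.subset ?_
  rintro _ ⟨y, hy, rfl⟩
  have hy : normSq y = N := hy
  exact quatCoords_mem_intBox (by positivity) (by rw [hy]; nlinarith [Nat.cast_nonneg (α := ℤ) N])

/-- The integer quaternions of norm `N`. -/
noncomputable def shell (N : ℕ) : Finset ℍ[ℤ] := (finite_normSq_eq N).toFinset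

lemma mem_shell {N : ℕ} {y : ℍ[ℤ]} : y ∈ shell N ↔ normSq y = N := by
  simp [shell]

lemma card_shell_eq (N r : ℕ) (h : (N : ℤ) < (r + 1) ^ 2) : (shell N).card =
    ((intBox r).filter fun v =>
      v.1 ^ 2 + v.2.1 ^ 2 + v.2.2.1 ^ 2 + v.2.2.2 ^ 2 = (N : ℤ)).card := by
  refine Finset.card_nbij quatCoords ?_ quatCoords_injective.injOn ?_
  · intro y hy
    have hy : normSq y = N := mem_shell.1 hy
    simp only [Finset.coe_filter, Set.mem_ofPred_eq]
    exact ⟨quatCoords_mem_intBox (by positivity) (by rwa [hy]), by rw [← hy, normSq_def']; rfl⟩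
  · rintro ⟨a, b, c, d⟩ hv
    simp only [Finset.coe_filter, Set.mem_ofPred_eq] at hv
    refine ⟨quat a b c d, ?_, rfl⟩
    rw [Finset.mem_coe, mem_shell, ← hv.2, normSq_def']
    rfl

lemma card_shell_seven : (shell 7).card = 64 :=
  (card_shell_eq 7 2 (by norm_num)).trans (by decide +kernel)

lemma card_shell_one : (shell 1).card = 8 :=
  (card_shell_eq 1 1 (by norm_num)).trans (by decide +kernel)

lemma star_mem_shell {N : ℕ} {y : ℍ[ℤ]} (h : y ∈ shell N) : star y ∈ shell N := by
  rw [mem_shell, normSq_star]; exact mem_shell.1 h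

/-- Divisibility of an integer quaternion by `7`. -/
def SevenDvd (x : ℍ[ℤ]) : Prop := ∃ z : ℍ[ℤ], x = (7 : ℤ) • z

lemma sevenDvd_iff {x : ℍ[ℤ]} :
    SevenDvd x ↔ 7 ∣ x.re ∧ 7 ∣ x.imI ∧ 7 ∣ x.imJ ∧ 7 ∣ x.imK := by
  constructor
  · rintro ⟨z, rfl⟩
    simp only [re_smul, imI_smul, imJ_smul, imK_smul, smul_eq_mul, dvd_mul_right, and_self]
  · rintro ⟨⟨a, ha⟩, ⟨b, hb⟩, ⟨c, hc⟩, ⟨d, hd⟩⟩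
    refine ⟨quat a b c d, ?_⟩
    ext <;> simp only [re_smul, imI_smul, imJ_smul, imK_smul, smul_eq_mul, re_quat, imI_quat,
      imJ_quat, imK_quat, *]

lemma SevenDvd.of_smul {x : ℍ[ℤ]} {N : ℤ} (hx : ¬ SevenDvd x) (h : SevenDvd (N • x)) : 7 ∣ N := by
  by_contra hN
  have p7 : Prime (7 : ℤ) := by norm_num
  apply hx
  rw [sevenDvd_iff] at h ⊢
  simp only [re_smul, imI_smul, imJ_smul, imK_smul, smul_eq_mul] at h
  exact ⟨(p7.dvd_or_dvd h.1).resolve_left hN, (p7.dvd_or_dvd h.2.1).resolve_left hN,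
    (p7.dvd_or_dvd h.2.2.1).resolve_left hN, (p7.dvd_or_dvd h.2.2.2).resolve_left hN⟩

lemma seven_smul_injective {x y : ℍ[ℤ]} (h : (7 : ℤ) • x = (7 : ℤ) • y) : x = y :=
  smul_right_injective _ (by norm_num : (7 : ℤ) ≠ 0) h

lemma normSq_coe_smul (a y : ℍ[ℤ]) : a * (star a * y) = (normSq a) • y := by
  rw [← mul_assoc, self_mul_star, coe_mul_eq_smul]

lemma seven_dvd_normSq_of_star_mul {a y : ℍ[ℤ]} (hy : ¬ SevenDvd y) (h : SevenDvd (star a * y)) :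
    7 ∣ normSq a := by
  obtain ⟨z, hz⟩ := h
  refine SevenDvd.of_smul hy ⟨a * z, ?_⟩
  rw [← normSq_coe_smul, hz, mul_smul_comm]

lemma sevenDvd_star_mul_of_common {q p y : ℍ[ℤ]} (hy : ¬ SevenDvd y)
    (hq : normSq q = 7) (hp : normSq p = 7)
    (h1 : SevenDvd (star q * y)) (h2 : SevenDvd (star p * y)) : SevenDvd (star q * p) := by
  have key : ∀ c : ℍ[ℤ], 7 ∣ 2 * (star q * p * c).re := by
    intro c
    have h3 : 7 ∣ normSq (q + p * c) := by
      apply seven_dvd_normSq_of_star_mul hy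
      obtain ⟨u, hu⟩ := h1
      obtain ⟨v, hv⟩ := h2
      refine ⟨u + star c * v, ?_⟩
      rw [star_add, star_mul, add_mul, hu, mul_assoc, hv, mul_smul_comm, smul_add]
    have h4 : normSq (q + p * c) = 7 * (1 + normSq c) + 2 * (star q * p * c).re := by
      have e : (q * star (p * c)).re = (star q * p * c).re := by
        simp; ring
      rw [normSq_add, e, map_mul, hq, hp]; ring
    rw [h4] at h3
    exact (Int.dvd_add_right (Dvd.intro _ rfl)).1 h3
  have h0 := key 1
  have hi := key (quat 0 1 0 0)
  have hj := key (quat 0 0 1 0)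
  have hk := key (quat 0 0 0 1)
  rw [sevenDvd_iff]
  rw [Quaternion.re_mul] at h0 hi hj hk
  simp only [re_quat, imI_quat, imJ_quat, imK_quat, re_one, imI_one, imJ_one, imK_one, mul_one,
    mul_zero, sub_zero, zero_sub] at h0 hi hj hk
  refine ⟨by omega, by omega, by omega, by omega⟩

lemma card_bad_le {y : ℍ[ℤ]} (hy : ¬ SevenDvd y) :
    ((shell 7).filter fun q => SevenDvd (star q * y)).card ≤ 8 := by
  rcases Finset.eq_empty_or_nonempty
    ((shell 7).filter fun q => SevenDvd (star q * y)) with h | ⟨p, hp⟩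
  · simp [h]
  rw [Finset.mem_filter, mem_shell] at hp
  refine le_trans (Finset.card_le_card (t := (shell 1).image fun u => p * star u) ?_)
    (Finset.card_image_le.trans card_shell_one.le)
  intro q hq
  rw [Finset.mem_filter, mem_shell] at hq
  obtain ⟨u, hu⟩ := sevenDvd_star_mul_of_common hy hq.1 hp.1 hq.2 hp.2
  have hpu : p = q * u := by
    apply seven_smul_injective
    have := normSq_coe_smul q p
    rw [hu, hq.1, mul_smul_comm] at this
    exact this.symm
  have hun : normSq u = 1 := by
    have := congrArg normSq hpu
    rw [map_mul, hp.1, hq.1] at this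
    push_cast at this
    omega
  refine Finset.mem_image.2 ⟨u, by rw [mem_shell]; exact_mod_cast hun, ?_⟩
  rw [hpu, mul_assoc, self_mul_star, hun]
  simp

/-- The sum of `F` over all products of `n` integer quaternions of norm `7`. -/
noncomputable def wordSum : ℕ → (ℍ[ℤ] → ℝ) → ℝ
  | 0, F => F 1
  | n + 1, F => ∑ q ∈ shell 7, wordSum n fun x => F (q * x)

/-- The number of representations of `x` as a product of `n` integer quaternions of norm `7`. -/
noncomputable def wordCount : ℕ → ℍ[ℤ] → ℝ
  | 0, x => if x = 1 then 1 else 0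
  | n + 1, x => ∑ q ∈ shell 7, if h : SevenDvd (star q * x) then wordCount n h.choose else 0

lemma wordSum_eq (n : ℕ) : ∀ F : ℍ[ℤ] → ℝ,
    wordSum n F = ∑ x ∈ shell (7 ^ n), wordCount n x * F x := by
  induction n with
  | zero =>
    intro F
    rw [Finset.sum_eq_single 1]
    · simp [wordSum, wordCount]
    · intro b _ hb
      simp [wordCount, hb]
    · intro h
      exact absurd (mem_shell.2 (by simp)) h
  | succ n ih =>
    intro F
    simp only [wordSum, wordCount, ih, Finset.sum_mul]
    rw [Finset.sum_comm (s := shell (7 ^ (n + 1)))]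
    refine Finset.sum_congr rfl fun q hq => ?_
    have hq := mem_shell.1 hq
    have hstar : ∀ x : ℍ[ℤ], star q * (q * x) = (7 : ℤ) • x := fun x => by
      have := normSq_coe_smul (star q) x
      rwa [star_star, normSq_star, hq] at this
    have hstar' : ∀ x : ℍ[ℤ], q * (star q * x) = (7 : ℤ) • x := fun x => by
      have := normSq_coe_smul q x
      rwa [hq] at this
    have hinj : ∀ x ∈ shell (7 ^ n), ∀ y ∈ shell (7 ^ n), q * x = q * y → x = y := by
      intro x _ y _ h
      apply seven_smul_injective
      rw [← hstar, ← hstar, h]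
    symm
    rw [← Finset.sum_subset (s₂ := shell (7 ^ (n + 1)))
      (s₁ := (shell (7 ^ n)).image fun x => q * x), Finset.sum_image hinj]
    · refine Finset.sum_congr rfl fun x _ => ?_
      have hd : SevenDvd (star q * (q * x)) := ⟨x, hstar x⟩
      rw [dif_pos hd]
      rw [← seven_smul_injective ((hstar x).symm.trans hd.choose_spec)]
    · intro y hy
      obtain ⟨x, hx, rfl⟩ := Finset.mem_image.1 hy
      rw [mem_shell] at hx ⊢
      rw [map_mul, hx, hq]; push_cast; ring
    · intro y hy hny
      rw [dif_neg, zero_mul]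
      rintro ⟨z, hz⟩
      apply hny
      have hy := mem_shell.1 hy
      have e : q * z = y := by
        apply seven_smul_injective
        rw [← mul_smul_comm, ← hz, hstar']
      refine Finset.mem_image.2 ⟨z, ?_, e⟩
      rw [mem_shell]
      rw [← e, map_mul, hq] at hy
      push_cast at hy ⊢
      rw [pow_succ] at hy
      linarith

lemma wordCount_le (n : ℕ) : ∀ (j : ℕ) (y : ℍ[ℤ]), ¬ SevenDvd y →
    wordCount n ((7 : ℤ) ^ j • y) ≤ n.choose j * 8 ^ (n - j) * 64 ^ j := by
  induction n with
  | zero =>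
    intro j y hy
    simp only [wordCount]
    rcases Nat.eq_zero_or_pos j with rfl | hj
    · simp; split_ifs <;> norm_num
    · rw [if_neg]
      · positivity
      · intro h
        have h1 := congrArg QuaternionAlgebra.re h
        rw [re_smul, re_one, smul_eq_mul] at h1
        obtain ⟨k, rfl⟩ : ∃ k, j = k + 1 := ⟨j - 1, by omega⟩
        rw [pow_succ] at h1
        have : (7 : ℤ) ∣ 1 := ⟨7 ^ k * y.re, by linear_combination -h1⟩
        omega
  | succ n ih =>
    intro j y hy
    have hbound : ∀ q ∈ shell 7,
        (if h : SevenDvd (star q * (7 : ℤ) ^ j • y) then wordCount n h.choose else 0)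
        ≤ (if SevenDvd (star q * y) then (n.choose j * 8 ^ (n - j) * 64 ^ j : ℝ) else 0)
          + (if j = 0 then 0 else (n.choose (j - 1) * 8 ^ (n - (j - 1)) * 64 ^ (j - 1) : ℝ)) := by
      intro q hq
      have hq := mem_shell.1 hq
      have hstar' : ∀ x : ℍ[ℤ], q * (star q * x) = (7 : ℤ) • x := fun x => by
        have := normSq_coe_smul q x
        rwa [hq] at this
      split_ifs with h1 h2 h3 h4
      · subst h3
        have hspec := h1.choose_spec
        set z := h1.choose
        rw [pow_zero, one_smul] at hspec
        have hz : ¬ SevenDvd z := by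
          rintro ⟨w, hw⟩
          apply hy
          refine ⟨q * w, seven_smul_injective ?_⟩
          rw [← hstar', hspec, hw, mul_smul_comm, mul_smul_comm]
        have := ih 0 z hz
        simpa using this
      · have hspec := h1.choose_spec
        set z := h1.choose
        obtain ⟨v, hv⟩ := h2
        have hz : z = (7 : ℤ) ^ j • v := by
          apply seven_smul_injective
          rw [← hspec, mul_smul_comm, hv, smul_comm]
        have hvn : ¬ SevenDvd v := by
          rintro ⟨w, hw⟩
          apply hy
          refine ⟨q * w, seven_smul_injective ?_⟩
          rw [← hstar', hv, hw, mul_smul_comm, mul_smul_comm]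
        rw [hz]
        have := ih j v hvn
        have h0 : (0 : ℝ) ≤ n.choose (j - 1) * 8 ^ (n - (j - 1)) * 64 ^ (j - 1) := by positivity
        linarith
      · subst h4
        exact absurd (by simpa using h1) h2
      · have hspec := h1.choose_spec
        set z := h1.choose
        obtain ⟨k, rfl⟩ : ∃ k, j = k + 1 := ⟨j - 1, by omega⟩
        have hz : z = (7 : ℤ) ^ k • (star q * y) := by
          apply seven_smul_injective
          rw [← hspec, mul_smul_comm, pow_succ, smul_smul, mul_comm]
        rw [hz]
        have := ih k _ h2
        simpa using this
      · simp
      · positivity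
      · simp
      · positivity
    simp only [wordCount]
    refine (Finset.sum_le_sum hbound).trans ?_
    rw [Finset.sum_add_distrib, ← Finset.sum_filter, Finset.sum_const, Finset.sum_const]
    have hb : (((shell 7).filter fun q => SevenDvd (star q * y)).card : ℝ) ≤ 8 := by
      exact_mod_cast card_bad_le hy
    have hs : ((shell 7).card : ℝ) ≤ 64 := by exact_mod_cast card_shell_seven.le
    simp only [nsmul_eq_mul]
    refine (add_le_add (mul_le_mul_of_nonneg_right hb (by positivity))
      (mul_le_mul_of_nonneg_right hs (by split_ifs <;> positivity))).trans ?_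
    rcases j with _ | k
    · simp [pow_succ]; linarith
    · simp only [Nat.add_one_ne_zero, if_false, Nat.add_sub_cancel, Nat.choose_succ_succ',
      Nat.add_sub_add_right]
      push_cast
      rcases le_or_gt (k + 1) n with h | h
      · obtain ⟨l, rfl⟩ := Nat.exists_eq_add_of_le h
        rw [show k + 1 + l - (k + 1) = l by omega, show k + 1 + l - k = l + 1 by omega]
        rw [pow_succ, pow_succ]
        nlinarith
      · rw [Nat.choose_eq_zero_of_lt h]
        rw [pow_succ]
        push_cast
        nlinarith

lemma exists_primitive {x : ℍ[ℤ]} {n : ℕ} (hx : normSq x = 7 ^ n) :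
    ∃ j y, ¬ SevenDvd y ∧ x = (7 : ℤ) ^ j • y ∧ 2 * j ≤ n ∧ normSq y = 7 ^ (n - 2 * j) := by
  induction n using Nat.strong_induction_on generalizing x with
  | _ n ih =>
    by_cases h : SevenDvd x
    · obtain ⟨z, hz⟩ := h
      rw [hz, normSq_smul] at hx
      have hn : 2 ≤ n := by
        by_contra hlt
        interval_cases n <;> norm_num at hx <;> omega
      obtain ⟨k, rfl⟩ := Nat.exists_eq_add_of_le hn
      have hz' : normSq z = 7 ^ k := by
        rw [pow_add] at hx
        linarith
      obtain ⟨j, y, hy, h1, h2, h3⟩ := ih k (by omega) hz'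
      refine ⟨j + 1, y, hy, ?_, by omega, ?_⟩
      · rw [hz, h1, pow_succ, smul_smul, mul_comm]
      · rw [h3]; congr 1; omega
    · exact ⟨0, x, h, by simp, by omega, by simpa using hx⟩

theorem wordSum_le (n : ℕ) (F : ℍ[ℤ] → ℝ) (h0 : ∀ x, 0 ≤ F x)
    (hdir : ∀ x, F ((7 : ℤ) • x) = F x) :
    wordSum n F ≤ ∑ j ∈ range (n / 2 + 1), (n.choose j * 8 ^ (n - j) * 64 ^ j : ℝ) *
      ∑ y ∈ shell (7 ^ (n - 2 * j)), F y := by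
  have hdir' : ∀ (j : ℕ) x, F ((7 : ℤ) ^ j • x) = F x := by
    intro j
    induction j with
    | zero => simp
    | succ j ih => intro x; rw [pow_succ', mul_smul, hdir, ih]
  rw [wordSum_eq]
  calc _ ≤ ∑ x ∈ shell (7 ^ n), ∑ j ∈ range (n / 2 + 1), ∑ y ∈ shell (7 ^ (n - 2 * j)),
        if (7 : ℤ) ^ j • y = x then (n.choose j * 8 ^ (n - j) * 64 ^ j : ℝ) * F y else 0 := by
        refine Finset.sum_le_sum fun x hx => ?_
        obtain ⟨j, y, hy, h1, h2, h3⟩ := exists_primitive (n := n) (x := x)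
          (by rw [mem_shell.1 hx]; push_cast; rfl)
        have hnn : ∀ (i : ℕ) (z : ℍ[ℤ]), (0 : ℝ) ≤ if (7 : ℤ) ^ i • z = x then
            (n.choose i * 8 ^ (n - i) * 64 ^ i : ℝ) * F z else 0 := by
          intro i z
          have := h0 z
          split_ifs <;> positivity
        refine le_trans ?_ (Finset.single_le_sum
          (f := fun j => ∑ y ∈ shell (7 ^ (n - 2 * j)), if (7 : ℤ) ^ j • y = x then
            (n.choose j * 8 ^ (n - j) * 64 ^ j : ℝ) * F y else 0)
          (fun i _ => Finset.sum_nonneg fun z _ => hnn i z)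
          (Finset.mem_range.2 (by omega : j < n / 2 + 1)))
        refine le_trans ?_ (Finset.single_le_sum
          (f := fun y => if (7 : ℤ) ^ j • y = x then
            (n.choose j * 8 ^ (n - j) * 64 ^ j : ℝ) * F y else 0)
          (fun z _ => hnn j z) (mem_shell.2 (by rw [h3]; push_cast; rfl)))
        rw [if_pos h1.symm, h1, hdir']
        exact mul_le_mul_of_nonneg_right (wordCount_le n j y hy) (h0 y)
    _ = ∑ j ∈ range (n / 2 + 1), ∑ y ∈ shell (7 ^ (n - 2 * j)), ∑ x ∈ shell (7 ^ n),
        if (7 : ℤ) ^ j • y = x then (n.choose j * 8 ^ (n - j) * 64 ^ j : ℝ) * F y else 0 := by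
        rw [Finset.sum_comm]
        exact Finset.sum_congr rfl fun j _ => Finset.sum_comm
    _ ≤ _ := by
        refine Finset.sum_le_sum fun j _ => ?_
        rw [Finset.mul_sum]
        refine Finset.sum_le_sum fun y _ => ?_
        rw [Finset.sum_ite_eq]
        have := h0 y
        split_ifs
        · exact le_rfl
        · positivity

end

section
open Quaternion Finset

lemma exists_card_divisors_pow_le (K : ℕ) :
    ∃ C : ℕ, 0 < C ∧ ∀ n : ℕ, n ≠ 0 → n.divisors.card ^ K ≤ C * n := by
  set B := K.factorial * 2 ^ K
  have hB1 : 1 ≤ B := Nat.succ_le_of_lt (by positivity)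
  have hB : ∀ e : ℕ, (e + 1) ^ K ≤ B * 2 ^ e := by
    intro e
    calc (e + 1) ^ K ≤ (e + 1).ascFactorial K := Nat.pow_succ_le_ascFactorial _ _
      _ = K.factorial * (e + K).choose K := Nat.ascFactorial_eq_factorial_mul_choose _ _
      _ ≤ K.factorial * 2 ^ (e + K) := Nat.mul_le_mul_left _ (Nat.choose_le_two_pow _ _)
      _ = B * 2 ^ e := by simp only [B]; ring
  refine ⟨B ^ (2 ^ K), by positivity, fun n hn => ?_⟩
  rw [Nat.card_divisors hn, ← Finset.prod_pow]
  calc ∏ p ∈ n.primeFactors, (n.factorization p + 1) ^ K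
      ≤ ∏ p ∈ n.primeFactors, (if p < 2 ^ K then B else 1) * p ^ n.factorization p := by
        refine Finset.prod_le_prod' fun p hp => ?_
        have h2 : 2 ≤ p := (Nat.prime_of_mem_primeFactors hp).two_le
        split_ifs with h
        · exact (hB _).trans (Nat.mul_le_mul_left _ (Nat.pow_le_pow_left h2 _))
        · push Not at h
          rw [one_mul]
          calc (n.factorization p + 1) ^ K ≤ (2 ^ n.factorization p) ^ K :=
                Nat.pow_le_pow_left (Nat.succ_le_of_lt Nat.lt_two_pow_self) _
            _ = (2 ^ K) ^ n.factorization p := by rw [← pow_mul, ← pow_mul, mul_comm]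
            _ ≤ _ := Nat.pow_le_pow_left h _
    _ = (∏ p ∈ n.primeFactors, if p < 2 ^ K then B else 1) * n := by
        rw [Finset.prod_mul_distrib]
        congr 1
        exact Nat.prod_factorization_pow_eq_self hn
    _ ≤ B ^ (2 ^ K) * n := by
        refine Nat.mul_le_mul_right _ ?_
        rw [← Finset.prod_filter, Finset.prod_const]
        refine Nat.pow_le_pow_right hB1 ?_
        calc _ ≤ (Finset.range (2 ^ K)).card := Finset.card_le_card fun p hp => by
              simpa using (Finset.mem_filter.1 hp).2
          _ = _ := Finset.card_range _

lemma finite_norm_eq (n : ℕ) : {z : GaussianInt | z.norm = n}.Finite := by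
  refine Set.Finite.of_finite_image (f := fun z : GaussianInt => (z.re, z.im)) ?_
    (fun x _ y _ h => Zsqrtd.ext (congrArg Prod.fst h) (congrArg Prod.snd h))
  refine (Finset.Icc (-n : ℤ) n ×ˢ Finset.Icc (-n : ℤ) n).finite_toSet.subset ?_
  rintro _ ⟨z, hz, rfl⟩
  have hz : z.norm = n := hz
  rw [Zsqrtd.norm_def] at hz
  have hz : z.re * z.re + z.im * z.im = n := by linarith
  have key : ∀ a : ℤ, a * a ≤ n → -(n : ℤ) ≤ a ∧ a ≤ n := by
    intro a ha
    constructor <;> nlinarith [Nat.cast_nonneg (α := ℤ) n]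
  simp only [Finset.coe_product, Set.mem_prod, Finset.coe_Icc, Set.mem_Icc]
  exact ⟨key _ (by nlinarith), key _ (by nlinarith)⟩

/-- The Gaussian integers of norm `n`. -/
noncomputable def gaussShell (n : ℕ) : Finset GaussianInt := (finite_norm_eq n).toFinset

lemma mem_gaussShell {n : ℕ} {z : GaussianInt} : z ∈ gaussShell n ↔ z.norm = n := by
  simp [gaussShell]

open scoped Classical in
lemma exists_gauss_factors {p n : ℕ} (hp : p.Prime) (hn : ¬ p ∣ n) (e : ℕ) :
    ∃ A : Finset GaussianInt, A.card ≤ e + 1 ∧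
      ∀ z : GaussianInt, z.norm = ((p ^ e * n : ℕ) : ℤ) →
        ∃ a ∈ A, ∃ w : GaussianInt, w.norm = n ∧ z = a * w := by
  have : Fact p.Prime := ⟨hp⟩
  have hp0 : (p : ℤ) ≠ 0 := by exact_mod_cast hp.ne_zero
  by_cases hirr : Irreducible (p : GaussianInt)
  · refine ⟨{(p : GaussianInt) ^ (e / 2)}, by simp,
      fun z hz => ⟨_, Finset.mem_singleton_self _, ?_⟩⟩
    have hprime : Prime (p : GaussianInt) := hirr.prime
    induction e using Nat.strong_induction_on generalizing z with
    | _ e ih =>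
      rcases Nat.eq_zero_or_pos e with rfl | he
      · exact ⟨z, by simpa using hz, by simp⟩
      · have hd : (p : GaussianInt) ∣ z := by
          have : (p : GaussianInt) ∣ z * star z := by
            rw [← Zsqrtd.norm_eq_mul_conj, hz]
            refine ⟨((p ^ (e - 1) * n : ℕ) : GaussianInt), ?_⟩
            obtain ⟨k, rfl⟩ : ∃ k, e = k + 1 := ⟨e - 1, by omega⟩
            rw [Nat.add_sub_cancel]
            push_cast
            ring
          rcases hprime.dvd_or_dvd this with h | ⟨w, hw⟩
          · exact h
          · refine ⟨star w, ?_⟩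
            have := congrArg star hw
            rwa [star_star, star_mul', star_natCast] at this
        obtain ⟨w, rfl⟩ := hd
        rw [Zsqrtd.norm_mul, Zsqrtd.norm_natCast] at hz
        rcases Nat.lt_or_ge e 2 with h | h
        · exfalso
          obtain rfl : e = 1 := by omega
          apply hn
          have h1 : (p : ℤ) * w.norm = n := by
            apply mul_left_cancel₀ hp0
            push_cast at hz
            linear_combination hz
          exact_mod_cast Dvd.intro _ h1
        · obtain ⟨k, rfl⟩ := Nat.exists_eq_add_of_le' h
          obtain ⟨v, hv, rfl⟩ := ih k (by omega) w (by
            apply mul_left_cancel₀ (mul_ne_zero hp0 hp0)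
            rw [hz]; push_cast; ring)
          refine ⟨v, hv, ?_⟩
          rw [show (k + 2) / 2 = k / 2 + 1 by omega, pow_succ]; ring
  · obtain ⟨a, b, hab⟩ := GaussianInt.sq_add_sq_of_nat_prime_of_not_irreducible p hirr
    set π : GaussianInt := ⟨a, b⟩ with hπ
    have hπn : π.norm = p := by
      rw [Zsqrtd.norm_def, hπ, ← hab]; simp; ring
    have hπs : (star π).norm = p := by rw [Zsqrtd.norm_conj, hπn]
    have hirrπ : Irreducible π := by
      refine ⟨fun h => ?_, fun x y hxy => ?_⟩
      · rw [← Zsqrtd.norm_eq_one_iff, hπn] at h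
        exact hp.ne_one h
      · have := congrArg (fun z => (Zsqrtd.norm z).natAbs) hxy
        simp only [hπn, Zsqrtd.norm_mul, Int.natAbs_mul, Int.natAbs_natCast] at this
        rw [← Zsqrtd.norm_eq_one_iff, ← Zsqrtd.norm_eq_one_iff]
        rw [this] at hp
        rcases Nat.prime_mul_iff.1 hp with h | h
        · exact Or.inr h.2
        · exact Or.inl h.2
    have hprime : Prime π := hirrπ.prime
    refine ⟨(Finset.range (e + 1)).image fun i => π ^ i * star π ^ (e - i),
      Finset.card_image_le.trans (by simp), ?_⟩
    induction e with
    | zero => intro z hz; exact ⟨1, by simp, z, by simpa using hz, by simp⟩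
    | succ e ih =>
      intro z hz
      have step : ∀ w c : GaussianInt, c.norm = p → z = c * w →
          w.norm = ((p ^ e * n : ℕ) : ℤ) := by
        rintro w c hc rfl
        rw [Zsqrtd.norm_mul, hc] at hz
        apply mul_left_cancel₀ hp0
        rw [hz]; push_cast; ring
      have hd : π ∣ z ∨ star π ∣ z := by
        have : π ∣ z * star z := by
          rw [← Zsqrtd.norm_eq_mul_conj, hz]
          refine Dvd.dvd.trans ⟨star π, (Zsqrtd.norm_eq_mul_conj π)⟩ ?_
          rw [hπn]
          refine ⟨((p ^ e * n : ℕ) : GaussianInt), ?_⟩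
          push_cast; ring
        rcases hprime.dvd_or_dvd this with h | ⟨w, hw⟩
        · exact Or.inl h
        · refine Or.inr ⟨star w, ?_⟩
          have := congrArg star hw
          rwa [star_star, star_mul'] at this
      rcases hd with ⟨w, hw⟩ | ⟨w, hw⟩
      · obtain ⟨a, ha, v, hv, rfl⟩ := ih w (step w _ hπn hw)
        obtain ⟨i, hi, rfl⟩ := Finset.mem_image.1 ha
        rw [Finset.mem_range] at hi
        refine ⟨π ^ (i + 1) * star π ^ (e + 1 - (i + 1)), Finset.mem_image.2
          ⟨i + 1, by simp; omega, rfl⟩, v, hv, ?_⟩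
        rw [hw, show e + 1 - (i + 1) = e - i by omega]; ring
      · obtain ⟨a, ha, v, hv, rfl⟩ := ih w (step w _ hπs hw)
        obtain ⟨i, hi, rfl⟩ := Finset.mem_image.1 ha
        rw [Finset.mem_range] at hi
        refine ⟨π ^ i * star π ^ (e + 1 - i), Finset.mem_image.2
          ⟨i, by simp; omega, rfl⟩, v, hv, ?_⟩
        rw [hw, show e + 1 - i = e - i + 1 by omega]; ring

lemma card_gaussShell_one : (gaussShell 1).card ≤ 4 := by
  refine (Finset.card_le_card_of_injOn (t := ({(1, 0), (-1, 0), (0, 1), (0, -1)} : Finset (ℤ × ℤ)))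
    (fun z : GaussianInt => (z.re, z.im)) ?_
    (fun x _ y _ h => Zsqrtd.ext (congrArg Prod.fst h) (congrArg Prod.snd h))).trans
    (Finset.card_le_four)
  intro z hz
  have hz := mem_gaussShell.1 hz
  rw [Zsqrtd.norm_def] at hz
  have hz : z.re * z.re + z.im * z.im = 1 := by push_cast at hz; linarith
  have h1 : -1 ≤ z.re ∧ z.re ≤ 1 := by constructor <;> nlinarith
  have h2 : -1 ≤ z.im ∧ z.im ≤ 1 := by constructor <;> nlinarith
  obtain ⟨a, b⟩ := z
  simp only at *
  obtain ⟨h1, h1'⟩ := h1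
  obtain ⟨h2, h2'⟩ := h2
  interval_cases a <;> interval_cases b <;> simp at *

open scoped Classical in
lemma card_gaussShell_le (n : ℕ) (hn : n ≠ 0) :
    (gaussShell n).card ≤ 4 * n.divisors.card := by
  induction n using Nat.recOnPrimePow with
  | zero => exact absurd rfl hn
  | one => simpa using card_gaussShell_one
  | prime_pow_mul a p e hp hpa he ih =>
    have ha : a ≠ 0 := by rintro rfl; simp at hpa
    obtain ⟨A, hA, h⟩ := exists_gauss_factors hp hpa e
    have hco : Nat.Coprime (p ^ e) a := Nat.Coprime.pow_left _ ((hp.coprime_iff_not_dvd).2 hpa)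
    rw [hco.card_divisors_mul, Nat.divisors_prime_pow hp, Finset.card_map, Finset.card_range]
    calc (gaussShell (p ^ e * a)).card
        ≤ ((A ×ˢ gaussShell a).image fun x => x.1 * x.2).card := by
          refine Finset.card_le_card fun z hz => ?_
          obtain ⟨c, hc, w, hw, rfl⟩ := h z (mem_gaussShell.1 hz)
          exact Finset.mem_image.2 ⟨(c, w), Finset.mem_product.2 ⟨hc, mem_gaussShell.2 hw⟩, rfl⟩
      _ ≤ A.card * (gaussShell a).card := Finset.card_image_le.trans (Finset.card_product _ _).le
      _ ≤ (e + 1) * (4 * a.divisors.card) := Nat.mul_le_mul hA (ih ha)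
      _ = _ := by ring

lemma exists_card_gaussShell_le (K : ℕ) (hK : K ≠ 0) :
    ∃ C : ℝ, 0 < C ∧ ∀ n N : ℕ, n ≤ N → 1 ≤ N →
      ((gaussShell n).card : ℝ) ≤ C * (N : ℝ) ^ (1 / K : ℝ) := by
  obtain ⟨C, hC, h⟩ := exists_card_divisors_pow_le K
  refine ⟨4 * (C : ℝ) ^ (1 / K : ℝ), by positivity, fun n N hnN hN => ?_⟩
  have hN1 : (1 : ℝ) ≤ N := by exact_mod_cast hN
  have hC1 : (1 : ℝ) ≤ C := by exact_mod_cast hC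
  rcases Nat.eq_zero_or_pos n with rfl | hn
  · have : (gaussShell 0).card ≤ 1 := by
      rw [Finset.card_le_one]
      intro a ha b hb
      have ha := mem_gaussShell.1 ha
      have hb := mem_gaussShell.1 hb
      rw [Nat.cast_zero, GaussianInt.norm_eq_zero] at ha hb
      rw [ha, hb]
    calc ((gaussShell 0).card : ℝ) ≤ 4 * 1 * 1 := by
          have : ((gaussShell 0).card : ℝ) ≤ 1 := by exact_mod_cast this
          linarith
      _ ≤ _ := by
          gcongr
          · exact Real.one_le_rpow hC1 (by positivity)
          · exact Real.one_le_rpow hN1 (by positivity)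
  · have h1 : ((gaussShell n).card : ℝ) ≤ 4 * n.divisors.card := by
      exact_mod_cast card_gaussShell_le n hn.ne'
    have h2 : ((n.divisors.card : ℝ)) ^ K ≤ C * N := by
      have := (h n hn.ne').trans (Nat.mul_le_mul_left _ hnN)
      exact_mod_cast this
    have h3 : (n.divisors.card : ℝ) ≤ (C * N : ℝ) ^ (1 / K : ℝ) := by
      rw [one_div, ← Real.pow_rpow_inv_natCast (Nat.cast_nonneg n.divisors.card) hK]
      exact Real.rpow_le_rpow (by positivity) h2 (by positivity)
    rw [Real.mul_rpow (by positivity) (by positivity)] at h3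
    linarith

open scoped Classical in
lemma card_fiber_le (M : ℕ) (a b : ℤ) (s : Finset ℍ[ℤ]) (hs : s ⊆ shell (M ^ 2)) :
    ∃ n : ℕ, n ≤ M ^ 2 ∧ (s.filter fun y => (y.re, y.imI) = (a, b)).card ≤ (gaussShell n).card := by
  refine ⟨((M : ℤ) ^ 2 - a ^ 2 - b ^ 2).toNat, ?_, ?_⟩
  · rw [Int.toNat_le]; push_cast; nlinarith [sq_nonneg a, sq_nonneg b]
  · refine Finset.card_le_card_of_injOn (fun y => (⟨y.imJ, y.imK⟩ : GaussianInt)) ?_ ?_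
    · intro y hy
      obtain ⟨h1, h2⟩ := Finset.mem_filter.1 hy
      have h3 := mem_shell.1 (hs h1)
      rw [normSq_def'] at h3
      simp only [Prod.mk.injEq] at h2
      obtain ⟨rfl, rfl⟩ := h2
      push_cast at h3
      refine mem_gaussShell.2 ?_
      rw [Zsqrtd.norm_def, Int.toNat_of_nonneg (by nlinarith [sq_nonneg y.imJ, sq_nonneg y.imK])]
      linear_combination h3
    · intro x hx y hy h
      have hx := (Finset.mem_filter.1 hx).2
      have hy := (Finset.mem_filter.1 hy).2
      have h := h
      simp only [Prod.mk.injEq] at hx hy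
      exact Quaternion.ext _ _ (hx.1.trans hy.1.symm) (hx.2.trans hy.2.symm)
        (congrArg Zsqrtd.re h) (congrArg Zsqrtd.im h)

open scoped Classical in
lemma exists_card_cap_le : ∃ C : ℝ, 0 < C ∧ ∀ M : ℕ, 1 ≤ M → ∀ Δ : ℝ, 0 < Δ →
    (((shell (M ^ 2)).filter fun y => (1 - Δ) * M ≤ |(y.re : ℝ)|).card : ℝ) ≤
      2 + C * Δ ^ (3 / 2 : ℝ) * (M : ℝ) ^ 2 * (M : ℝ) ^ (1 / 50 : ℝ) := by
  obtain ⟨C, hC, hr⟩ := exists_card_gaussShell_le 100 (by norm_num)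
  refine ⟨8 * C, by positivity, fun M hM Δ hΔ => ?_⟩
  have hM1 : (1 : ℝ) ≤ M := by exact_mod_cast hM
  set s := (shell (M ^ 2)).filter fun y => (1 - Δ) * M ≤ |(y.re : ℝ)| with hs
  have hss : ∀ y ∈ s, y.re ^ 2 + y.imI ^ 2 + y.imJ ^ 2 + y.imK ^ 2 = (M : ℤ) ^ 2 := by
    intro y hy
    rw [← normSq_def', mem_shell.1 (Finset.mem_filter.1 hy).1]; push_cast; rfl
  rw [← Finset.card_filter_add_card_filter_not (s := s) (fun y => y.re ^ 2 = (M : ℤ) ^ 2)]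
  push_cast
  refine add_le_add ?_ ?_
  · have : (s.filter fun y => y.re ^ 2 = (M : ℤ) ^ 2).card ≤
        ({quat (M : ℤ) 0 0 0, quat (-M : ℤ) 0 0 0} : Finset ℍ[ℤ]).card := by
      refine Finset.card_le_card fun y hy => ?_
      obtain ⟨h1, h2⟩ := Finset.mem_filter.1 hy
      have h3 := hss y h1
      have hI : y.imI = 0 := by nlinarith [sq_nonneg y.imI, sq_nonneg y.imJ, sq_nonneg y.imK]
      have hJ : y.imJ = 0 := by nlinarith [sq_nonneg y.imI, sq_nonneg y.imJ, sq_nonneg y.imK]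
      have hK : y.imK = 0 := by nlinarith [sq_nonneg y.imI, sq_nonneg y.imJ, sq_nonneg y.imK]
      rw [Finset.mem_insert, Finset.mem_singleton]
      rcases sq_eq_sq_iff_eq_or_eq_neg.1 h2 with h | h
      · exact Or.inl (Quaternion.ext _ _ h hI hJ hK)
      · exact Or.inr (Quaternion.ext _ _ h hI hJ hK)
    exact_mod_cast this.trans Finset.card_le_two
  · set s' := s.filter fun y => ¬ y.re ^ 2 = (M : ℤ) ^ 2
    set D := ⌊Δ * M⌋₊
    set B := ⌊√(2 * Δ) * M⌋₊
    set t : Finset (ℤ × ℤ) := ((Finset.Icc (1 : ℤ) D).image (fun i => (M : ℤ) - i) ∪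
      (Finset.Icc (1 : ℤ) D).image (fun i => i - (M : ℤ))) ×ˢ Finset.Icc (-B : ℤ) B
    have ht : t.card ≤ 2 * D * (2 * B + 1) := by
      rw [Finset.card_product]
      refine Nat.mul_le_mul ?_ (by simp; omega)
      refine (Finset.card_union_le _ _).trans ?_
      have h1 : (Finset.Icc (1 : ℤ) D).card = D := by simp
      have h2 := Finset.card_image_le (s := Finset.Icc (1 : ℤ) D) (f := fun i => (M : ℤ) - i)
      have h3 := Finset.card_image_le (s := Finset.Icc (1 : ℤ) D) (f := fun i => i - (M : ℤ))
      omega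
    have hmap : ∀ y ∈ s', (y.re, y.imI) ∈ t := by
      intro y hy
      obtain ⟨h1, h2⟩ := Finset.mem_filter.1 hy
      have h3 := hss y h1
      have h4 := (Finset.mem_filter.1 h1).2
      have hreal : (y.re : ℝ) ^ 2 + (y.imI : ℝ) ^ 2 + (y.imJ : ℝ) ^ 2 + (y.imK : ℝ) ^ 2
          = (M : ℝ) ^ 2 := by exact_mod_cast h3
      have habs : |y.re| < M := by
        have hle : y.re ^ 2 ≤ (M : ℤ) ^ 2 := by
          nlinarith [sq_nonneg y.imI, sq_nonneg y.imJ, sq_nonneg y.imK]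
        refine lt_of_le_of_ne (abs_le_of_sq_le_sq hle (by positivity)) fun h => h2 ?_
        rw [← h, sq_abs]
      have hD : (M : ℤ) - |y.re| ≤ D := by
        have : ((M : ℤ) - |y.re|).toNat ≤ D := by
          refine Nat.le_floor ?_
          have e : (((M : ℤ) - |y.re|).toNat : ℝ) = (M : ℝ) - |(y.re : ℝ)| := by
            have : (((M : ℤ) - |y.re|).toNat : ℤ) = (M : ℤ) - |y.re| :=
              Int.toNat_of_nonneg (by omega)
            exact_mod_cast congrArg (Int.cast (R := ℝ)) this
          rw [e]; linarith
        omega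
      refine Finset.mem_product.2 ⟨Finset.mem_union.2 ?_, ?_⟩
      · rcases abs_cases y.re with ⟨h, _⟩ | ⟨h, _⟩
        · exact Or.inl (Finset.mem_image.2 ⟨M - y.re, by rw [Finset.mem_Icc]; omega, by omega⟩)
        · exact Or.inr (Finset.mem_image.2 ⟨M + y.re, by rw [Finset.mem_Icc]; omega, by omega⟩)
      · have hb : |(y.imI : ℝ)| ≤ √(2 * Δ) * M := by
          rw [← Real.sqrt_sq (by positivity : (0 : ℝ) ≤ M), ← Real.sqrt_mul (by positivity)]
          refine Real.abs_le_sqrt ?_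
          have hsq : (M : ℝ) ^ 2 - 2 * Δ * M ^ 2 ≤ (y.re : ℝ) ^ 2 := by
            rcases le_or_gt Δ 1 with h | h
            · have : ((1 - Δ) * M) ^ 2 ≤ |(y.re : ℝ)| ^ 2 :=
                pow_le_pow_left₀ (mul_nonneg (by linarith) (by positivity)) h4 2
              rw [sq_abs] at this
              nlinarith [sq_nonneg (Δ * M)]
            · nlinarith [sq_nonneg (y.re : ℝ), sq_nonneg (M : ℝ)]
          nlinarith [sq_nonneg (y.imJ : ℝ), sq_nonneg (y.imK : ℝ)]
        have : y.imI.natAbs ≤ B := by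
          refine Nat.le_floor ?_
          rwa [Nat.cast_natAbs, Int.cast_abs]
        rw [Finset.mem_Icc]
        omega
    have hcard := Finset.card_le_mul_card_image_of_maps_to hmap ⌊C * (M : ℝ) ^ (1 / 50 : ℝ)⌋₊
      (by
        rintro ⟨a, b⟩ _
        obtain ⟨n, hn, h⟩ := card_fiber_le M a b s'
          ((Finset.filter_subset _ _).trans (Finset.filter_subset _ _))
        refine h.trans (Nat.le_floor ?_)
        have := hr n (M ^ 2) hn (Nat.one_le_pow _ _ hM)
        refine this.trans_eq ?_
        congr 1
        rw [Nat.cast_pow, ← Real.rpow_natCast, ← Real.rpow_mul (by positivity)]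
        norm_num)
    have hfl : (⌊C * (M : ℝ) ^ (1 / 50 : ℝ)⌋₊ : ℝ) ≤ C * (M : ℝ) ^ (1 / 50 : ℝ) :=
      Nat.floor_le (by positivity)
    have hDle : (D : ℝ) ≤ Δ * M := Nat.floor_le (by positivity)
    have hBle : (B : ℝ) ≤ √(2 * Δ) * M := Nat.floor_le (by positivity)
    have hT : (2 * D * (2 * B + 1) : ℝ) ≤ 8 * Δ ^ (3 / 2 : ℝ) * (M : ℝ) ^ 2 := by
      have e : Δ ^ (3 / 2 : ℝ) = Δ * √Δ := by
        rw [Real.sqrt_eq_rpow, ← Real.rpow_one_add' hΔ.le (by norm_num)]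
        norm_num
      rw [e]
      rcases Nat.eq_zero_or_pos D with h | h
      · rw [h]; simp; positivity
      · have h1 : (1 : ℝ) ≤ D := by exact_mod_cast h
        have h2 : 1 ≤ √Δ * M := by
          rw [← Real.sqrt_sq (by positivity : (0 : ℝ) ≤ M), ← Real.sqrt_mul (by positivity)]
          rw [Real.one_le_sqrt]
          nlinarith
        have h3 : √(2 * Δ) ≤ 3 / 2 * √Δ := by
          rw [Real.sqrt_mul (by norm_num)]
          refine mul_le_mul_of_nonneg_right ?_ (Real.sqrt_nonneg _)
          rw [Real.sqrt_le_left (by norm_num)]; norm_num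
        have h4 : (2 * B + 1 : ℝ) ≤ 4 * (√Δ * M) := by
          have := mul_le_mul_of_nonneg_right h3 (by positivity : (0 : ℝ) ≤ M)
          linarith
        calc (2 * D * (2 * B + 1) : ℝ) ≤ 2 * (Δ * M) * (4 * (√Δ * M)) := by gcongr
          _ = _ := by ring
    calc (s'.card : ℝ) ≤ (⌊C * (M : ℝ) ^ (1 / 50 : ℝ)⌋₊ : ℝ) * t.card := by exact_mod_cast hcard
      _ ≤ C * (M : ℝ) ^ (1 / 50 : ℝ) * (2 * D * (2 * B + 1)) := by
          have : (t.card : ℝ) ≤ 2 * D * (2 * B + 1) := by exact_mod_cast ht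
          gcongr
      _ ≤ C * (M : ℝ) ^ (1 / 50 : ℝ) * (8 * Δ ^ (3 / 2 : ℝ) * (M : ℝ) ^ 2) := by gcongr
      _ = _ := by ring

end

section
open Quaternion Finset

/-- The multiplicity of the `(2j+1)`-dimensional irreducible representation of the group of unit
quaternions in the `2L`-th tensor power of its standard representation. -/
noncomputable def tensorMult (L j : ℕ) : ℝ :=
  ((2 * L).choose (L + j) : ℝ) - (2 * L).choose (L + j + 1)

lemma choose_succ_ratio (L j : ℕ) (hj : j ≤ L) :
    ((2 * L).choose (L + j + 1) : ℝ) * (L + j + 1) = (2 * L).choose (L + j) * (L - j) := by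
  have := Nat.choose_succ_right_eq (2 * L) (L + j)
  have h2 : ((2 * L - (L + j) : ℕ) : ℝ) = L - j := by
    rw [show 2 * L - (L + j) = L - j by omega, Nat.cast_sub hj]
  rw [← h2]
  exact_mod_cast this

lemma tensorMult_mul (L j : ℕ) (hj : j ≤ L) :
    tensorMult L j * (L + j + 1) = (2 * L).choose (L + j) * (2 * j + 1) := by
  have := choose_succ_ratio L j hj
  rw [tensorMult]
  linear_combination -this

lemma tensorMult_nonneg (L j : ℕ) (hj : j ≤ L) : 0 ≤ tensorMult L j := by
  have h := tensorMult_mul L j hj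
  have h1 : (0 : ℝ) < L + j + 1 := by positivity
  have h2 : (0 : ℝ) ≤ (2 * L).choose (L + j) * (2 * j + 1) := by positivity
  rw [← h] at h2
  exact nonneg_of_mul_nonneg_left h2 h1

lemma sum_tensorMult_Ico (L d : ℕ) (hd : d ≤ L) :
    ∑ j ∈ Finset.Ico d (L + 1), tensorMult L j = (2 * L).choose (L + d) := by
  have key : ∀ n, d ≤ n → ∑ j ∈ Finset.Ico d n, tensorMult L j =
      ((2 * L).choose (L + d) : ℝ) - (2 * L).choose (L + n) := by
    intro n hn
    induction n, hn using Nat.le_induction with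
    | base => simp
    | succ n hn ih =>
      rw [Finset.sum_Ico_succ_top hn, ih, tensorMult, ← add_assoc]; ring
  rw [key _ (by omega), Nat.choose_eq_zero_of_lt (by omega : 2 * L < L + (L + 1))]
  simp

lemma one_add_pow_eq_sum_tensorMult (w : ℂ) (L : ℕ) :
    (w + 1) ^ (2 * L) = ∑ j ∈ range (L + 1), (tensorMult L j : ℂ) *
      ∑ i ∈ Finset.Icc (L - j) (L + j), w ^ i := by
  have h1 : ∀ j ∈ range (L + 1), (tensorMult L j : ℂ) * ∑ i ∈ Finset.Icc (L - j) (L + j), w ^ i =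
      ∑ i ∈ range (2 * L + 1),
        if L - j ≤ i ∧ i ≤ L + j then (tensorMult L j : ℂ) * w ^ i else 0 := by
    intro j hj
    rw [Finset.mem_range] at hj
    rw [Finset.mul_sum, ← Finset.sum_filter]
    refine Finset.sum_congr ?_ fun _ _ => rfl
    ext i
    simp only [Finset.mem_Icc, Finset.mem_filter, Finset.mem_range]
    omega
  rw [Finset.sum_congr rfl h1, Finset.sum_comm, add_pow]
  refine Finset.sum_congr rfl fun i hi => ?_
  rw [Finset.mem_range] at hi
  rw [← Finset.sum_filter, ← Finset.sum_mul, one_pow, mul_one, mul_comm]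
  congr 1
  rcases le_total i L with h | h
  · have := sum_tensorMult_Ico L (L - i) (by omega)
    rw [show L + (L - i) = 2 * L - i by omega, Nat.choose_symm (by omega)] at this
    rw [← Complex.ofReal_natCast, ← this, Complex.ofReal_sum]
    refine Finset.sum_congr ?_ fun _ _ => rfl
    ext j
    simp only [Finset.mem_Ico, Finset.mem_filter, Finset.mem_range]
    omega
  · have := sum_tensorMult_Ico L (i - L) (by omega)
    rw [show L + (i - L) = i by omega] at this
    rw [← Complex.ofReal_natCast, ← this, Complex.ofReal_sum]
    refine Finset.sum_congr ?_ fun _ _ => rfl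
    ext j
    simp only [Finset.mem_Ico, Finset.mem_filter, Finset.mem_range]
    omega

lemma sixteen_pow_le (L : ℕ) (hL : 1 ≤ L) :
    (16 : ℝ) ^ L ≤ 4 * L * ((2 * L).choose L : ℝ) ^ 2 := by
  simp only [← Nat.centralBinom_eq_two_mul_choose]
  induction L, hL using Nat.le_induction with
  | base => norm_num [Nat.centralBinom]
  | succ n hn ih =>
    have h : ((n : ℝ) + 1) * (n + 1).centralBinom = 2 * (2 * n + 1) * n.centralBinom := by
      exact_mod_cast Nat.succ_mul_centralBinom_succ n
    have hn0 : (0 : ℝ) < n + 1 := by positivity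
    have h2 : ((n : ℝ) + 1) ^ 2 * ((n + 1).centralBinom : ℝ) ^ 2 =
        4 * (2 * n + 1) ^ 2 * (n.centralBinom : ℝ) ^ 2 := by
      rw [← mul_pow, h]; ring
    rw [pow_succ]
    have h3 : (16 : ℝ) ^ n * 16 * (n + 1) ≤
        4 * ((n + 1) ^ 2 * ((n + 1).centralBinom : ℝ) ^ 2) := by
      rw [h2]
      have := mul_le_mul_of_nonneg_right ih (by positivity : (0 : ℝ) ≤ 16 * (n + 1))
      nlinarith [sq_nonneg (n.centralBinom : ℝ)]
    push_cast
    refine le_of_mul_le_mul_right ?_ hn0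
    linarith

lemma tensorMult_lower (m : ℕ) (hm : 1 ≤ m) :
    (4 : ℝ) ^ (4 * m ^ 2) / (16 * m ^ 2) ≤ tensorMult (4 * m ^ 2) m := by
  set L := 4 * m ^ 2 with hL
  have hm1 : (1 : ℝ) ≤ m := by exact_mod_cast hm
  have hLr : (L : ℝ) = 4 * m ^ 2 := by rw [hL]; push_cast; ring
  have hL0 : (0 : ℝ) < L := by rw [hLr]; positivity
  have hmL : m ≤ L := by nlinarith
  set b := ((2 * L).choose L : ℝ)
  have hb0 : 0 ≤ b := by positivity
  have hb : (4 : ℝ) ^ L ≤ 4 * m * b := by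
    have h1 := sixteen_pow_le L (by nlinarith)
    have h2 : ((4 : ℝ) ^ L) ^ 2 ≤ (4 * m * b) ^ 2 := by
      rw [← pow_mul, mul_comm, pow_mul]
      norm_num
      refine h1.trans_eq ?_
      rw [hLr]; ring
    exact le_of_sq_le_sq h2 (by positivity)
  have hprod : ∀ j : ℕ, j ≤ m → b * (1 - j ^ 2 / L) ≤ (2 * L).choose (L + j) := by
    intro j
    induction j with
    | zero => intro _; simp [b]
    | succ j ih =>
      intro hj
      have ih := ih (by omega)
      have h1 := choose_succ_ratio L j (by omega)
      have hjm : (j : ℝ) + 1 ≤ m := by exact_mod_cast hj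
      have hj0 : (0 : ℝ) ≤ j := by positivity
      have hpos : (0 : ℝ) < L + j + 1 := by positivity
      have h2 : ((2 * L).choose (L + (j + 1)) : ℝ) =
          (2 * L).choose (L + j) * ((L - j) / (L + j + 1)) := by
        rw [← mul_div_assoc, eq_div_iff hpos.ne', ← h1, ← add_assoc]
      have h3 : 1 - (2 * j + 1) / L ≤ ((L : ℝ) - j) / (L + j + 1) := by
        rw [le_div_iff₀ hpos, one_sub_div hL0.ne', div_mul_eq_mul_div, div_le_iff₀ hL0]
        nlinarith
      have h4 : (0 : ℝ) ≤ 1 - (2 * j + 1) / L := by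
        rw [sub_nonneg, div_le_one hL0, hLr]; nlinarith
      rw [h2]
      calc b * (1 - ((j + 1 : ℕ) : ℝ) ^ 2 / (L : ℝ))
          ≤ b * (1 - (j : ℝ) ^ 2 / L) * (1 - (2 * (j : ℝ) + 1) / L) := by
            rw [mul_assoc]
            refine mul_le_mul_of_nonneg_left ?_ hb0
            have : (0 : ℝ) ≤ (j ^ 2 / L) * ((2 * j + 1) / L) := by positivity
            have e : ((j + 1 : ℕ) : ℝ) ^ 2 / L = j ^ 2 / L + (2 * j + 1) / L := by
              push_cast; ring
            rw [e]; nlinarith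
        _ ≤ ((2 * L).choose (L + j) : ℝ) * (1 - (2 * (j : ℝ) + 1) / L) :=
            mul_le_mul_of_nonneg_right ih h4
        _ ≤ ((2 * L).choose (L + j) : ℝ) * ((L - j) / (L + j + 1)) :=
            mul_le_mul_of_nonneg_left h3 (by positivity)
  have h1 := hprod m le_rfl
  have h2 : (1 : ℝ) - m ^ 2 / L = 3 / 4 := by
    rw [hLr]; field_simp; norm_num
  rw [h2] at h1
  have h3 := tensorMult_mul L m hmL
  have h4 : (0 : ℝ) ≤ tensorMult L m := tensorMult_nonneg L m hmL
  rw [div_le_iff₀ (by positivity)]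
  have h5 : (L + m + 1 : ℝ) ≤ 6 * m ^ 2 := by rw [hLr]; nlinarith
  have h6 : b * (3 / 4) * (2 * m + 1) ≤ tensorMult L m * (6 * m ^ 2) := by
    calc _ ≤ (2 * L).choose (L + m) * (2 * m + 1 : ℝ) :=
          mul_le_mul_of_nonneg_right h1 (by positivity)
      _ = tensorMult L m * (L + m + 1) := h3.symm
      _ ≤ _ := mul_le_mul_of_nonneg_left h5 h4
  nlinarith

end

section
open Quaternion Finset

lemma wordSum_mono (n : ℕ) : ∀ {F G : ℍ[ℤ] → ℝ}, (∀ x, F x ≤ G x) → wordSum n F ≤ wordSum n G := by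
  induction n with
  | zero => intro F G h; exact h 1
  | succ n ih => intro F G h; exact Finset.sum_le_sum fun q _ => ih fun x => h _

lemma wordSum_add_const (n : ℕ) : ∀ (F : ℍ[ℤ] → ℝ) (c : ℝ),
    wordSum n (fun x => c + F x) = 64 ^ n * c + wordSum n F := by
  induction n with
  | zero => intro F c; simp [wordSum]
  | succ n ih =>
    intro F c
    simp only [wordSum, ih, Finset.sum_add_distrib, Finset.sum_const, card_shell_seven,
      nsmul_eq_mul]
    push_cast
    ring

lemma wordSum_mul_left (n : ℕ) : ∀ (F : ℍ[ℤ] → ℝ) (c : ℝ),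
    wordSum n (fun x => c * F x) = c * wordSum n F := by
  induction n with
  | zero => intro F c; simp [wordSum]
  | succ n ih => intro F c; simp only [wordSum, ih, Finset.mul_sum]

/-- The squared cosine of the angle between a quaternion and the real axis. -/
noncomputable def cosSq (x : ℍ[ℤ]) : ℝ := (x.re : ℝ) ^ 2 / (normSq x : ℤ)

lemma cosSq_nonneg (x : ℍ[ℤ]) : 0 ≤ cosSq x := by
  have : (0 : ℝ) ≤ (normSq x : ℤ) := by exact_mod_cast normSq_nonneg
  exact div_nonneg (sq_nonneg _) this

lemma cosSq_le_one (x : ℍ[ℤ]) : cosSq x ≤ 1 := by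
  have h0 : (0 : ℝ) ≤ (normSq x : ℤ) := by exact_mod_cast normSq_nonneg
  refine div_le_one_of_le₀ ?_ h0
  rw [normSq_def']; push_cast
  nlinarith [sq_nonneg (x.imI : ℝ), sq_nonneg (x.imJ : ℝ), sq_nonneg (x.imK : ℝ)]

lemma cosSq_smul (x : ℍ[ℤ]) : cosSq ((7 : ℤ) • x) = cosSq x := by
  have h : (normSq ((7 : ℤ) • x) : ℤ) = 49 * normSq x := by rw [normSq_smul]; ring
  rw [cosSq, cosSq, h, re_smul, smul_eq_mul]
  push_cast
  rw [mul_pow, show (7 : ℝ) ^ 2 = 49 by norm_num, mul_div_mul_left _ _ (by norm_num)]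

open scoped Classical in
lemma exists_wordSum_cosSq_le : ∃ C : ℝ, 0 < C ∧ ∀ k L : ℕ, ∀ Δ : ℝ, 0 < Δ → Δ ≤ 1 →
    wordSum (2 * k) (fun x => cosSq x ^ L) ≤ 64 ^ (2 * k) * ((1 - Δ) ^ (2 * L) +
      2 * (1 / 2) ^ k + C * Δ ^ (3 / 2 : ℝ) * (57 / 56) ^ (2 * k) *
        ((7 : ℝ) ^ k) ^ (1 / 50 : ℝ)) := by
  obtain ⟨C, hC, hcap⟩ := exists_card_cap_le
  refine ⟨C, hC, fun k L Δ hΔ hΔ1 => ?_⟩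
  set G : ℍ[ℤ] → ℝ := fun x => if (1 - Δ) ^ 2 ≤ cosSq x then 1 else 0 with hG
  have hsplit : ∀ x, cosSq x ^ L ≤ (1 - Δ) ^ (2 * L) + G x := by
    intro x
    have h0 := cosSq_nonneg x
    by_cases h : (1 - Δ) ^ 2 ≤ cosSq x
    · have h1 : cosSq x ^ L ≤ 1 := pow_le_one₀ h0 (cosSq_le_one x)
      have h2 : (0 : ℝ) ≤ (1 - Δ) ^ (2 * L) := by rw [pow_mul]; positivity
      simp only [hG, if_pos h]
      linarith
    · simp only [hG, if_neg h, add_zero]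
      rw [pow_mul]
      exact pow_le_pow_left₀ h0 (not_le.1 h).le L
  refine (wordSum_mono _ hsplit).trans ?_
  rw [wordSum_add_const, mul_add, mul_add, add_assoc]
  refine add_le_add_right ?_ _
  refine (wordSum_le (2 * k) G (fun x => by simp only [hG]; split_ifs <;> norm_num)
    (fun x => by simp only [hG, cosSq_smul])).trans ?_
  have hterm : ∀ j ∈ range (2 * k / 2 + 1),
      ((2 * k).choose j * 8 ^ (2 * k - j) * 64 ^ j : ℝ) * ∑ y ∈ shell (7 ^ (2 * k - 2 * j)), G y ≤
      64 ^ (2 * k) * ((2 * k).choose j * (2 * (1 / 8) ^ k)) +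
      64 ^ (2 * k) * (C * Δ ^ (3 / 2 : ℝ) * ((7 : ℝ) ^ k) ^ (1 / 50 : ℝ)) *
        ((1 / 7) ^ j * (7 / 8) ^ (2 * k - j) * (2 * k).choose j) := by
    intro j hj
    have hjk : j ≤ k := by rw [Finset.mem_range] at hj; omega
    have hs : ∑ y ∈ shell (7 ^ (2 * k - 2 * j)), G y ≤
        2 + C * Δ ^ (3 / 2 : ℝ) * (7 ^ (k - j)) ^ 2 * ((7 : ℝ) ^ k) ^ (1 / 50 : ℝ) := by
      have hc := hcap (7 ^ (k - j)) (Nat.one_le_pow _ _ (by norm_num)) Δ hΔ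
      have e : 7 ^ (2 * k - 2 * j) = (7 ^ (k - j)) ^ 2 := by
        rw [← pow_mul]; congr 1; omega
      rw [e]
      set M : ℕ := 7 ^ (k - j) with hM
      have hMr : (7 : ℝ) ^ (k - j) = M := by rw [hM]; push_cast; rfl
      have hM0 : (0 : ℝ) < M := by rw [← hMr]; positivity
      rw [hMr]
      refine le_trans ?_ (hc.trans ?_)
      · rw [Finset.sum_ite, Finset.sum_const_zero, add_zero, Finset.sum_const, nsmul_eq_mul,
          mul_one]
        refine Nat.cast_le.2 (Finset.card_le_card fun y hy => ?_)
        rw [Finset.mem_filter] at hy ⊢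
        refine ⟨hy.1, ?_⟩
        have h1 := hy.2
        have h2 : (normSq y : ℤ) = (M : ℤ) ^ 2 := by
          rw [mem_shell.1 hy.1]; push_cast; rfl
        rw [cosSq, h2, le_div_iff₀ (by push_cast; positivity)] at h1
        push_cast at h1
        refine abs_le_of_sq_le_sq' ?_ (abs_nonneg _) |>.2
        rw [sq_abs]; linarith
      · gcongr
        rw [← hMr]
        exact pow_le_pow_right₀ (by norm_num) (by omega)
    have h8 : (8 : ℝ) ^ (2 * k - j) * 64 ^ j = 64 ^ (2 * k) * (1 / 8) ^ (2 * k - j) := by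
      have : (64 : ℝ) ^ (2 * k) = 64 ^ (2 * k - j) * 64 ^ j := by
        rw [← pow_add]; congr 1; omega
      rw [this, mul_right_comm, ← mul_pow]; norm_num
    have h78 : (7 / 8 : ℝ) ^ (2 * k - j) * (1 / 7) ^ j = (1 / 8) ^ (2 * k - j) *
        (7 ^ (k - j)) ^ 2 := by
      have e : 2 * k - j = (k - j) * 2 + j := by omega
      rw [← pow_mul, div_pow, e, pow_add, pow_add, div_pow, div_pow, one_pow, one_pow,
        pow_add (8 : ℝ)]
      field_simp
    have h18 : (1 / 8 : ℝ) ^ (2 * k - j) ≤ (1 / 8) ^ k :=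
      pow_le_pow_of_le_one (by norm_num) (by norm_num) (by omega)
    calc _ ≤ ((2 * k).choose j * 8 ^ (2 * k - j) * 64 ^ j : ℝ) *
          (2 + C * Δ ^ (3 / 2 : ℝ) * (7 ^ (k - j)) ^ 2 * ((7 : ℝ) ^ k) ^ (1 / 50 : ℝ)) :=
        mul_le_mul_of_nonneg_left hs (by positivity)
      _ = 64 ^ (2 * k) * ((2 * k).choose j * (2 * (1 / 8) ^ (2 * k - j))) +
          64 ^ (2 * k) * (C * Δ ^ (3 / 2 : ℝ) * ((7 : ℝ) ^ k) ^ (1 / 50 : ℝ)) *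
          ((1 / 7) ^ j * (7 / 8) ^ (2 * k - j) * (2 * k).choose j) := by
        rw [mul_assoc ((2 * k).choose j : ℝ), h8, mul_comm ((1 / 7 : ℝ) ^ j), h78]; ring
      _ ≤ _ := by gcongr
  refine (Finset.sum_le_sum hterm).trans ?_
  rw [Finset.sum_add_distrib, ← Finset.mul_sum, ← Finset.mul_sum, ← Finset.sum_mul]
  have hsub : range (2 * k / 2 + 1) ⊆ range (2 * k + 1) := by
    intro j hj; rw [Finset.mem_range] at *; omega
  have h1 : ∑ j ∈ range (2 * k / 2 + 1), ((2 * k).choose j : ℝ) ≤ 4 ^ k := by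
    refine (Finset.sum_le_sum_of_subset_of_nonneg hsub fun _ _ _ => by positivity).trans ?_
    have := Nat.sum_range_choose (2 * k)
    rw [pow_mul] at this
    exact_mod_cast this.le
  have h2 : ∑ j ∈ range (2 * k / 2 + 1),
      ((1 / 7 : ℝ) ^ j * (7 / 8) ^ (2 * k - j) * (2 * k).choose j) ≤ (57 / 56) ^ (2 * k) := by
    refine (Finset.sum_le_sum_of_subset_of_nonneg hsub fun _ _ _ => by positivity).trans ?_
    rw [← add_pow]; norm_num
  refine add_le_add ?_ ?_
  · refine mul_le_mul_of_nonneg_left ?_ (by positivity)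
    refine (mul_le_mul_of_nonneg_right h1 (by positivity)).trans_eq ?_
    rw [mul_left_comm, ← mul_pow]; norm_num
  · rw [mul_assoc]
    refine mul_le_mul_of_nonneg_left ?_ (by positivity)
    refine (mul_le_mul_of_nonneg_left h2 (by positivity)).trans_eq ?_
    ring

lemma exp_neg_le (y : ℝ) (hy : 0 < y) : Real.exp (-y) ≤ Nat.factorial 14 / y ^ 14 := by
  have := Real.pow_div_factorial_le_exp y hy.le 14
  rw [Real.exp_neg, inv_eq_one_div]
  rw [div_le_div_iff₀ (Real.exp_pos _) (by positivity)]
  rw [div_le_iff₀ (by positivity)] at this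
  linarith

/-- If `x ↦ |λ|` obeys the trace inequality in all tensor powers, then `λ` is bounded away
from the trivial bound once the degree is large. -/
theorem exists_large_degree_bound : ∃ m₀ : ℕ, 1 ≤ m₀ ∧ ∀ m : ℕ, m₀ ≤ m → ∀ l : ℝ,
    (∀ k L : ℕ, m ≤ L →
      tensorMult L m * l ^ (2 * k) ≤ wordSum (2 * k) (fun x => (4 * cosSq x) ^ L)) →
    |l| ≤ 99 / 100 * 64 := by
  obtain ⟨C, hC, hw⟩ := exists_wordSum_cosSq_le
  set D : ℝ := 2 ^ 28 * (Nat.factorial 14 + 2 + C) with hD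
  obtain ⟨s₀, hs₀⟩ := pow_unbounded_of_one_lt D (show (1 : ℝ) < 4 by norm_num)
  refine ⟨(2 ^ 12) ^ s₀, Nat.one_le_pow _ _ (by norm_num), fun m hm l hl => ?_⟩
  have hm0 : m ≠ 0 := by
    have : 1 ≤ (2 ^ 12) ^ s₀ := Nat.one_le_pow _ _ (by norm_num)
    omega
  set s := Nat.log (2 ^ 12) m with hs
  have hs1 : (2 ^ 12) ^ s ≤ m := Nat.pow_log_le_self _ hm0
  have hs2 : m < (2 ^ 12) ^ (s + 1) := Nat.lt_pow_succ_log_self (by norm_num) m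
  have hss : s₀ ≤ s := Nat.le_log_of_pow_le (by norm_num) hm
  set x : ℝ := 2 ^ s with hx
  have hx1 : 1 ≤ x := one_le_pow₀ (by norm_num)
  have hx0 : 0 < x := by positivity
  have hmx1 : x ^ 12 ≤ m := by
    rw [hx, ← pow_mul, mul_comm, pow_mul]; exact_mod_cast hs1
  have hmx2 : (m : ℝ) ≤ 2 ^ 12 * x ^ 12 := by
    rw [hx, ← pow_mul, mul_comm s, pow_mul, ← pow_succ']; exact_mod_cast hs2.le
  have hb := tensorMult_lower m (by omega)
  have h1 := hl (36 * s) (4 * m ^ 2) (by nlinarith [Nat.pos_of_ne_zero hm0])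
  have hΔ1 : (x ^ 22)⁻¹ ≤ 1 := inv_le_one_of_one_le₀ (one_le_pow₀ hx1)
  have h2 := hw (36 * s) (4 * m ^ 2) (x ^ 22)⁻¹ (by positivity) hΔ1
  have hmr : (1 : ℝ) ≤ m := by exact_mod_cast Nat.one_le_iff_ne_zero.2 hm0
  simp only [mul_pow (4 : ℝ)] at h1
  rw [wordSum_mul_left] at h1
  have t1 : (1 - (x ^ 22)⁻¹) ^ (2 * (4 * m ^ 2)) ≤ Nat.factorial 14 * (x ^ 28)⁻¹ := by
    have : (1 - (x ^ 22)⁻¹) ^ (2 * (4 * m ^ 2)) ≤ Real.exp (-(x ^ 2)) := by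
      have e := Real.one_sub_le_exp_neg (x ^ 22)⁻¹
      refine (pow_le_pow_left₀ (by linarith) e _).trans ?_
      rw [← Real.exp_nat_mul]
      refine Real.exp_le_exp.2 ?_
      push_cast
      have : x ^ 24 ≤ (m : ℝ) ^ 2 := by
        have := pow_le_pow_left₀ (by positivity) hmx1 2
        rwa [← pow_mul] at this
      rw [mul_neg, neg_le_neg_iff, ← div_eq_mul_inv, le_div_iff₀ (by positivity), ← pow_add]
      norm_num
      nlinarith [sq_nonneg (m : ℝ)]
    refine this.trans ((exp_neg_le _ (by positivity)).trans_eq ?_)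
    rw [← pow_mul]; rfl
  have t2 : (1 / 2 : ℝ) ^ (36 * s) = (x ^ 36)⁻¹ := by
    rw [hx, ← pow_mul, mul_comm s, one_div, inv_pow]
  have t3 : ((x ^ 22)⁻¹) ^ (3 / 2 : ℝ) = (x ^ 33)⁻¹ := by
    rw [Real.inv_rpow (by positivity), ← Real.rpow_natCast, ← Real.rpow_mul hx0.le,
      ← Real.rpow_natCast]
    norm_num
  have t4 : (57 / 56 : ℝ) ^ (2 * (36 * s)) ≤ x ^ 2 := by
    rw [hx, ← pow_mul, mul_comm s, ← mul_assoc, pow_mul, pow_mul (2 : ℝ)]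
    exact pow_le_pow_left₀ (by norm_num) (by norm_num) _
  have t5 : ((7 : ℝ) ^ (36 * s)) ^ (1 / 50 : ℝ) ≤ x ^ 3 := by
    have : ((7 : ℝ) ^ (36 * s)) ^ (1 / 50 : ℝ) ≤ ((7 ^ s) ^ 50) ^ (1 / 50 : ℝ) := by
      refine Real.rpow_le_rpow (by positivity) ?_ (by norm_num)
      rw [← pow_mul]
      exact pow_le_pow_right₀ (by norm_num) (by omega)
    refine this.trans ?_
    have e : (((7 : ℝ) ^ s) ^ 50) ^ (1 / 50 : ℝ) = 7 ^ s := by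
      rw [one_div]
      exact_mod_cast Real.pow_rpow_inv_natCast (by positivity : (0 : ℝ) ≤ 7 ^ s)
        (n := 50) (by norm_num)
    rw [e, hx, ← pow_mul, mul_comm s, pow_mul]
    exact pow_le_pow_left₀ (by norm_num) (by norm_num) _
  set W := wordSum (2 * (36 * s)) (fun x => cosSq x ^ (4 * m ^ 2)) with hW
  set y : ℝ := (l / 64) ^ (2 * (36 * s)) with hy
  have hy0 : 0 ≤ y := by rw [hy, pow_mul]; positivity
  have hly : l ^ (2 * (36 * s)) = 64 ^ (2 * (36 * s)) * y := by
    rw [hy, ← mul_pow]; congr 1; ring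
  have h3 : y ≤ 16 * m ^ 2 * ((1 - (x ^ 22)⁻¹) ^ (2 * (4 * m ^ 2)) +
      2 * (1 / 2) ^ (36 * s) + C * ((x ^ 22)⁻¹) ^ (3 / 2 : ℝ) * (57 / 56) ^ (2 * (36 * s)) *
        ((7 : ℝ) ^ (36 * s)) ^ (1 / 50 : ℝ)) := by
    have a1 : (4 : ℝ) ^ (4 * m ^ 2) / (16 * m ^ 2) * (64 ^ (2 * (36 * s)) * y) ≤
        4 ^ (4 * m ^ 2) * W := by
      rw [← hly]
      refine le_trans (mul_le_mul_of_nonneg_right hb ?_) h1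
      rw [pow_mul]; positivity
    have a2 := a1.trans (mul_le_mul_of_nonneg_left h2 (by positivity))
    rw [div_mul_eq_mul_div, div_le_iff₀ (by positivity), mul_assoc, mul_assoc] at a2
    have a3 := le_of_mul_le_mul_left a2 (by positivity)
    have a4 := le_of_mul_le_mul_left a3 (by positivity)
    exact a4.trans_eq (mul_comm _ _)
  have h4 : y ≤ D * (x ^ 4)⁻¹ := by
    refine h3.trans ?_
    have m2 : 16 * (m : ℝ) ^ 2 ≤ 2 ^ 28 * x ^ 24 := by
      have := pow_le_pow_left₀ (by positivity) hmx2 2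
      rw [mul_pow, ← pow_mul, ← pow_mul] at this
      norm_num at this ⊢
      linarith
    rw [t2, t3]
    have i1 : (x ^ 36)⁻¹ ≤ (x ^ 28)⁻¹ :=
      inv_anti₀ (by positivity) (pow_le_pow_right₀ hx1 (by norm_num))
    have i2 : C * (x ^ 33)⁻¹ * (57 / 56) ^ (2 * (36 * s)) * ((7 : ℝ) ^ (36 * s)) ^ (1 / 50 : ℝ) ≤
        C * (x ^ 28)⁻¹ := by
      calc _ ≤ C * (x ^ 33)⁻¹ * x ^ 2 * x ^ 3 := by gcongr
        _ = _ := by field_simp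
    calc _ ≤ 2 ^ 28 * x ^ 24 * (Nat.factorial 14 * (x ^ 28)⁻¹ + 2 * (x ^ 28)⁻¹ +
          C * (x ^ 28)⁻¹) := by gcongr
      _ = _ := by rw [hD]; field_simp
  by_contra hcon
  push Not at hcon
  have hlam : 99 / 100 ≤ |l / 64| := by
    rw [abs_div, le_div_iff₀ (by norm_num)]; norm_num; linarith
  have h5 : (1 / 4 : ℝ) ^ s ≤ y := by
    rw [hy, ← mul_assoc, pow_mul]
    refine pow_le_pow_left₀ (by norm_num) ?_ _
    rw [← Even.pow_abs (by decide)]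
    refine le_trans ?_ (pow_le_pow_left₀ (by norm_num) hlam _)
    norm_num
  have h6 : (1 / 4 : ℝ) ^ s = (x ^ 2)⁻¹ := by
    rw [hx, ← pow_mul, mul_comm s, pow_mul, one_div, inv_pow]; norm_num
  have h7 : x ^ 2 ≤ D := by
    have := h5.trans h4
    rw [h6, ← div_eq_mul_inv, inv_eq_one_div,
      div_le_div_iff₀ (by positivity) (by positivity)] at this
    have e : x ^ 4 = x ^ 2 * x ^ 2 := by ring
    rw [e, one_mul] at this
    exact le_of_mul_le_mul_right this (by positivity)
  have h8 : (4 : ℝ) ^ s₀ ≤ x ^ 2 := by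
    rw [hx, ← pow_mul, mul_comm s, pow_mul]
    norm_num
    exact pow_le_pow_right₀ (by norm_num) hss
  linarith

end

section
open Quaternion Finset
open scoped InnerProductSpace

section SymmetricOperators
variable {V : Type*} [NormedAddCommGroup V] [InnerProductSpace ℂ V] [FiniteDimensional ℂ V]
  {T : V →ₗ[ℂ] V}

lemma LinearMap.IsSymmetric.re_trace_pow (hT : T.IsSymmetric) (k : ℕ) :
    (LinearMap.trace ℂ V (T ^ k)).re = ∑ i, hT.eigenvalues rfl i ^ k := by
  have h : ∀ i, (T ^ k) (hT.eigenvectorBasis rfl i) =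
      ((hT.eigenvalues rfl i ^ k : ℝ) : ℂ) • hT.eigenvectorBasis rfl i := by
    intro i
    have := (hT.hasEigenvector_eigenvectorBasis rfl i).pow_apply k
    rw [this]; push_cast; rfl
  rw [LinearMap.trace_eq_sum_inner _ (hT.eigenvectorBasis rfl), Complex.re_sum]
  refine Finset.sum_congr rfl fun i _ => ?_
  rw [h, inner_smul_right, inner_self_eq_norm_sq_to_K, OrthonormalBasis.norm_eq_one]
  norm_num [← Complex.ofReal_pow]

lemma LinearMap.IsSymmetric.re_inner_le (hT : T.IsSymmetric) (c : ℝ)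
    (h : ∀ i, hT.eigenvalues rfl i ≤ c) (x : V) : (⟪x, T x⟫_ℂ).re ≤ c * ‖x‖ ^ 2 := by
  set b := hT.eigenvectorBasis rfl with hb
  rw [← b.sum_inner_mul_inner x (T x), Complex.re_sum]
  have e : ‖x‖ ^ 2 = ∑ i, ‖⟪b i, x⟫_ℂ‖ ^ 2 := (b.sum_sq_norm_inner_right x).symm
  rw [e, Finset.mul_sum]
  refine Finset.sum_le_sum fun i _ => ?_
  have h1 : ⟪b i, T x⟫_ℂ = (hT.eigenvalues rfl i : ℂ) * ⟪b i, x⟫_ℂ := by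
    rw [← hT, hT.apply_eigenvectorBasis, inner_smul_left, RCLike.conj_ofReal]
    rfl
  have h2 : ⟪x, b i⟫_ℂ * ⟪b i, T x⟫_ℂ = ((hT.eigenvalues rfl i * ‖⟪b i, x⟫_ℂ‖ ^ 2 : ℝ) : ℂ) := by
    rw [h1, ← inner_conj_symm x (b i), mul_left_comm, Complex.conj_mul']
    push_cast; rfl
  rw [h2, Complex.ofReal_re]
  exact mul_le_mul_of_nonneg_right (h i) (sq_nonneg _)

end SymmetricOperators

/-- An isometric right action of a group on a complex inner product space, with an increasing
sequence of invariant finite-dimensional subspaces. -/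
structure IsometricTower (G E : Type*) [Group G] [NormedAddCommGroup E]
    [InnerProductSpace ℂ E] where
  U : G → E →ₗᵢ[ℂ] E
  map_one : ∀ x, U 1 x = x
  map_mul : ∀ g h x, U (g * h) x = U h (U g x)
  Q : ℕ → Submodule ℂ E
  finite : ∀ m, FiniteDimensional ℂ (Q m)
  mono : Monotone Q
  inv : ∀ g m, ∀ x ∈ Q m, U g x ∈ Q m

namespace IsometricTower
variable {G E : Type*} [Group G] [NormedAddCommGroup E] [InnerProductSpace ℂ E]
  (A : IsometricTower G E)

instance (m : ℕ) : FiniteDimensional ℂ (A.Q m) := A.finite m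

/-- The subspace of the tower preceding the `m`-th one. -/
noncomputable def below : ℕ → Submodule ℂ E
  | 0 => ⊥
  | m + 1 => A.Q m

instance (m : ℕ) : FiniteDimensional ℂ (A.below m) := by
  cases m
  · exact inferInstanceAs (FiniteDimensional ℂ (⊥ : Submodule ℂ E))
  · exact A.finite _

/-- The orthogonal complement of each subspace of the tower in the next one. -/
noncomputable def layer (m : ℕ) : Submodule ℂ E := A.Q m ⊓ (A.below m)ᗮ

instance (m : ℕ) : FiniteDimensional ℂ (A.layer m) :=
  Submodule.finiteDimensional_of_le (inf_le_left : A.layer m ≤ A.Q m)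

lemma below_le (m : ℕ) : A.below m ≤ A.Q m := by
  cases m
  · exact bot_le
  · exact A.mono (Nat.le_succ _)

lemma apply_inv_apply (g : G) (x : E) : A.U g (A.U g⁻¹ x) = x := by
  rw [← A.map_mul, inv_mul_cancel, A.map_one]

lemma inner_apply_left (g : G) (x y : E) : ⟪A.U g x, y⟫_ℂ = ⟪x, A.U g⁻¹ y⟫_ℂ := by
  rw [← (A.U g).inner_map_map x, A.apply_inv_apply]

lemma apply_mem_below (g : G) (m : ℕ) (x : E) (hx : x ∈ A.below m) : A.U g x ∈ A.below m := by
  cases m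
  · rw [below, Submodule.mem_bot] at *; rw [hx, LinearIsometry.map_zero]
  · exact A.inv g _ x hx

lemma apply_mem_below_orthogonal (g : G) (m : ℕ) (x : E) (hx : x ∈ (A.below m)ᗮ) :
    A.U g x ∈ (A.below m)ᗮ := by
  rw [Submodule.mem_orthogonal'] at *
  intro y hy
  rw [A.inner_apply_left]
  exact hx _ (A.apply_mem_below _ _ _ hy)

lemma apply_mem_layer (g : G) (m : ℕ) (x : E) (hx : x ∈ A.layer m) : A.U g x ∈ A.layer m :=
  ⟨A.inv g m x hx.1, A.apply_mem_below_orthogonal g m x hx.2⟩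

/-- The restriction of the action to a layer. -/
noncomputable def onLayer (m : ℕ) (g : G) : A.layer m →ₗ[ℂ] A.layer m :=
  (A.U g).toLinearMap.restrict (A.apply_mem_layer g m)

@[simp] lemma coe_onLayer (m : ℕ) (g : G) (x : A.layer m) : (A.onLayer m g x : E) = A.U g x := rfl

lemma onLayer_one (m : ℕ) : A.onLayer m 1 = LinearMap.id := by
  ext x; simp [A.map_one]

lemma onLayer_mul (m : ℕ) (g h : G) : A.onLayer m (g * h) = A.onLayer m h * A.onLayer m g := by
  ext x; simp [A.map_mul]

variable (d : ℍ[ℤ] → G)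

/-- The sum of the actions of the integer quaternions of norm `7` on a layer. -/
noncomputable def step (m : ℕ) : A.layer m →ₗ[ℂ] A.layer m := ∑ q ∈ shell 7, A.onLayer m (d q)

lemma ne_zero_of_mem_shell {q : ℍ[ℤ]} (hq : q ∈ shell 7) : q ≠ 0 := by
  rintro rfl
  rw [mem_shell] at hq
  simp at hq

variable {d}

lemma step_isSymmetric (hstar : ∀ x ≠ 0, d (star x) = (d x)⁻¹) (m : ℕ) :
    (A.step d m).IsSymmetric := by
  intro x y
  simp only [step, LinearMap.sum_apply, sum_inner, inner_sum]
  refine Finset.sum_nbij' star star (fun q => star_mem_shell) (fun q => star_mem_shell)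
    (fun q _ => star_star q) (fun q _ => star_star q) fun q hq => ?_
  rw [hstar q (ne_zero_of_mem_shell hq), Submodule.coe_inner, Submodule.coe_inner,
    coe_onLayer, coe_onLayer, A.inner_apply_left]

lemma wordSum_re_trace (h1 : d 1 = 1) (hmul : ∀ x y, x ≠ 0 → y ≠ 0 → d (x * y) = d x * d y)
    (m n : ℕ) : ∀ (B : A.layer m →ₗ[ℂ] A.layer m) (F : ℍ[ℤ] → ℝ),
    (∀ x ≠ 0, F x = (LinearMap.trace ℂ _ (B * A.onLayer m (d x))).re) →
    wordSum n F = (LinearMap.trace ℂ _ (B * A.step d m ^ n)).re := by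
  induction n with
  | zero =>
    intro B F h
    rw [wordSum, h 1 one_ne_zero, h1, onLayer_one, pow_zero]; rfl
  | succ n ih =>
    intro B F h
    have : ∀ q ∈ shell 7, wordSum n (fun x => F (q * x)) =
        (LinearMap.trace ℂ _ ((A.onLayer m (d q) * B) * A.step d m ^ n)).re := by
      intro q hq
      have hq0 := ne_zero_of_mem_shell hq
      refine ih _ _ fun x hx => ?_
      rw [h _ (mul_ne_zero hq0 hx), hmul q x hq0 hx, onLayer_mul, ← mul_assoc,
        LinearMap.trace_mul_comm, mul_assoc]
    rw [wordSum, Finset.sum_congr rfl this, ← Complex.re_sum, ← map_sum, ← Finset.sum_mul,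
      ← Finset.sum_mul, ← step, mul_assoc, LinearMap.trace_mul_comm, mul_assoc, pow_succ]

lemma wordSum_finset_sum {ι : Type*} (s : Finset ι) (n : ℕ) : ∀ (F : ι → ℍ[ℤ] → ℝ),
    wordSum n (fun x => ∑ i ∈ s, F i x) = ∑ i ∈ s, wordSum n (F i) := by
  induction n with
  | zero => intro F; rfl
  | succ n ih =>
    intro F
    simp only [wordSum]
    rw [Finset.sum_comm]
    exact Finset.sum_congr rfl fun q _ => ih fun i x => F i (q * x)

lemma wordSum_congr (n : ℕ) : ∀ {F F' : ℍ[ℤ] → ℝ}, (∀ x ≠ 0, F x = F' x) →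
    wordSum n F = wordSum n F' := by
  induction n with
  | zero => intro F F' h; exact h 1 one_ne_zero
  | succ n ih =>
    intro F F' h
    exact Finset.sum_congr rfl fun q hq => ih fun x hx =>
      h _ (mul_ne_zero (ne_zero_of_mem_shell hq) hx)

/-- The tower satisfies the character identity of the layers of the even functions on the
three-sphere. -/
def CharacterIdentity (d : ℍ[ℤ] → G) : Prop := ∀ L : ℕ, ∀ x ≠ 0, (4 * cosSq x) ^ L =
  ∑ j ∈ range (L + 1), tensorMult L j * (LinearMap.trace ℂ _ (A.onLayer j (d x))).re

lemma exists_re_inner_step_le (h1 : d 1 = 1)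
    (hmul : ∀ x y, x ≠ 0 → y ≠ 0 → d (x * y) = d x * d y)
    (hstar : ∀ x ≠ 0, d (star x) = (d x)⁻¹) (hchar : A.CharacterIdentity d) :
    ∃ m₀ : ℕ, 1 ≤ m₀ ∧ ∀ m, m₀ ≤ m → ∀ x : A.layer m,
      (⟪x, A.step d m x⟫_ℂ).re ≤ 99 / 100 * 64 * ‖x‖ ^ 2 := by
  obtain ⟨m₀, hm₀, h⟩ := exists_large_degree_bound
  refine ⟨m₀, hm₀, fun m hm x => ?_⟩
  have hT := A.step_isSymmetric hstar m
  refine hT.re_inner_le _ (fun i => (le_abs_self _).trans (h m hm _ fun k L hL => ?_)) x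
  have hnn : ∀ j, ∑ i, (A.step_isSymmetric hstar j).eigenvalues rfl i ^ (2 * k) =
      wordSum (2 * k) (fun x => (LinearMap.trace ℂ _ (A.onLayer j (d x))).re) := by
    intro j
    rw [A.wordSum_re_trace h1 hmul j (2 * k) 1 _ (fun x _ => by rw [one_mul]), one_mul,
      (A.step_isSymmetric hstar j).re_trace_pow]
  have hpos : ∀ j, ∀ i, 0 ≤ (A.step_isSymmetric hstar j).eigenvalues rfl i ^ (2 * k) := by
    intro j i; rw [pow_mul]; positivity
  rw [wordSum_congr (2 * k) (hchar L), wordSum_finset_sum]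
  simp only [wordSum_mul_left]
  have hterm : ∀ j ∈ range (L + 1), 0 ≤ tensorMult L j *
      wordSum (2 * k) (fun x => (LinearMap.trace ℂ _ (A.onLayer j (d x))).re) := by
    intro j hj
    rw [← hnn]
    exact mul_nonneg (tensorMult_nonneg L j (by rw [Finset.mem_range] at hj; omega))
      (Finset.sum_nonneg fun i _ => hpos j i)
  refine le_trans ?_ (Finset.single_le_sum hterm (Finset.mem_range.2 (Nat.lt_succ_of_le hL)))
  refine mul_le_mul_of_nonneg_left ?_ (tensorMult_nonneg L m hL)
  rw [← hnn]
  exact Finset.single_le_sum (f := fun i => hT.eigenvalues rfl i ^ (2 * k))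
    (fun i _ => hpos m i) (Finset.mem_univ i)

end IsometricTower

end

section
open Quaternion Finset
open scoped InnerProductSpace
namespace IsometricTower
variable {G E : Type*} [Group G] [NormedAddCommGroup E] [InnerProductSpace ℂ E]
  (A : IsometricTower G E) (d : ℍ[ℤ] → G)

/-- The total squared displacement of a vector under the integer quaternions of norm `7`. -/
noncomputable def displacement (x : E) : ℝ := ∑ q ∈ shell 7, ‖A.U (d q) x - x‖ ^ 2

lemma displacement_nonneg (x : E) : 0 ≤ A.displacement d x :=
  Finset.sum_nonneg fun _ _ => sq_nonneg _

lemma displacement_eq_zero {x : E} (h : A.displacement d x = 0) :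
    ∀ q ∈ shell 7, A.U (d q) x = x := by
  intro q hq
  have := (Finset.sum_eq_zero_iff_of_nonneg fun _ _ => sq_nonneg _).1 h q hq
  simpa [sub_eq_zero] using this

lemma displacement_of_fixed {x : E} (h : ∀ q ∈ shell 7, A.U (d q) x = x) :
    A.displacement d x = 0 := by
  refine Finset.sum_eq_zero fun q hq => ?_
  rw [h q hq, sub_self, norm_zero]; norm_num

lemma displacement_smul (r : ℝ) (x : E) :
    A.displacement d ((r : ℂ) • x) = r ^ 2 * A.displacement d x := by
  simp only [displacement, LinearIsometry.map_smul, ← smul_sub, norm_smul, mul_pow,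
    Finset.mul_sum, Complex.norm_real, Real.norm_eq_abs, sq_abs]

lemma continuous_displacement : Continuous (A.displacement d) := by
  unfold displacement
  refine continuous_finsetSum _ fun q _ => ?_
  exact (((A.U (d q)).continuous.sub continuous_id).norm).pow 2

lemma displacement_add {m : ℕ} {p w : E} (hp : p ∈ A.below m) (hw : w ∈ (A.below m)ᗮ) :
    A.displacement d (p + w) = A.displacement d p + A.displacement d w := by
  rw [displacement, displacement, displacement, ← Finset.sum_add_distrib]
  refine Finset.sum_congr rfl fun q _ => ?_
  have e : A.U (d q) (p + w) - (p + w) = (A.U (d q) p - p) + (A.U (d q) w - w) := by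
    rw [map_add]; abel
  rw [e, sq, sq, sq]
  refine norm_add_sq_eq_norm_sq_add_norm_sq_of_inner_eq_zero (𝕜 := ℂ) _ _ ?_
  exact ((A.below m).mem_orthogonal _).1
    (Submodule.sub_mem _ (A.apply_mem_below_orthogonal _ _ _ hw) hw) _
    (Submodule.sub_mem _ (A.apply_mem_below _ _ _ hp) hp)

variable {d}

lemma displacement_eq (m : ℕ) (x : A.layer m) :
    A.displacement d x = 2 * (64 * ‖x‖ ^ 2 - (⟪x, A.step d m x⟫_ℂ).re) := by
  have h : ∀ q ∈ shell 7, ‖A.U (d q) x - x‖ ^ 2 =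
      2 * (‖x‖ ^ 2 - (⟪x, A.onLayer m (d q) x⟫_ℂ).re) := by
    intro q _
    rw [@norm_sub_rev, @norm_sub_sq ℂ, LinearIsometry.norm_map, Submodule.coe_inner, coe_onLayer,
      Submodule.coe_norm]
    simp only [RCLike.re_to_complex]
    ring
  rw [displacement, Finset.sum_congr rfl h, ← Finset.mul_sum, Finset.sum_sub_distrib,
    Finset.sum_const, card_shell_seven, step, LinearMap.sum_apply, inner_sum, Complex.re_sum]
  simp

lemma exists_layer_bound {m : ℕ} (hfix : ∀ x ∈ A.layer m, A.displacement d x = 0 → x = 0) :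
    ∃ c > 0, ∀ x ∈ A.layer m, c * ‖x‖ ^ 2 ≤ A.displacement d x := by
  have hcont : Continuous fun x : A.layer m => A.displacement d x :=
    (A.continuous_displacement d).comp continuous_subtype_val
  have : ProperSpace (A.layer m) := FiniteDimensional.proper ℂ _
  by_cases hne : (Metric.sphere (0 : A.layer m) 1).Nonempty
  · obtain ⟨u, hu, hmin⟩ :=
      (isCompact_sphere (0 : A.layer m) 1).exists_isMinOn hne hcont.continuousOn
    refine ⟨A.displacement d u, ?_, fun x hx => ?_⟩
    · refine lt_of_le_of_ne (A.displacement_nonneg d _) fun h => ?_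
      have := hfix u u.2 h.symm
      rw [mem_sphere_zero_iff_norm, Submodule.coe_norm, this, norm_zero] at hu
      exact zero_ne_one hu
    · by_cases hx0 : x = 0
      · simpa [hx0] using A.displacement_nonneg d 0
      have hn : ‖x‖ ≠ 0 := norm_ne_zero_iff.2 hx0
      set v : A.layer m := ((‖x‖⁻¹ : ℝ) : ℂ) • ⟨x, hx⟩ with hv
      have hvs : v ∈ Metric.sphere (0 : A.layer m) 1 := by
        rw [mem_sphere_zero_iff_norm, hv, norm_smul, Complex.norm_real, norm_inv, norm_norm]
        exact inv_mul_cancel₀ hn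
      have h1 : A.displacement d u ≤ A.displacement d v := hmin hvs
      have h2 : A.displacement d v = ‖x‖⁻¹ ^ 2 * A.displacement d x := by
        rw [← displacement_smul]; rfl
      rw [h2, inv_pow, inv_mul_eq_div, le_div_iff₀ (by positivity)] at h1
      exact h1
  · refine ⟨1, one_pos, fun x hx => ?_⟩
    by_cases hx0 : x = 0
    · simpa [hx0] using A.displacement_nonneg d 0
    exfalso
    refine hne ⟨((‖x‖⁻¹ : ℝ) : ℂ) • ⟨x, hx⟩, ?_⟩
    rw [mem_sphere_zero_iff_norm, norm_smul, Complex.norm_real, norm_inv, norm_norm]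
    exact inv_mul_cancel₀ (norm_ne_zero_iff.2 hx0)

lemma sub_starProjection_mem_layer {m : ℕ} {x : E} (hx : x ∈ A.Q m) :
    x - (A.below m).starProjection x ∈ A.layer m :=
  ⟨Submodule.sub_mem _ hx (A.below_le m (Submodule.starProjection_apply_mem _ _)),
    Submodule.sub_starProjection_mem_orthogonal _⟩

lemma displacement_eq_add (m : ℕ) (x : E) : A.displacement d x =
    A.displacement d ((A.below m).starProjection x) +
      A.displacement d (x - (A.below m).starProjection x) := by
  conv_lhs => rw [← add_sub_cancel ((A.below m).starProjection x) x]
  exact A.displacement_add d (Submodule.starProjection_apply_mem _ _)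
    (Submodule.sub_starProjection_mem_orthogonal _)

/-- A uniform displacement bound for the tower: the integer quaternions of norm `7` move every
vector by at least a fixed proportion of what any group element does. -/
theorem exists_displacement_bound (h1 : d 1 = 1)
    (hmul : ∀ x y, x ≠ 0 → y ≠ 0 → d (x * y) = d x * d y)
    (hstar : ∀ x ≠ 0, d (star x) = (d x)⁻¹) (hchar : A.CharacterIdentity d)
    (hQ0 : ∀ g, ∀ x ∈ A.Q 0, A.U g x = x)
    (hfix : ∀ m₀, (∀ m, ∀ x ∈ A.Q m, (∀ q ∈ shell 7, A.U (d q) x = x) → x ∈ A.Q m₀) →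
      ∀ m, ∀ x ∈ A.Q m, (∀ q ∈ shell 7, A.U (d q) x = x) → x ∈ A.Q 0) :
    ∃ C : ℝ, 0 < C ∧ ∀ m, ∀ x ∈ A.Q m, ∀ g, ‖A.U g x - x‖ ^ 2 ≤ C * A.displacement d x := by
  obtain ⟨m₀, hm₀, hlarge⟩ := A.exists_re_inner_step_le h1 hmul hstar hchar
  have hbig : ∀ m, m₀ ≤ m → ∀ x ∈ A.layer m, 1 * ‖x‖ ^ 2 ≤ A.displacement d x := by
    intro m hm x hx
    have e := A.displacement_eq (d := d) m ⟨x, hx⟩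
    have e2 := hlarge m hm ⟨x, hx⟩
    have e3 : ‖(⟨x, hx⟩ : A.layer m)‖ = ‖x‖ := rfl
    rw [e3] at e e2
    have : 0 ≤ ‖x‖ ^ 2 := by positivity
    change A.displacement d x = _ at e
    linarith
  have hfixed : ∀ m, ∀ x ∈ A.Q m, A.displacement d x = 0 → x ∈ A.Q 0 := by
    have key : ∀ m, ∀ x ∈ A.Q m, A.displacement d x = 0 → x ∈ A.Q m₀ := by
      intro m
      induction m with
      | zero => intro x hx _; exact A.mono (Nat.zero_le _) hx
      | succ m ih =>
        intro x hx h0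
        by_cases hm : m + 1 ≤ m₀
        · exact A.mono hm hx
        have hs := A.displacement_eq_add (d := d) (m + 1) x
        have n1 := A.displacement_nonneg d ((A.below (m + 1)).starProjection x)
        have n2 := A.displacement_nonneg d (x - (A.below (m + 1)).starProjection x)
        have h3 := hbig (m + 1) (by omega) _ (A.sub_starProjection_mem_layer hx)
        have h4 : ‖x - (A.below (m + 1)).starProjection x‖ ^ 2 ≤ 0 := by linarith
        have h5 : x - (A.below (m + 1)).starProjection x = 0 := by
          rw [← norm_eq_zero]; exact pow_eq_zero_iff (two_ne_zero) |>.1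
            (le_antisymm h4 (sq_nonneg _))
        have h6 : x ∈ A.below (m + 1) := by
          rw [sub_eq_zero.1 h5]; exact Submodule.starProjection_apply_mem _ _
        exact ih x h6 h0
    intro m x hx h0
    exact hfix m₀ (fun m x hx h => key m x hx (A.displacement_of_fixed d h)) m x hx
      (A.displacement_eq_zero d h0)
  have hlayer : ∀ m, 1 ≤ m → ∃ c > 0, ∀ x ∈ A.layer m, c * ‖x‖ ^ 2 ≤ A.displacement d x := by
    intro m hm
    refine A.exists_layer_bound fun x hx h => ?_
    have hx0 := hfixed m x hx.1 h
    obtain ⟨k, rfl⟩ := Nat.exists_eq_add_of_le' hm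
    have : ⟪x, x⟫_ℂ = 0 := (Submodule.mem_orthogonal _ _).1 hx.2 x (A.mono (Nat.zero_le k) hx0)
    exact inner_self_eq_zero.1 this
  have hunif : ∀ N, ∃ c > 0, ∀ m, 1 ≤ m → m < N → ∀ x ∈ A.layer m,
      c * ‖x‖ ^ 2 ≤ A.displacement d x := by
    intro N
    induction N with
    | zero => exact ⟨1, one_pos, fun m _ h => absurd h (Nat.not_lt_zero _)⟩
    | succ N ih =>
      obtain ⟨c, hc, h⟩ := ih
      rcases Nat.eq_zero_or_pos N with rfl | hN
      · exact ⟨1, one_pos, fun m h1 h2 => by omega⟩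
      obtain ⟨c', hc', h'⟩ := hlayer N hN
      refine ⟨min c c', lt_min hc hc', fun m hm1 hm2 x hx => ?_⟩
      rcases Nat.lt_succ_iff_lt_or_eq.1 hm2 with hlt | rfl
      · exact (mul_le_mul_of_nonneg_right (min_le_left _ _) (sq_nonneg _)).trans (h m hm1 hlt x hx)
      · exact (mul_le_mul_of_nonneg_right (min_le_right _ _) (sq_nonneg _)).trans (h' x hx)
  obtain ⟨c₁, hc₁, hsmall⟩ := hunif m₀
  set c := min c₁ 1 with hc
  have hc0 : 0 < c := lt_min hc₁ one_pos
  have hall : ∀ m, 1 ≤ m → ∀ x ∈ A.layer m, c * ‖x‖ ^ 2 ≤ A.displacement d x := by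
    intro m hm x hx
    rcases lt_or_ge m m₀ with h | h
    · exact (mul_le_mul_of_nonneg_right (min_le_left _ _) (sq_nonneg _)).trans (hsmall m hm h x hx)
    · exact (mul_le_mul_of_nonneg_right (min_le_right _ _) (sq_nonneg _)).trans (hbig m h x hx)
  have hmain : ∀ m, ∀ x ∈ A.Q m, ∃ y ∈ A.Q 0, c * ‖x - y‖ ^ 2 ≤ A.displacement d x := by
    intro m
    induction m with
    | zero =>
      intro x hx
      refine ⟨x, hx, ?_⟩
      rw [sub_self, norm_zero]
      simpa using A.displacement_nonneg d x
    | succ m ih =>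
      intro x hx
      set p := (A.below (m + 1)).starProjection x with hp
      have hpm : p ∈ A.below (m + 1) := Submodule.starProjection_apply_mem _ _
      obtain ⟨y, hy, hyle⟩ := ih p hpm
      refine ⟨y, hy, ?_⟩
      have hw := A.sub_starProjection_mem_layer hx
      have h2 := hall (m + 1) (by omega) _ hw
      rw [A.displacement_eq_add (m + 1) x]
      have h3 : ‖x - y‖ ^ 2 = ‖p - y‖ ^ 2 + ‖x - p‖ ^ 2 := by
        have e : x - y = (p - y) + (x - p) := by abel
        rw [e, sq, sq, sq]
        refine norm_add_sq_eq_norm_sq_add_norm_sq_of_inner_eq_zero (𝕜 := ℂ) _ _ ?_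
        exact (Submodule.mem_orthogonal _ _).1 hw.2 _
          (Submodule.sub_mem _ hpm (A.mono (Nat.zero_le m) hy))
      rw [h3, mul_add]
      exact add_le_add hyle h2
  refine ⟨4 / c, by positivity, fun m x hx g => ?_⟩
  obtain ⟨y, hy, hle⟩ := hmain m x hx
  have e : A.U g x - x = A.U g (x - y) - (x - y) := by
    rw [map_sub, hQ0 g y hy]; abel
  have h2 : ‖A.U g x - x‖ ≤ 2 * ‖x - y‖ := by
    rw [e]
    refine (norm_sub_le _ _).trans ?_
    rw [LinearIsometry.norm_map]; linarith
  have h3 := pow_le_pow_left₀ (norm_nonneg _) h2 2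
  rw [div_mul_eq_mul_div, le_div_iff₀ hc0]
  nlinarith

end IsometricTower

end

section
open Quaternion Finset

/-- The group of unit quaternions. -/
abbrev UQ : Type := Metric.sphere (0 : ℍ[ℝ]) 1

namespace UQ

lemma normSq_coe (g : UQ) : normSq (g : ℍ[ℝ]) = 1 := by
  rw [normSq_eq_norm_mul_self, mem_sphere_zero_iff_norm.1 g.2, one_mul]

/-- The unit quaternion with given value of reduced norm one. -/
def mk' (a : ℍ[ℝ]) (h : normSq a = 1) : UQ := ⟨a, by
  rw [mem_sphere_zero_iff_norm]
  have := normSq_eq_norm_mul_self a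
  rw [h] at this
  nlinarith [norm_nonneg a]⟩

@[simp] lemma coe_mk' (a : ℍ[ℝ]) (h : normSq a = 1) : (mk' a h : ℍ[ℝ]) = a := rfl

@[simp] lemma coe_mul_star (g : UQ) : (g : ℍ[ℝ]) * star (g : ℍ[ℝ]) = 1 := by
  rw [Quaternion.self_mul_star, normSq_coe]; rfl

lemma coe_inv (g : UQ) : ((g⁻¹ : UQ) : ℍ[ℝ]) = star (g : ℍ[ℝ]) := by
  have h : ((g⁻¹ : UQ) : ℍ[ℝ]) * g = 1 := by
    have := congrArg (Subtype.val) (inv_mul_cancel g)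
    exact this
  calc ((g⁻¹ : UQ) : ℍ[ℝ]) = ((g⁻¹ : UQ) : ℍ[ℝ]) * (g * star (g : ℍ[ℝ])) := by simp
    _ = _ := by rw [← mul_assoc, h, one_mul]

/-- Conjugation by a unit quaternion. -/
noncomputable def act (g : UQ) : ℍ[ℝ] →ₗ[ℝ] ℍ[ℝ] where
  toFun a := g * a * star (g : ℍ[ℝ])
  map_add' a b := by rw [mul_add, add_mul]
  map_smul' r a := by simp

lemma act_apply (g : UQ) (a : ℍ[ℝ]) : act g a = g * a * star (g : ℍ[ℝ]) := rfl

lemma act_mul (g h : UQ) (a : ℍ[ℝ]) : act (g * h) a = act g (act h a) := by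
  have : ((g * h : UQ) : ℍ[ℝ]) = g * h := rfl
  simp only [act_apply, this, star_mul, mul_assoc]

lemma act_one (a : ℍ[ℝ]) : act 1 a = a := by
  simp [act_apply]

lemma normSq_act (g : UQ) (a : ℍ[ℝ]) : normSq (act g a) = normSq a := by
  rw [act_apply, map_mul, map_mul, normSq_star, normSq_coe]; ring

lemma re_act (g : UQ) (a : ℍ[ℝ]) : (act g a).re = a.re := by
  have h := normSq_coe g
  rw [normSq_def'] at h
  simp only [act_apply, re_mul, imI_mul, imJ_mul, imK_mul, re_star, imI_star, imJ_star, imK_star]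
  linear_combination a.re * h

/-- The first imaginary unit. -/
def unitI : ℍ[ℝ] := quat 0 1 0 0

/-- Every unit imaginary quaternion is a conjugate of the first imaginary unit. -/
lemma exists_act_unitI (u : ℍ[ℝ]) (hre : u.re = 0) (hn : normSq u = 1) :
    ∃ k : UQ, act k unitI = u := by
  have huu : u * u = -1 := by
    rw [normSq_def', hre] at hn
    refine Quaternion.ext _ _ ?_ ?_ ?_ ?_ <;>
      simp only [re_mul, imI_mul, imJ_mul, imK_mul, hre, re_neg, imI_neg, imJ_neg, imK_neg,
        re_one, imI_one, imJ_one, imK_one]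
    · linear_combination -hn
    all_goals ring
  have hii : unitI * unitI = -1 := by
    refine Quaternion.ext _ _ ?_ ?_ ?_ ?_ <;> simp [unitI]
  set h : ℍ[ℝ] := 1 - u * unitI with hh
  have hcomm : h * unitI = u * h := by
    rw [hh, sub_mul, mul_sub, one_mul, mul_one, mul_assoc, hii, ← mul_assoc, huu]
    simp only [mul_neg, mul_one, neg_mul, one_mul, sub_neg_eq_add]
    rw [add_comm]
  by_cases h0 : h = 0
  · have hu : u = -unitI := by
      have : u * unitI = 1 := (sub_eq_zero.1 h0).symm
      have h2 := congrArg (· * unitI) this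
      simp only [mul_assoc, hii, mul_neg, mul_one, one_mul] at h2
      rw [← h2, neg_neg]
    refine ⟨mk' (quat 0 0 1 0) (by simp [normSq_def']), ?_⟩
    rw [hu, act_apply, coe_mk']
    refine Quaternion.ext _ _ ?_ ?_ ?_ ?_ <;> simp [unitI]
  · have hN : 0 < normSq h := lt_of_le_of_ne normSq_nonneg (Ne.symm (normSq_ne_zero.2 h0))
    have hs : Real.sqrt (normSq h) ^ 2 = normSq h := Real.sq_sqrt hN.le
    have hs0 : Real.sqrt (normSq h) ≠ 0 := (Real.sqrt_pos.2 hN).ne'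
    refine ⟨mk' ((Real.sqrt (normSq h))⁻¹ • h) ?_, ?_⟩
    · rw [normSq_smul, inv_pow, hs, inv_mul_cancel₀ hN.ne']
    · set k := mk' ((Real.sqrt (normSq h))⁻¹ • h) _ with hk
      have e : (k : ℍ[ℝ]) * unitI = u * k := by
        rw [hk, coe_mk', smul_mul_assoc, hcomm, mul_smul_comm]
      rw [act_apply, e, mul_assoc, coe_mul_star, mul_one]

/-- The unit complex number of given argument, as a quaternion. -/
noncomputable def diag (φ : ℝ) : UQ :=
  mk' (quat (Real.cos φ) (Real.sin φ) 0 0) (by simp [normSq_def'])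

lemma exists_conj_diag (g : UQ) : ∃ (k : UQ) (φ : ℝ),
    g = k * diag φ * k⁻¹ ∧ Real.cos φ = (g : ℍ[ℝ]).re := by
  have hn := normSq_coe g
  rw [normSq_def'] at hn
  set t := (g : ℍ[ℝ]).re with ht
  have ht1 : t ^ 2 ≤ 1 := by
    nlinarith [sq_nonneg ((g : ℍ[ℝ]).imI), sq_nonneg ((g : ℍ[ℝ]).imJ),
    sq_nonneg ((g : ℍ[ℝ]).imK)]
  have hcos : Real.cos (Real.arccos t) = t :=
    Real.cos_arccos (by nlinarith) (by nlinarith)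
  set φ := Real.arccos t with hφ
  have hsc := Real.sin_sq_add_cos_sq φ
  rw [hcos] at hsc
  suffices h : ∃ u : ℍ[ℝ], u.re = 0 ∧ normSq u = 1 ∧
      (g : ℍ[ℝ]) = (t : ℝ) • (1 : ℍ[ℝ]) + (Real.sin φ) • u by
    obtain ⟨u, hu, hu1, hg⟩ := h
    obtain ⟨k, hk⟩ := exists_act_unitI u hu hu1
    refine ⟨k, φ, Subtype.ext ?_, hcos⟩
    have e : ((k * diag φ * k⁻¹ : UQ) : ℍ[ℝ]) = k * diag φ * star (k : ℍ[ℝ]) := by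
      rw [← coe_inv]; rfl
    have e2 : ((diag φ : UQ) : ℍ[ℝ]) = t • (1 : ℍ[ℝ]) + (Real.sin φ) • unitI := by
      rw [diag, coe_mk', hcos]
      refine Quaternion.ext _ _ ?_ ?_ ?_ ?_ <;> simp [unitI]
    rw [e, e2, hg, ← hk, ← act_apply, map_add, map_smul, map_smul]
    simp [act_apply]
  by_cases hs : Real.sin φ = 0
  · refine ⟨unitI, rfl, by simp [unitI, normSq_def'], ?_⟩
    rw [hs] at hsc ⊢
    have h3 : (g : ℍ[ℝ]).imI ^ 2 + (g : ℍ[ℝ]).imJ ^ 2 + (g : ℍ[ℝ]).imK ^ 2 = 0 := by linarith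
    have a1 := sq_nonneg ((g : ℍ[ℝ]).imI)
    have a2 := sq_nonneg ((g : ℍ[ℝ]).imJ)
    have a3 := sq_nonneg ((g : ℍ[ℝ]).imK)
    have b1 : (g : ℍ[ℝ]).imI = 0 := pow_eq_zero_iff two_ne_zero |>.1 (by linarith)
    have b2 : (g : ℍ[ℝ]).imJ = 0 := pow_eq_zero_iff two_ne_zero |>.1 (by linarith)
    have b3 : (g : ℍ[ℝ]).imK = 0 := pow_eq_zero_iff two_ne_zero |>.1 (by linarith)
    refine Quaternion.ext _ _ ?_ ?_ ?_ ?_ <;> simp [b1, b2, b3, ht]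
  · refine ⟨(Real.sin φ)⁻¹ • quat 0 (g : ℍ[ℝ]).imI (g : ℍ[ℝ]).imJ (g : ℍ[ℝ]).imK, ?_, ?_, ?_⟩
    · simp
    · rw [normSq_smul, normSq_def', inv_pow, inv_mul_eq_div, div_eq_one_iff_eq (by positivity)]
      simp only [re_quat, imI_quat, imJ_quat, imK_quat]
      linarith
    · rw [smul_inv_smul₀ hs]
      refine Quaternion.ext _ _ ?_ ?_ ?_ ?_ <;> simp [ht]

/-- The orbit map of the first imaginary unit. -/
noncomputable def orbit (g : UQ) : ℍ[ℝ] := act g unitI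

lemma continuous_orbit : Continuous orbit := by
  unfold orbit
  simp only [act_apply]
  fun_prop

lemma orbit_mul (h g : UQ) : orbit (h * g) = act h (orbit g) := act_mul _ _ _

lemma re_orbit (g : UQ) : (orbit g).re = 0 := re_act _ _

lemma normSq_orbit (g : UQ) : normSq (orbit g) = 1 := by
  rw [orbit, normSq_act, unitI]; simp [normSq_def']

end UQ

end

section
open Quaternion Finset

namespace UQ

noncomputable instance : Semiring C(UQ, ℂ) := ContinuousMap.instSemiringOfIsTopologicalSemiring
noncomputable instance : CommSemiring C(UQ, ℂ) :=
  ContinuousMap.instCommSemiringOfIsTopologicalSemiring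
noncomputable instance : CommRing C(UQ, ℂ) := ContinuousMap.instCommRingOfIsTopologicalRing
noncomputable instance : Algebra ℂ C(UQ, ℂ) := ContinuousMap.algebra

/-- Left translation of continuous functions on the group of unit quaternions. -/
noncomputable def shift (h : UQ) : C(UQ, ℂ) →ₐ[ℂ] C(UQ, ℂ) :=
  ContinuousMap.compRightAlgHom ℂ ℂ ⟨fun g => h * g, by fun_prop⟩

@[simp] lemma shift_apply (h : UQ) (f : C(UQ, ℂ)) (g : UQ) : shift h f g = f (h * g) := rfl

/-- The function on the group given by a linear form on the orbit of the imaginary unit. -/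
noncomputable def lin (l : ℍ[ℝ] →ₗ[ℝ] ℂ) : C(UQ, ℂ) :=
  ⟨fun g => l (orbit g), l.continuous_of_finiteDimensional.comp continuous_orbit⟩

@[simp] lemma lin_apply (l : ℍ[ℝ] →ₗ[ℝ] ℂ) (g : UQ) : lin l g = l (orbit g) := rfl

lemma shift_lin (h : UQ) (l : ℍ[ℝ] →ₗ[ℝ] ℂ) : shift h (lin l) = lin (l ∘ₗ act h) := by
  ext g; simp [orbit_mul]

lemma continuous_imI_orbit : Continuous fun g => (orbit g).imI :=
  Quaternion.continuous_imI.comp continuous_orbit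

lemma continuous_imJ_orbit : Continuous fun g => (orbit g).imJ :=
  Quaternion.continuous_imJ.comp continuous_orbit

lemma continuous_imK_orbit : Continuous fun g => (orbit g).imK :=
  Quaternion.continuous_imK.comp continuous_orbit

/-- The height of a point of the orbit. -/
noncomputable def height : C(UQ, ℂ) :=
  ⟨fun g => ((orbit g).imI : ℂ), Complex.continuous_ofReal.comp continuous_imI_orbit⟩

/-- The complex coordinate of a point of the orbit in the horizontal plane. -/
noncomputable def plane : C(UQ, ℂ) :=
  ⟨fun g => ((orbit g).imJ : ℂ) + Complex.I * ((orbit g).imK : ℂ),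
    (Complex.continuous_ofReal.comp continuous_imJ_orbit).add
      (continuous_const.mul (Complex.continuous_ofReal.comp continuous_imK_orbit))⟩

/-- The conjugate of the complex coordinate in the horizontal plane. -/
noncomputable def planeConj : C(UQ, ℂ) :=
  ⟨fun g => ((orbit g).imJ : ℂ) - Complex.I * ((orbit g).imK : ℂ),
    (Complex.continuous_ofReal.comp continuous_imJ_orbit).sub
      (continuous_const.mul (Complex.continuous_ofReal.comp continuous_imK_orbit))⟩

lemma height_apply (g : UQ) : height g = ((orbit g).imI : ℂ) := rfl

lemma plane_apply (g : UQ) :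
    plane g = ((orbit g).imJ : ℂ) + Complex.I * ((orbit g).imK : ℂ) := rfl

lemma planeConj_apply (g : UQ) :
    planeConj g = ((orbit g).imJ : ℂ) - Complex.I * ((orbit g).imK : ℂ) := rfl

lemma plane_mul_planeConj : plane * planeConj = 1 - height * height := by
  ext g
  have h := normSq_orbit g
  rw [normSq_def', re_orbit] at h
  have h' : ((orbit g).imI : ℂ) ^ 2 + ((orbit g).imJ : ℂ) ^ 2 + ((orbit g).imK : ℂ) ^ 2 = 1 := by
    exact_mod_cast (by linarith : (orbit g).imI ^ 2 + (orbit g).imJ ^ 2 + (orbit g).imK ^ 2 = 1)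
  simp only [ContinuousMap.mul_apply, ContinuousMap.sub_apply, ContinuousMap.one_apply,
    plane_apply, planeConj_apply, height_apply]
  linear_combination h' - ((orbit g).imK : ℂ) ^ 2 * Complex.I_sq

/-- The space of affine functions of the orbit. -/
noncomputable def affine : Submodule ℂ C(UQ, ℂ) :=
  Submodule.span ℂ {1, height, plane, planeConj}

lemma one_mem_affine : (1 : C(UQ, ℂ)) ∈ affine := Submodule.subset_span (by simp)
lemma height_mem_affine : height ∈ affine := Submodule.subset_span (by simp)
lemma plane_mem_affine : plane ∈ affine := Submodule.subset_span (by simp)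
lemma planeConj_mem_affine : planeConj ∈ affine := Submodule.subset_span (by simp)

lemma lin_mem_affine (l : ℍ[ℝ] →ₗ[ℝ] ℂ) : lin l ∈ affine := by
  set a := l (quat 0 1 0 0)
  set b := l (quat 0 0 1 0)
  set c := l (quat 0 0 0 1)
  have : lin l = a • height + ((b - Complex.I * c) / 2) • plane +
      ((b + Complex.I * c) / 2) • planeConj := by
    ext g
    have h : orbit g = (orbit g).imI • quat 0 1 0 0 + (orbit g).imJ • quat 0 0 1 0 +
        (orbit g).imK • quat 0 0 0 1 := by
      refine Quaternion.ext _ _ ?_ ?_ ?_ ?_ <;> simp [re_orbit]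
    rw [lin_apply, h]
    simp only [map_add, map_smul, ContinuousMap.add_apply, ContinuousMap.smul_apply,
      height_apply, plane_apply, planeConj_apply, smul_eq_mul, Complex.real_smul]
    linear_combination ((orbit g).imK : ℂ) * c * Complex.I_sq
  rw [this]
  exact Submodule.add_mem _ (Submodule.add_mem _ (Submodule.smul_mem _ _ height_mem_affine)
    (Submodule.smul_mem _ _ plane_mem_affine)) (Submodule.smul_mem _ _ planeConj_mem_affine)

/-- The coordinate functions as linear forms. -/
noncomputable def coordI : ℍ[ℝ] →ₗ[ℝ] ℂ where
  toFun a := (a.imI : ℂ)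
  map_add' a b := by simp
  map_smul' r a := by simp

/-- The complex horizontal coordinate as a linear form. -/
noncomputable def coordPlane (z : ℂ) : ℍ[ℝ] →ₗ[ℝ] ℂ where
  toFun a := (a.imJ : ℂ) + z * (a.imK : ℂ)
  map_add' a b := by simp; ring
  map_smul' r a := by simp; ring

lemma affine_map_shift_le (h : UQ) : affine.map (shift h).toLinearMap ≤ affine := by
  refine Submodule.map_le_iff_le_comap.2 (Submodule.span_le.2 ?_)
  have e1 : height = lin coordI := rfl
  have e2 : plane = lin (coordPlane Complex.I) := rfl
  have e3 : planeConj = lin (coordPlane (-Complex.I)) := by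
    ext g
    simp [planeConj_apply, coordPlane, sub_eq_add_neg]
  rintro x (rfl | rfl | rfl | rfl)
  · change shift h 1 ∈ affine
    rw [map_one]; exact one_mem_affine
  · change shift h height ∈ affine
    rw [e1, shift_lin]; exact lin_mem_affine _
  · change shift h plane ∈ affine
    rw [e2, shift_lin]; exact lin_mem_affine _
  · change shift h planeConj ∈ affine
    rw [e3, shift_lin]; exact lin_mem_affine _

lemma shift_mem_affine_pow (h : UQ) (m : ℕ) {f : C(UQ, ℂ)} (hf : f ∈ affine ^ m) :
    shift h f ∈ affine ^ m := by
  have h1 : (affine ^ m).map (shift h).toLinearMap ≤ affine ^ m := by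
    rw [Submodule.map_pow]
    exact pow_le_pow_left' (affine_map_shift_le h) m
  exact h1 ⟨f, hf, rfl⟩

lemma affine_pow_le_succ (m : ℕ) : affine ^ m ≤ affine ^ (m + 1) := fun f hf => by
  have := Submodule.mul_mem_mul hf one_mem_affine
  rwa [mul_one, ← pow_succ] at this

lemma affine_pow_mono {m n : ℕ} (h : m ≤ n) : affine ^ m ≤ affine ^ n :=
  monotone_nat_of_le_succ affine_pow_le_succ h

lemma affine_pow_fg (m : ℕ) : (affine ^ m).FG :=
  Submodule.FG.pow (Submodule.fg_span (Set.toFinite _)) m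

/-- The predecessor of the space of polynomials of degree `m` in the orbit. -/
noncomputable def affineBelow : ℕ → Submodule ℂ C(UQ, ℂ)
  | 0 => ⊥
  | m + 1 => affine ^ m

/-- The weight vector of given degree and weight. -/
noncomputable def weight (m : ℕ) (a : ℤ) : C(UQ, ℂ) :=
  plane ^ a.toNat * planeConj ^ (-a).toNat * height ^ (m - a.natAbs)

lemma weight_mem (m : ℕ) {a : ℤ} (ha : a.natAbs ≤ m) : weight m a ∈ affine ^ m := by
  have h := Submodule.mul_mem_mul (Submodule.mul_mem_mul
    (Submodule.pow_mem_pow _ plane_mem_affine a.toNat)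
    (Submodule.pow_mem_pow _ planeConj_mem_affine (-a).toNat))
    (Submodule.pow_mem_pow _ height_mem_affine (m - a.natAbs))
  rw [← pow_add, ← pow_add] at h
  rwa [show a.toNat + (-a).toNat + (m - a.natAbs) = m by omega] at h

lemma weight_mul_height (m : ℕ) {a : ℤ} (ha : a.natAbs ≤ m) :
    weight m a * height = weight (m + 1) a := by
  rw [weight, weight, mul_assoc, ← pow_succ, show m + 1 - a.natAbs = m - a.natAbs + 1 by omega]

/-- The span of the weight vectors of degree `m`. -/
noncomputable def weightSpan (m : ℕ) : Submodule ℂ C(UQ, ℂ) :=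
  Submodule.span ℂ (weight m '' {a | a.natAbs ≤ m})

lemma weight_mul_plane (m : ℕ) {a : ℤ} (ha : a.natAbs ≤ m) :
    weight m a * plane ∈ affine ^ m ⊔ weightSpan (m + 1) := by
  rcases le_or_gt 0 a with h | h
  · have e : weight m a * plane = weight (m + 1) (a + 1) := by
      rw [weight, weight, show (a + 1).toNat = a.toNat + 1 by omega,
        show (-(a + 1)).toNat = (-a).toNat by omega,
        show m + 1 - (a + 1).natAbs = m - a.natAbs by omega]
      ring
    rw [e]
    exact Submodule.mem_sup_right (Submodule.subset_span ⟨a + 1, by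
      simp only [Set.mem_ofPred_eq]; omega, rfl⟩)
  · have e : weight m a * plane = weight (m - 1) (a + 1) - weight (m + 1) (a + 1) := by
      rw [weight, weight, weight, show (a + 1).toNat = 0 by omega, show a.toNat = 0 by omega,
        show (-a).toNat = (-(a + 1)).toNat + 1 by omega,
        show m - 1 - (a + 1).natAbs = m - a.natAbs by omega,
        show m + 1 - (a + 1).natAbs = m - a.natAbs + 2 by omega]
      linear_combination (planeConj ^ (-(a + 1)).toNat * height ^ (m - a.natAbs)) *
        plane_mul_planeConj
    rw [e]
    refine Submodule.sub_mem _ (Submodule.mem_sup_left (affine_pow_mono (Nat.sub_le m 1)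
      (weight_mem _ (by omega)))) (Submodule.mem_sup_right (Submodule.subset_span ⟨a + 1, by
      simp only [Set.mem_ofPred_eq]; omega, rfl⟩))

lemma weight_mul_planeConj (m : ℕ) {a : ℤ} (ha : a.natAbs ≤ m) :
    weight m a * planeConj ∈ affine ^ m ⊔ weightSpan (m + 1) := by
  rcases le_or_gt a 0 with h | h
  · have e : weight m a * planeConj = weight (m + 1) (a - 1) := by
      rw [weight, weight, show (-(a - 1)).toNat = (-a).toNat + 1 by omega,
        show (a - 1).toNat = a.toNat by omega,
        show m + 1 - (a - 1).natAbs = m - a.natAbs by omega]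
      ring
    rw [e]
    exact Submodule.mem_sup_right (Submodule.subset_span ⟨a - 1, by
      simp only [Set.mem_ofPred_eq]; omega, rfl⟩)
  · have e : weight m a * planeConj = weight (m - 1) (a - 1) - weight (m + 1) (a - 1) := by
      rw [weight, weight, weight, show (-(a - 1)).toNat = 0 by omega,
        show (-a).toNat = 0 by omega,
        show a.toNat = (a - 1).toNat + 1 by omega,
        show m - 1 - (a - 1).natAbs = m - a.natAbs by omega,
        show m + 1 - (a - 1).natAbs = m - a.natAbs + 2 by omega]
      linear_combination (plane ^ (a - 1).toNat * height ^ (m - a.natAbs)) *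
        plane_mul_planeConj
    rw [e]
    refine Submodule.sub_mem _ (Submodule.mem_sup_left (affine_pow_mono (Nat.sub_le m 1)
      (weight_mem _ (by omega)))) (Submodule.mem_sup_right (Submodule.subset_span ⟨a - 1, by
      simp only [Set.mem_ofPred_eq]; omega, rfl⟩))

lemma affine_pow_le_sup (m : ℕ) : affine ^ m ≤ affineBelow m ⊔ weightSpan m := by
  induction m with
  | zero =>
    rw [pow_zero, Submodule.one_eq_span, Submodule.span_singleton_le_iff_mem]
    refine Submodule.mem_sup_right (Submodule.subset_span ⟨0, by simp, by simp [weight]⟩)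
  | succ m ih =>
    rw [pow_succ]
    refine (mul_le_mul_left ih _).trans ?_
    rw [Submodule.sup_mul]
    refine sup_le ?_ ?_
    · refine le_trans ?_ (le_sup_left : affineBelow (m + 1) ≤ _)
      cases m with
      | zero => rw [affineBelow, Submodule.bot_mul]; exact bot_le
      | succ m => simp only [affineBelow]; rw [pow_succ]
    · rw [weightSpan, affine, Submodule.span_mul_span, Submodule.span_le]
      rintro _ ⟨_, ⟨a, ha, rfl⟩, x, hx, rfl⟩
      rcases hx with rfl | rfl | rfl | rfl
      · change weight m a * 1 ∈ affineBelow (m + 1) ⊔ weightSpan (m + 1)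
        rw [mul_one]
        exact Submodule.mem_sup_left (weight_mem m ha)
      · refine Submodule.mem_sup_right (Submodule.subset_span ⟨a, ?_, ?_⟩)
        · simp only [Set.mem_ofPred_eq] at ha ⊢; omega
        · exact (weight_mul_height m ha).symm
      · exact weight_mul_plane m ha
      · exact weight_mul_planeConj m ha

/-- Functions whose restriction to a meridian is a trigonometric polynomial of degree at most
`k`. -/
def trigDegree (p : ℝ → UQ) (k : ℕ) : Submodule ℂ C(UQ, ℂ) where
  carrier := {f | ∃ P : Polynomial ℂ, ∀ θ : ℝ,
    f (p θ) * Complex.exp (θ * Complex.I) ^ k = P.eval (Complex.exp (θ * Complex.I))}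
  zero_mem' := ⟨0, fun θ => by simp⟩
  add_mem' := by
    rintro f g ⟨P, hP⟩ ⟨R, hR⟩
    exact ⟨P + R, fun θ => by rw [ContinuousMap.add_apply, add_mul, hP, hR, Polynomial.eval_add]⟩
  smul_mem' := by
    rintro c f ⟨P, hP⟩
    exact ⟨Polynomial.C c * P, fun θ => by
      rw [ContinuousMap.smul_apply, smul_eq_mul, mul_assoc, hP, Polynomial.eval_C_mul]⟩

lemma affine_pow_le_trigDegree {p : ℝ → UQ}
    (hp : ∀ θ, orbit (p θ) = quat 0 (Real.cos θ) (Real.sin θ) 0) (k : ℕ) :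
    affine ^ k ≤ trigDegree p k := by
  induction k with
  | zero =>
    rw [pow_zero, Submodule.one_eq_span, Submodule.span_singleton_le_iff_mem]
    exact ⟨1, fun θ => by simp⟩
  | succ k ih =>
    rw [pow_succ, Submodule.mul_le]
    intro f hf g hg
    have hone : affine ≤ trigDegree p 1 := by
      rw [affine, Submodule.span_le]
      have hexp : ∀ θ : ℝ, Complex.exp (θ * Complex.I) =
          Complex.cos θ + Complex.sin θ * Complex.I := fun θ => Complex.exp_mul_I _
      have hcs : ∀ θ : ℝ, Complex.sin θ ^ 2 + Complex.cos θ ^ 2 = 1 := fun θ =>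
        Complex.sin_sq_add_cos_sq _
      rintro x (rfl | rfl | rfl | rfl)
      · exact ⟨Polynomial.X, fun θ => by simp⟩
      · refine ⟨Polynomial.C (1 / 2) * (Polynomial.X ^ 2 + 1), fun θ => ?_⟩
        rw [height_apply, hp]
        simp only [imI_quat, Polynomial.eval_mul, Polynomial.eval_C, Polynomial.eval_add,
          Polynomial.eval_pow, Polynomial.eval_X, Polynomial.eval_one, Complex.ofReal_cos, hexp]
        linear_combination (-1 / 2) * hcs θ +
          (-1 / 2) * Complex.sin θ ^ 2 * Complex.I_sq + hcs θ
      · refine ⟨Polynomial.C (-Complex.I / 2) * (Polynomial.X ^ 2 - 1), fun θ => ?_⟩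
        rw [plane_apply, hp]
        simp only [imJ_quat, imK_quat, Polynomial.eval_mul, Polynomial.eval_C,
          Polynomial.eval_sub, Complex.ofReal_zero, mul_zero, add_zero,
          Polynomial.eval_pow, Polynomial.eval_X, Polynomial.eval_one, Complex.ofReal_sin, hexp]
        linear_combination (Complex.I / 2) * hcs θ +
          (Complex.I / 2 * Complex.sin θ ^ 2 + Complex.sin θ * Complex.cos θ) * Complex.I_sq
      · refine ⟨Polynomial.C (-Complex.I / 2) * (Polynomial.X ^ 2 - 1), fun θ => ?_⟩
        rw [planeConj_apply, hp]
        simp only [imJ_quat, imK_quat, Polynomial.eval_mul, Polynomial.eval_C,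
          Polynomial.eval_sub, Complex.ofReal_zero, mul_zero, sub_zero,
          Polynomial.eval_pow, Polynomial.eval_X, Polynomial.eval_one, Complex.ofReal_sin, hexp]
        linear_combination (Complex.I / 2) * hcs θ +
          (Complex.I / 2 * Complex.sin θ ^ 2 + Complex.sin θ * Complex.cos θ) * Complex.I_sq
    obtain ⟨P, hP⟩ := ih hf
    obtain ⟨R, hR⟩ := hone hg
    refine ⟨P * R, fun θ => ?_⟩
    rw [Polynomial.eval_mul, ← hP, ← hR, ContinuousMap.mul_apply]
    ring

lemma exists_meridian : ∃ p : ℝ → UQ,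
    ∀ θ, orbit (p θ) = quat 0 (Real.cos θ) (Real.sin θ) 0 := by
  have h : ∀ θ : ℝ, ∃ g : UQ, orbit g = quat 0 (Real.cos θ) (Real.sin θ) 0 := fun θ =>
    exists_act_unitI _ rfl (by simp [normSq_def'])
  choose p hp using h
  exact ⟨p, hp⟩

lemma weight_notMem (m : ℕ) {a : ℤ} (ha : a.natAbs ≤ m) : weight m a ∉ affineBelow m := by
  intro h
  cases m with
  | zero =>
    have h0 : a = 0 := by omega
    subst h0
    rw [affineBelow, Submodule.mem_bot] at h
    have := congrArg (fun f : C(UQ, ℂ) => f 1) h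
    simp [weight] at this
  | succ m =>
    obtain ⟨p, hp⟩ := exists_meridian
    obtain ⟨P, hP⟩ := affine_pow_le_trigDegree hp m h
    set r := a.natAbs with hr
    have hval : ∀ θ : ℝ, weight (m + 1) a (p θ) =
        Complex.sin θ ^ r * Complex.cos θ ^ (m + 1 - r) := by
      intro θ
      simp only [weight, ContinuousMap.mul_apply, ContinuousMap.pow_apply, plane_apply,
        planeConj_apply, height_apply, hp, imJ_quat, imK_quat, imI_quat, Complex.ofReal_zero,
        mul_zero, add_zero, sub_zero, Complex.ofReal_sin, Complex.ofReal_cos, ← pow_add, ← hr]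
      rw [show a.toNat + (-a).toNat = r by omega]
    have hpoly : (Polynomial.X ^ 2 - 1 : Polynomial ℂ) ^ r *
        (Polynomial.X ^ 2 + 1) ^ (m + 1 - r) =
        Polynomial.C ((2 * Complex.I) ^ r * 2 ^ (m + 1 - r)) * Polynomial.X * P := by
      refine Polynomial.eq_of_infinite_eval_eq _ _ (Set.Infinite.mono ?_
        (Set.infinite_range_of_injective (f := fun n : ℕ => Complex.exp ((n : ℝ) * Complex.I)) ?_))
      · rintro _ ⟨n, rfl⟩
        have hn := hP n
        rw [hval] at hn
        set z := Complex.exp (((n : ℝ) : ℂ) * Complex.I) with hz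
        have hzz : z = Complex.cos (n : ℝ) + Complex.sin (n : ℝ) * Complex.I :=
          Complex.exp_mul_I _
        have hcs := Complex.sin_sq_add_cos_sq ((n : ℝ) : ℂ)
        have e1 : z ^ 2 - 1 = 2 * Complex.I * Complex.sin (n : ℝ) * z := by
          rw [hzz]
          linear_combination hcs +
            (-Complex.sin (n : ℝ) ^ 2) * Complex.I_sq
        have e2 : z ^ 2 + 1 = 2 * Complex.cos (n : ℝ) * z := by
          rw [hzz]
          linear_combination (-1) * hcs + Complex.sin (n : ℝ) ^ 2 * Complex.I_sq
        change Polynomial.eval z _ = Polynomial.eval z _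
        simp only [Polynomial.eval_mul, Polynomial.eval_pow,
          Polynomial.eval_sub, Polynomial.eval_add, Polynomial.eval_X, Polynomial.eval_one,
          Polynomial.eval_C, e1, e2, ← hn, mul_pow]
        have : z * z ^ m = z ^ r * z ^ (m + 1 - r) := by
          rw [← pow_add, ← pow_succ']; congr 1; omega
        linear_combination (-(2 ^ r * Complex.I ^ r * 2 ^ (m + 1 - r) *
          Complex.sin (n : ℝ) ^ r * Complex.cos (n : ℝ) ^ (m + 1 - r))) * this
      · intro n n' hnn
        obtain ⟨k, hk⟩ := Complex.exp_eq_exp_iff_exists_int.1 hnn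
        have hk' : ((n : ℝ) : ℂ) = (n' : ℝ) + k * (2 * Real.pi) := by
          have := mul_right_cancel₀ Complex.I_ne_zero
            (show ((n : ℝ) : ℂ) * Complex.I = ((n' : ℝ) + k * (2 * Real.pi)) * Complex.I by
              rw [hk]; ring)
          exact this
        have hk2 : (n : ℝ) = n' + k * (2 * Real.pi) := by exact_mod_cast hk'
        by_contra hne
        have hk0 : k ≠ 0 := by
          rintro rfl
          apply hne
          have : (n : ℝ) = n' := by simpa using hk2
          exact_mod_cast this
        refine irrational_pi ⟨((n : ℚ) - n') / (2 * k), ?_⟩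
        have : (k : ℝ) ≠ 0 := by exact_mod_cast hk0
        push_cast
        field_simp
        linarith
    have := congrArg (Polynomial.eval 0) hpoly
    simp at this

end UQ

end

section
open Quaternion Finset
open scoped InnerProductSpace

namespace IsometricTower
variable {G E : Type*} [Group G] [NormedAddCommGroup E] [InnerProductSpace ℂ E]
  (A : IsometricTower G E)

lemma starProjection_apply_comm (g : G) (m : ℕ) (x : E) :
    (A.below m).starProjection (A.U g x) = A.U g ((A.below m).starProjection x) := by
  have h : A.U g x = A.U g ((A.below m).starProjection x) +
      A.U g (x - (A.below m).starProjection x) := by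
    rw [← map_add]; congr 1; abel
  rw [h, map_add, Submodule.starProjection_eq_self_iff.2 (A.apply_mem_below g m _
    (Submodule.starProjection_apply_mem _ _))]
  rw [(Submodule.starProjection_apply_eq_zero_iff _).2 (A.apply_mem_below_orthogonal g m _
    (Submodule.sub_starProjection_mem_orthogonal _)), add_zero]

lemma trace_onLayer_of_eigenvectors {ι : Type*} [Fintype ι] (m : ℕ) (e : ι → E)
    (hspan : A.Q m ≤ A.below m ⊔ Submodule.span ℂ (Set.range e))
    (he : ∀ i, e i ∈ A.Q m) (he' : ∀ i, e i ∉ A.below m) (g₀ : G) (l₀ : ι → ℂ)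
    (hl₀ : Function.Injective l₀) (h₀ : ∀ i, A.U g₀ (e i) = l₀ i • e i)
    (g : G) (l : ι → ℂ) (h : ∀ i, A.U g (e i) = l i • e i) :
    LinearMap.trace ℂ _ (A.onLayer m g) = ∑ i, l i := by
  let u : ι → A.layer m := fun i =>
    ⟨e i - (A.below m).starProjection (e i), A.sub_starProjection_mem_layer (he i)⟩
  have hu : ∀ i, (u i : E) = e i - (A.below m).starProjection (e i) := fun i => rfl
  have hu0 : ∀ i, u i ≠ 0 := by
    intro i hi
    have : (u i : E) = 0 := by rw [hi]; rfl
    rw [hu, sub_eq_zero] at this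
    exact he' i (this ▸ Submodule.starProjection_apply_mem _ _)
  have heig : ∀ (k : G) (c : ι → ℂ), (∀ i, A.U k (e i) = c i • e i) →
      ∀ i, A.onLayer m k (u i) = c i • u i := by
    intro k c hk i
    apply Subtype.ext
    rw [coe_onLayer, hu, map_sub, ← starProjection_apply_comm, hk, map_smul,
      Submodule.coe_smul, hu, smul_sub]
  have hli : LinearIndependent ℂ u :=
    Module.End.eigenvectors_linearIndependent' (A.onLayer m g₀) l₀ hl₀ u fun i =>
      ⟨Module.End.mem_eigenspace_iff.2 (heig g₀ l₀ h₀ i), hu0 i⟩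
  have hsp : ⊤ ≤ Submodule.span ℂ (Set.range u) := by
    rintro ⟨x, hx⟩ -
    obtain ⟨b, hb, s, hs, hbs⟩ := Submodule.mem_sup.1 (hspan hx.1)
    have hx0 : (A.below m).starProjection x = 0 :=
      (Submodule.starProjection_apply_eq_zero_iff _).2 hx.2
    have hxs : x = s - (A.below m).starProjection s := by
      have := congrArg (A.below m).starProjection hbs
      rw [map_add, hx0, Submodule.starProjection_eq_self_iff.2 hb] at this
      rw [← hbs, eq_neg_of_add_eq_zero_left this]; abel
    have key : ∀ s ∈ Submodule.span ℂ (Set.range e), s - (A.below m).starProjection s ∈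
        (Submodule.span ℂ (Set.range u)).map (A.layer m).subtype := by
      intro s hs
      induction hs using Submodule.span_induction with
      | mem y hy =>
        obtain ⟨i, rfl⟩ := hy
        exact ⟨u i, Submodule.subset_span ⟨i, rfl⟩, rfl⟩
      | zero => simp
      | add y z _ _ hy hz =>
        rw [map_add, add_sub_add_comm]; exact Submodule.add_mem _ hy hz
      | smul c y _ hy => rw [map_smul, ← smul_sub]; exact Submodule.smul_mem _ _ hy
    obtain ⟨v, hv, hvx⟩ := key s hs
    have : v = ⟨x, hx⟩ := Subtype.ext (hvx.trans hxs.symm)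
    exact this ▸ hv
  let b := Module.Basis.mk hli hsp
  classical
  rw [LinearMap.trace_eq_matrix_trace ℂ b, Matrix.trace]
  refine Finset.sum_congr rfl fun i _ => ?_
  rw [Matrix.diag_apply, LinearMap.toMatrix_apply, Module.Basis.mk_apply, heig g l h, map_smul]
  have : b.repr (u i) = Finsupp.single i 1 := by
    rw [← Module.Basis.mk_apply hli hsp i]; exact b.repr_self i
  rw [this]; simp

lemma trace_onLayer_conj (m : ℕ) (k g : G) :
    LinearMap.trace ℂ _ (A.onLayer m (k * g * k⁻¹)) = LinearMap.trace ℂ _ (A.onLayer m g) := by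
  rw [onLayer_mul, LinearMap.trace_mul_comm, ← onLayer_mul]
  congr 2; group
end IsometricTower

end

section
open Quaternion Finset MeasureTheory

namespace UQ

lemma height_diag_mul (φ : ℝ) (g : UQ) : height (diag φ * g) = height g := by
  have h := Real.sin_sq_add_cos_sq φ
  rw [height_apply, height_apply, orbit_mul, act_apply, diag, coe_mk']
  norm_cast
  simp only [re_mul, imI_mul, imJ_mul, imK_mul, re_star, imI_star, imJ_star, imK_star,
    re_quat, imI_quat, imJ_quat, imK_quat]
  linear_combination (orbit g).imI * h

lemma plane_diag_mul (φ : ℝ) (g : UQ) :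
    plane (diag φ * g) = Complex.exp (2 * φ * Complex.I) * plane g := by
  have hexp : Complex.exp (2 * φ * Complex.I) =
      (Complex.cos φ + Complex.sin φ * Complex.I) ^ 2 := by
    rw [← Complex.exp_mul_I, ← Complex.exp_nat_mul]; congr 1; push_cast; ring
  rw [plane_apply, plane_apply, orbit_mul, act_apply, diag, coe_mk', hexp]
  simp only [re_mul, imI_mul, imJ_mul, imK_mul, re_star, imI_star, imJ_star, imK_star,
    re_quat, imI_quat, imJ_quat, imK_quat]
  push_cast
  linear_combination (-(2 * Complex.cos φ * Complex.sin φ * (orbit g).imK) -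
    Complex.sin φ ^ 2 * ((orbit g).imJ + Complex.I * (orbit g).imK)) * Complex.I_sq

lemma planeConj_diag_mul (φ : ℝ) (g : UQ) :
    planeConj (diag φ * g) = (Complex.exp (2 * φ * Complex.I))⁻¹ * planeConj g := by
  have hexp : (Complex.exp (2 * φ * Complex.I))⁻¹ =
      (Complex.cos φ - Complex.sin φ * Complex.I) ^ 2 := by
    rw [← Complex.exp_neg]
    have := Complex.exp_mul_I (-φ)
    rw [Complex.cos_neg, Complex.sin_neg, neg_mul] at this
    rw [sub_eq_add_neg, ← neg_mul (Complex.sin φ), ← this, ← Complex.exp_nat_mul]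
    congr 1; push_cast; ring
  rw [planeConj_apply, planeConj_apply, orbit_mul, act_apply, diag, coe_mk', hexp]
  simp only [re_mul, imI_mul, imJ_mul, imK_mul, re_star, imI_star, imJ_star, imK_star,
    re_quat, imI_quat, imJ_quat, imK_quat]
  push_cast
  linear_combination (-(2 * Complex.cos φ * Complex.sin φ * (orbit g).imK) -
    Complex.sin φ ^ 2 * ((orbit g).imJ - Complex.I * (orbit g).imK)) * Complex.I_sq

lemma shift_diag_weight (φ : ℝ) (m : ℕ) (a : ℤ) :
    shift (diag φ) (weight m a) = Complex.exp (2 * φ * Complex.I) ^ a • weight m a := by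
  have h0 := Complex.exp_ne_zero (2 * φ * Complex.I)
  ext g
  simp only [shift_apply, weight, ContinuousMap.mul_apply, ContinuousMap.pow_apply,
    height_diag_mul, plane_diag_mul, planeConj_diag_mul, ContinuousMap.smul_apply, smul_eq_mul,
    mul_pow]
  have : Complex.exp (2 * φ * Complex.I) ^ a.toNat *
      (Complex.exp (2 * φ * Complex.I))⁻¹ ^ (-a).toNat = Complex.exp (2 * φ * Complex.I) ^ a := by
    rw [← zpow_natCast, ← zpow_natCast, inv_zpow', ← zpow_add₀ h0]
    congr 1; omega
  rw [← this]; ring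

noncomputable instance : MeasurableSpace UQ := borel _
instance : BorelSpace UQ := ⟨rfl⟩

/-- The normalized Haar measure of the group of unit quaternions. -/
noncomputable def haar : Measure UQ := Measure.haarMeasure ⊤

instance : haar.IsHaarMeasure := Measure.isHaarMeasure_haarMeasure _

instance : IsProbabilityMeasure haar := ⟨by
  have := Measure.haarMeasure_self (K₀ := (⊤ : TopologicalSpace.PositiveCompacts UQ))
  simpa [haar] using this⟩

/-- The Hilbert space of square-integrable functions on the group of unit quaternions. -/
abbrev L2 : Type := Lp ℂ 2 haar

/-- Translation of square-integrable functions. -/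
noncomputable def translate (h : UQ) : L2 →ₗᵢ[ℂ] L2 :=
  Lp.compMeasurePreservingₗᵢ ℂ (fun g => h * g) (measurePreserving_mul_left haar h)

/-- The class of a continuous function. -/
noncomputable def toL2 : C(UQ, ℂ) →L[ℂ] L2 := ContinuousMap.toLp 2 haar ℂ

lemma toL2_injective : Function.Injective toL2 := ContinuousMap.toLp_injective haar

lemma translate_toL2 (h : UQ) (f : C(UQ, ℂ)) : translate h (toL2 f) = toL2 (shift h f) := by
  apply Lp.ext
  refine (Lp.coeFn_compMeasurePreserving _ (measurePreserving_mul_left haar h)).trans ?_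
  have h1 := (measurePreserving_mul_left haar h).quasiMeasurePreserving.ae_eq_comp
    (ContinuousMap.coeFn_toLp (p := 2) (𝕜 := ℂ) haar f)
  have h2 := ContinuousMap.coeFn_toLp (p := 2) (𝕜 := ℂ) haar (shift h f)
  exact h1.trans h2.symm

lemma translate_one (x : L2) : translate 1 x = x := by
  have h := Lp.compMeasurePreserving_id_apply x
  have e : (fun g : UQ => 1 * g) = id := by ext1 g; exact one_mul g
  change Lp.compMeasurePreserving (fun g : UQ => 1 * g) _ x = x
  simpa only [e] using h

lemma translate_mul (g h : UQ) (x : L2) : translate (g * h) x = translate h (translate g x) := by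
  have := Lp.compMeasurePreserving_comp_apply x (measurePreserving_mul_left haar g)
    (measurePreserving_mul_left haar h)
  change Lp.compMeasurePreserving (fun k : UQ => g * h * k) _ x = _
  have e : (fun k : UQ => g * h * k) = (fun k => g * k) ∘ (fun k => h * k) := by
    ext1 k; exact mul_assoc _ _ _
  simp only [e]
  exact this

/-- The tower of polynomial functions of the orbit. -/
noncomputable def tower : IsometricTower UQ L2 where
  U := translate
  map_one := translate_one
  map_mul := translate_mul
  Q m := (affine ^ m).map toL2.toLinearMap
  finite m := Module.Finite.iff_fg.2 ((affine_pow_fg m).map _)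
  mono _ _ h := Submodule.map_mono (affine_pow_mono h)
  inv g m := by
    rintro _ ⟨f, hf, rfl⟩
    exact ⟨shift g f, shift_mem_affine_pow g m hf, (translate_toL2 g f).symm⟩

lemma tower_below (m : ℕ) : tower.below m = (affineBelow m).map toL2.toLinearMap := by
  cases m with
  | zero => simp [IsometricTower.below, affineBelow]
  | succ m => rfl

lemma injective_exp_zpow : Function.Injective
    fun a : ℤ => Complex.exp (2 * (1 : ℝ) * Complex.I) ^ a := by
  intro a b hab
  simp only [← Complex.exp_int_mul] at hab
  obtain ⟨k, hk⟩ := Complex.exp_eq_exp_iff_exists_int.1 hab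
  have hk' : (a : ℂ) = b + k * Real.pi := by
    have h2 : (2 * Complex.I : ℂ) ≠ 0 := by simp
    refine mul_right_cancel₀ h2 ?_
    push_cast at hk
    linear_combination hk
  have hk2 : (a : ℝ) = b + k * Real.pi := by exact_mod_cast hk'
  by_contra hne
  have hk0 : k ≠ 0 := by
    rintro rfl
    apply hne
    have : (a : ℝ) = b := by simpa using hk2
    exact_mod_cast this
  refine irrational_pi ⟨((a : ℚ) - b) / k, ?_⟩
  have : (k : ℝ) ≠ 0 := by exact_mod_cast hk0
  push_cast
  field_simp
  linarith

lemma trace_diag (m : ℕ) (φ : ℝ) : LinearMap.trace ℂ _ (tower.onLayer m (diag φ)) =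
    ∑ a ∈ Finset.Icc (-m : ℤ) m, Complex.exp (2 * φ * Complex.I) ^ a := by
  have habs : ∀ a : Finset.Icc (-m : ℤ) m, (a : ℤ).natAbs ≤ m := fun a => by
    have := Finset.mem_Icc.1 a.2; omega
  have heig : ∀ (ψ : ℝ) (a : Finset.Icc (-m : ℤ) m), tower.U (diag ψ) (toL2 (weight m a)) =
      Complex.exp (2 * ψ * Complex.I) ^ (a : ℤ) • toL2 (weight m a) := fun ψ a => by
    rw [← toL2.map_smul, ← shift_diag_weight, ← translate_toL2]; rfl
  rw [tower.trace_onLayer_of_eigenvectors m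
    (fun a : Finset.Icc (-m : ℤ) m => toL2 (weight m a)) ?_ ?_ ?_ (diag 1)
    (fun a => Complex.exp (2 * (1 : ℝ) * Complex.I) ^ (a : ℤ)) ?_ (heig 1) (diag φ)
    (fun a => Complex.exp (2 * φ * Complex.I) ^ (a : ℤ)) (heig φ)]
  · exact Finset.sum_coe_sort (Finset.Icc (-m : ℤ) m)
      (fun a => Complex.exp (2 * φ * Complex.I) ^ a)
  · rw [tower_below]
    refine (Submodule.map_mono (affine_pow_le_sup m)).trans ?_
    rw [Submodule.map_sup, weightSpan, Submodule.map_span]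
    refine sup_le_sup le_rfl (Submodule.span_mono ?_)
    rintro _ ⟨_, ⟨a, ha, rfl⟩, rfl⟩
    simp only [Set.mem_ofPred_eq] at ha
    exact ⟨⟨a, Finset.mem_Icc.2 (by omega)⟩, rfl⟩
  · exact fun a => ⟨_, weight_mem m (habs a), rfl⟩
  · rintro a h
    rw [tower_below] at h
    obtain ⟨f, hf, hfa⟩ := h
    exact weight_notMem m (habs a) (toL2_injective hfa ▸ hf)
  · exact injective_exp_zpow.comp Subtype.coe_injective

lemma sum_Icc_zpow (w : ℂ) (hw : w ≠ 0) {m L : ℕ} (h : m ≤ L) :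
    ∑ i ∈ Finset.Icc (L - m) (L + m), w ^ i = w ^ L * ∑ a ∈ Finset.Icc (-m : ℤ) m, w ^ a := by
  rw [Finset.mul_sum]
  refine Finset.sum_nbij' (fun i => (i : ℤ) - L) (fun a => (a + L).toNat) ?_ ?_ ?_ ?_ ?_
  · intro i hi; simp only [Finset.mem_Icc] at hi ⊢; omega
  · intro i hi; simp only [Finset.mem_Icc] at hi ⊢; omega
  · intro i hi; simp
  · intro i hi; simp only [Finset.mem_Icc] at hi ⊢; omega
  · intro i hi
    rw [← zpow_natCast w L, ← zpow_add₀ hw, ← zpow_natCast]; congr 1; ring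

/-- The real quaternion with the same coordinates as an integer quaternion. -/
def toReal (x : ℍ[ℤ]) : ℍ[ℝ] := quat x.re x.imI x.imJ x.imK

lemma toReal_mul (x y : ℍ[ℤ]) : toReal (x * y) = toReal x * toReal y := by
  refine Quaternion.ext _ _ ?_ ?_ ?_ ?_ <;> simp [toReal]

lemma toReal_star (x : ℍ[ℤ]) : toReal (star x) = star (toReal x) := by
  refine Quaternion.ext _ _ ?_ ?_ ?_ ?_ <;> simp [toReal]

lemma normSq_toReal (x : ℍ[ℤ]) : normSq (toReal x) = ((normSq x : ℤ) : ℝ) := by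
  rw [normSq_def', normSq_def']; simp [toReal]

lemma normSq_toReal_pos {x : ℍ[ℤ]} (hx : x ≠ 0) : 0 < normSq (toReal x) := by
  rw [normSq_toReal]
  exact_mod_cast lt_of_le_of_ne normSq_nonneg (Ne.symm (normSq_ne_zero.2 hx))

lemma normSq_inv_sqrt_smul {a : ℍ[ℝ]} (ha : 0 < normSq a) :
    normSq ((Real.sqrt (normSq a))⁻¹ • a) = 1 := by
  rw [normSq_smul, inv_pow, Real.sq_sqrt ha.le, inv_mul_cancel₀ ha.ne']

open scoped Classical in
/-- The direction of a nonzero integer quaternion. -/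
noncomputable def direction (x : ℍ[ℤ]) : UQ :=
  if hx : x = 0 then 1 else mk' _ (normSq_inv_sqrt_smul (normSq_toReal_pos hx))

lemma coe_direction {x : ℍ[ℤ]} (hx : x ≠ 0) :
    (direction x : ℍ[ℝ]) = (Real.sqrt (normSq (toReal x)))⁻¹ • toReal x := by
  rw [direction, dif_neg hx, coe_mk']

lemma direction_one : direction 1 = 1 := by
  apply Subtype.ext
  have : toReal 1 = 1 := by refine Quaternion.ext _ _ ?_ ?_ ?_ ?_ <;> simp [toReal]
  rw [coe_direction one_ne_zero, this]
  simp

lemma direction_mul {x y : ℍ[ℤ]} (hx : x ≠ 0) (hy : y ≠ 0) :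
    direction (x * y) = direction x * direction y := by
  apply Subtype.ext
  have : ((direction x * direction y : UQ) : ℍ[ℝ]) = direction x * direction y := rfl
  rw [this, coe_direction hx, coe_direction hy, coe_direction (mul_ne_zero hx hy), toReal_mul,
    map_mul, Real.sqrt_mul normSq_nonneg, smul_mul_smul_comm, mul_inv]

lemma direction_star {x : ℍ[ℤ]} (hx : x ≠ 0) : direction (star x) = (direction x)⁻¹ := by
  apply Subtype.ext
  have hx' : star x ≠ 0 := by simpa using hx
  rw [coe_inv, coe_direction hx, coe_direction hx', toReal_star, normSq_star]
  simp

lemma sq_re_direction {x : ℍ[ℤ]} (hx : x ≠ 0) : (direction x : ℍ[ℝ]).re ^ 2 = cosSq x := by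
  rw [coe_direction hx, re_smul, smul_eq_mul, mul_pow, inv_pow,
    Real.sq_sqrt (normSq_toReal_pos hx).le, normSq_toReal, cosSq, inv_mul_eq_div]
  simp [toReal]

lemma characterIdentity_tower : tower.CharacterIdentity direction := by
  intro L x hx
  obtain ⟨k, φ, hk, hφ⟩ := exists_conj_diag (direction x)
  rw [← sq_re_direction hx, ← hφ]
  set w := Complex.exp (2 * φ * Complex.I) with hw
  have hw0 : w ≠ 0 := Complex.exp_ne_zero _
  have htr : ∀ j, LinearMap.trace ℂ _ (tower.onLayer j (direction x)) =
      ∑ a ∈ Finset.Icc (-j : ℤ) j, w ^ a := fun j => by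
    rw [hk, tower.trace_onLayer_conj, trace_diag]
  have hone : (w + 1) ^ (2 * L) = w ^ L * ((4 * Real.cos φ ^ 2 : ℝ) : ℂ) ^ L := by
    have : (w + 1) ^ 2 = w * ((4 * Real.cos φ ^ 2 : ℝ) : ℂ) := by
      have e1 : w = Complex.exp (φ * Complex.I) ^ 2 := by
        rw [hw, ← Complex.exp_nat_mul]; congr 1; push_cast; ring
      have e2 : (1 : ℂ) = Complex.exp (φ * Complex.I) * Complex.exp (-φ * Complex.I) := by
        rw [← Complex.exp_add]; simp
      have e3 : ((4 * Real.cos φ ^ 2 : ℝ) : ℂ) =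
          (Complex.exp (φ * Complex.I) + Complex.exp (-φ * Complex.I)) ^ 2 := by
        push_cast; rw [Complex.cos]; ring
      rw [e3, e1]
      set p := Complex.exp (φ * Complex.I)
      set q := Complex.exp (-φ * Complex.I)
      linear_combination (p ^ 2 + 1 + p ^ 2 + p * q) * e2
    rw [pow_mul, this, mul_pow]
  rw [one_add_pow_eq_sum_tensorMult] at hone
  have hsum : ∑ j ∈ range (L + 1), (tensorMult L j : ℂ) * ∑ a ∈ Finset.Icc (-j : ℤ) j, w ^ a =
      ((4 * Real.cos φ ^ 2 : ℝ) : ℂ) ^ L := by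
    refine mul_left_cancel₀ (pow_ne_zero L hw0) ?_
    rw [← hone, Finset.mul_sum]
    refine Finset.sum_congr rfl fun j hj => ?_
    rw [sum_Icc_zpow w hw0 (Nat.lt_succ_iff.1 (Finset.mem_range.1 hj))]
    ring
  have := congrArg Complex.re hsum
  rw [Complex.re_sum, ← Complex.ofReal_pow, Complex.ofReal_re] at this
  rw [← this]
  refine Finset.sum_congr rfl fun j _ => ?_
  rw [htr, Complex.re_ofReal_mul]

end UQ

end

section
open Quaternion Finset MeasureTheory

namespace UQ

instance : PreconnectedSpace UQ := by
  have h : 1 < Module.rank ℝ ℍ[ℝ] := by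
    rw [Quaternion.rank_eq_four]; norm_num
  exact Subtype.preconnectedSpace (isPreconnected_sphere h 0 1)

lemma exists_const_of_isIntegral {f : C(UQ, ℂ)} (hf : IsIntegral ℂ f) :
    ∃ c : ℂ, f = c • (1 : C(UQ, ℂ)) := by
  obtain ⟨P, hP, hPf⟩ := hf
  have hroot : ∀ g, f g ∈ ({z | z ∈ P.roots.toFinset} : Set ℂ) := by
    intro g
    have h1 : Polynomial.aeval f P = 0 := hPf
    have h2 := congrArg (ContinuousMap.evalAlgHom ℂ ℂ g) h1
    rw [← Polynomial.aeval_algHom_apply, map_zero, Polynomial.coe_aeval_eq_eval] at h2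
    simp only [Set.mem_ofPred_eq, Multiset.mem_toFinset]
    exact (Polynomial.mem_roots hP.ne_zero).2 h2
  have hfin : (P.roots.toFinset : Set ℂ).Finite := P.roots.toFinset.finite_toSet
  refine ⟨f 1, ?_⟩
  ext g
  have := isPreconnected_univ.constant_of_mapsTo hfin.isDiscrete f.continuous.continuousOn
    (fun g _ => hroot g) (Set.mem_univ g) (Set.mem_univ 1)
  simpa using this

lemma isIntegral_of_pow_mem {f : C(UQ, ℂ)} {m : ℕ} (h : ∀ r, f ^ r ∈ affine ^ m) :
    IsIntegral ℂ f := by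
  refine IsIntegral.of_mem_of_fg (Algebra.adjoin ℂ {f}) ?_ f
    (Algebra.subset_adjoin (Set.mem_singleton f))
  have : Module.Finite ℂ (affine ^ m : Submodule ℂ C(UQ, ℂ)) :=
    Module.Finite.iff_fg.2 (affine_pow_fg m)
  have hn : IsNoetherian ℂ (affine ^ m : Submodule ℂ C(UQ, ℂ)) := inferInstance
  refine isNoetherian_submodule.1 hn _ ?_
  intro x hx
  rw [Subalgebra.mem_toSubmodule, Algebra.adjoin_singleton_eq_range_aeval] at hx
  obtain ⟨p, rfl⟩ := hx
  change Polynomial.aeval f p ∈ _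
  rw [Polynomial.aeval_eq_sum_range]
  exact Submodule.sum_mem _ fun i _ => Submodule.smul_mem _ _ (h i)

lemma mem_Q_iff {m : ℕ} {f : C(UQ, ℂ)} : toL2 f ∈ tower.Q m ↔ f ∈ affine ^ m := by
  constructor
  · rintro ⟨g, hg, h⟩
    exact toL2_injective h ▸ hg
  · exact fun h => ⟨f, h, rfl⟩

lemma translate_toL2_eq_iff (h : UQ) (f : C(UQ, ℂ)) :
    translate h (toL2 f) = toL2 f ↔ shift h f = f := by
  rw [translate_toL2]; exact toL2_injective.eq_iff

theorem exists_displacement_bound_tower : ∃ C : ℝ, 0 < C ∧ ∀ m, ∀ f ∈ affine ^ m, ∀ g,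
    ‖translate g (toL2 f) - toL2 f‖ ^ 2 ≤ C * tower.displacement direction (toL2 f) := by
  have := tower.exists_displacement_bound (d := direction) direction_one
    (fun x y hx hy => direction_mul hx hy) (fun x hx => direction_star hx)
    characterIdentity_tower ?_ ?_
  · obtain ⟨C, hC, h⟩ := this
    exact ⟨C, hC, fun m f hf g => h m _ (mem_Q_iff.2 hf) g⟩
  · rintro g _ ⟨f, hf, rfl⟩
    change translate g (toL2 f) = toL2 f
    rw [translate_toL2_eq_iff]
    rw [pow_zero, Submodule.one_eq_span, SetLike.mem_coe, Submodule.mem_span_singleton] at hf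
    obtain ⟨c, rfl⟩ := hf
    rw [map_smul, map_one]
  · rintro m₀ hm₀ m _ ⟨f, hf, rfl⟩ hfix
    have hpow : ∀ r, f ^ r ∈ affine ^ m₀ := by
      intro r
      refine mem_Q_iff.1 (hm₀ (m * r) _ (mem_Q_iff.2 ?_) ?_)
      · rw [pow_mul]; exact Submodule.pow_mem_pow _ hf r
      · intro q hq
        change translate _ (toL2 _) = toL2 _
        rw [translate_toL2_eq_iff, map_pow, (translate_toL2_eq_iff _ _).1 (hfix q hq)]
    obtain ⟨c, hc⟩ := exists_const_of_isIntegral (isIntegral_of_pow_mem hpow)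
    refine mem_Q_iff.2 ?_
    rw [hc, pow_zero]
    exact Submodule.smul_mem _ _ (Submodule.one_le.1 le_rfl)

lemma exists_displacement_bound_closure : ∃ C : ℝ, 0 < C ∧
    ∀ f ∈ closure (⋃ m, ((affine ^ m : Submodule ℂ C(UQ, ℂ)) : Set C(UQ, ℂ))), ∀ g,
    ‖translate g (toL2 f) - toL2 f‖ ^ 2 ≤ C * tower.displacement direction (toL2 f) := by
  obtain ⟨C, hC, h⟩ := exists_displacement_bound_tower
  refine ⟨C, hC, fun f hf g => ?_⟩
  have hcl : IsClosed {f : C(UQ, ℂ) |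
      ‖translate g (toL2 f) - toL2 f‖ ^ 2 ≤ C * tower.displacement direction (toL2 f)} := by
    refine isClosed_le ?_ ?_
    · have h1 : Continuous (translate g) := (translate g).continuous
      have h2 : Continuous toL2 := toL2.continuous
      exact (((h1.comp h2).sub h2).norm).pow 2
    · exact continuous_const.mul ((tower.continuous_displacement direction).comp toL2.continuous)
  refine closure_minimal ?_ hcl hf
  intro f hf
  obtain ⟨m, hm⟩ := Set.mem_iUnion.1 hf
  exact h m f hm g

/-- The orbit map into the unit sphere of the quaternions. -/
noncomputable def orbitUQ : C(UQ, UQ) :=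
  ⟨fun g => mk' (orbit g) (normSq_orbit g), continuous_orbit.subtype_mk _⟩

/-- Complexification of the composition with the orbit map. -/
noncomputable def pull : C(UQ, ℝ) →+* C(UQ, ℂ) where
  toFun F := ⟨fun g => (F (orbitUQ g) : ℂ),
    Complex.continuous_ofReal.comp (F.continuous.comp orbitUQ.continuous)⟩
  map_one' := by ext; simp
  map_zero' := by ext; simp
  map_mul' _ _ := by ext; simp
  map_add' _ _ := by ext; simp

lemma pull_apply (F : C(UQ, ℝ)) (g : UQ) : pull F g = (F (orbitUQ g) : ℂ) := rfl

lemma continuous_pull : Continuous pull :=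
  ((ContinuousMap.continuous_postcomp
    ⟨fun x : ℝ => (x : ℂ), Complex.continuous_ofReal⟩).comp
      (ContinuousMap.continuous_precomp orbitUQ) : _)

/-- The functions on the sphere that restrict to polynomials on the orbit. -/
noncomputable def polySubalgebra : Subalgebra ℝ C(UQ, ℝ) where
  carrier := {F | ∃ m, pull F ∈ affine ^ m}
  mul_mem' := by
    rintro F H ⟨m, hm⟩ ⟨k, hk⟩
    refine ⟨m + k, ?_⟩
    rw [map_mul, pow_add]; exact Submodule.mul_mem_mul hm hk
  add_mem' := by
    rintro F H ⟨m, hm⟩ ⟨k, hk⟩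
    refine ⟨m + k, ?_⟩
    rw [map_add]
    exact Submodule.add_mem _ (affine_pow_mono (Nat.le_add_right m k) hm)
      (affine_pow_mono (Nat.le_add_left k m) hk)
  algebraMap_mem' r := by
    refine ⟨0, ?_⟩
    have : pull (algebraMap ℝ C(UQ, ℝ) r) = (r : ℂ) • (1 : C(UQ, ℂ)) := by
      refine ContinuousMap.ext fun g => ?_
      rw [pull_apply, ContinuousMap.smul_apply, ContinuousMap.one_apply, smul_eq_mul, mul_one]
      rfl
    rw [this, pow_zero]
    exact Submodule.smul_mem _ _ (Submodule.one_le.1 le_rfl)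

lemma polySubalgebra_separatesPoints : polySubalgebra.SeparatesPoints := by
  have hmem : ∀ l : ℍ[ℝ] →ₗ[ℝ] ℝ,
      (⟨fun g : UQ => l g, l.continuous_of_finiteDimensional.comp continuous_subtype_val⟩ :
        C(UQ, ℝ)) ∈ polySubalgebra := by
    intro l
    refine ⟨1, ?_⟩
    rw [pow_one]
    exact lin_mem_affine (Complex.ofRealCLM.toLinearMap ∘ₗ l)
  intro x y hxy
  by_contra! hcon
  apply hxy
  have key : ∀ l : ℍ[ℝ] →ₗ[ℝ] ℝ, l x = l y := fun l => hcon _ ⟨_, hmem l, rfl⟩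
  apply Subtype.ext
  refine Quaternion.ext _ _ ?_ ?_ ?_ ?_
  · exact key ⟨⟨fun a => a.re, fun a b => by simp⟩, fun r a => by simp⟩
  · exact key ⟨⟨fun a => a.imI, fun a b => by simp⟩, fun r a => by simp⟩
  · exact key ⟨⟨fun a => a.imJ, fun a b => by simp⟩, fun r a => by simp⟩
  · exact key ⟨⟨fun a => a.imK, fun a b => by simp⟩, fun r a => by simp⟩

lemma pull_mem_closure (F : C(UQ, ℝ)) :
    pull F ∈ closure (⋃ m, ((affine ^ m : Submodule ℂ C(UQ, ℂ)) : Set C(UQ, ℂ))) := by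
  have h := ContinuousMap.subalgebra_topologicalClosure_eq_top_of_separatesPoints _
    polySubalgebra_separatesPoints
  have hF : F ∈ closure (polySubalgebra : Set C(UQ, ℝ)) := by
    rw [← Subalgebra.topologicalClosure_coe, h]; trivial
  exact map_mem_closure continuous_pull hF fun H ⟨m, hm⟩ => Set.mem_iUnion.2 ⟨m, hm⟩

lemma norm_sq_translate_sub (h : UQ) (f : C(UQ, ℂ)) :
    ‖translate h (toL2 f) - toL2 f‖ ^ 2 = ∫ g, ‖f (h * g) - f g‖ ^ 2 ∂haar := by
  rw [translate_toL2, ← toL2.map_sub, ← inner_self_eq_norm_sq (𝕜 := ℂ)]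
  rw [toL2, ContinuousMap.inner_toLp]
  have e : ∀ g, (shift h f - f) g * (starRingEnd ℂ) ((shift h f - f) g) =
      ((‖f (h * g) - f g‖ ^ 2 : ℝ) : ℂ) := fun g => by
    rw [ContinuousMap.sub_apply, shift_apply, RCLike.mul_conj]
    push_cast; rfl
  simp_rw [e]
  rw [integral_complex_ofReal]
  exact RCLike.ofReal_re _

/-- The spectral gap of the action of the integer quaternions of norm `7` on the orbit. -/
theorem exists_orbit_displacement_bound : ∃ C : ℝ, 0 < C ∧ ∀ φ : ℍ[ℝ] → ℝ, Continuous φ →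
    ∀ h : UQ, ∫ g, (φ (orbit (h * g)) - φ (orbit g)) ^ 2 ∂haar ≤
      C * ∑ q ∈ shell 7, ∫ g, (φ (orbit (direction q * g)) - φ (orbit g)) ^ 2 ∂haar := by
  obtain ⟨C, hC, h⟩ := exists_displacement_bound_closure
  refine ⟨C, hC, fun φ hφ k => ?_⟩
  have := h _ (pull_mem_closure ⟨fun x => φ x, hφ.comp continuous_subtype_val⟩) k
  have e : ∀ k, ‖translate k (toL2 (pull ⟨fun x => φ x, hφ.comp continuous_subtype_val⟩)) -
      toL2 (pull ⟨fun x => φ x, hφ.comp continuous_subtype_val⟩)‖ ^ 2 =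
      ∫ g, (φ (orbit (k * g)) - φ (orbit g)) ^ 2 ∂haar := by
    intro k
    rw [norm_sq_translate_sub]
    refine integral_congr_ae (Filter.Eventually.of_forall fun g => ?_)
    simp only [pull_apply]
    rw [← Complex.ofReal_sub, Complex.norm_real, Real.norm_eq_abs, sq_abs]
    rfl
  rw [e] at this
  refine this.trans (le_of_eq ?_)
  congr 1
  exact Finset.sum_congr rfl fun q _ => e _
end UQ

end

section
open Quaternion Finset MeasureTheory

namespace UQ

instance : haar.IsMulRightInvariant := by
  refine ⟨fun g => ?_⟩
  have : IsProbabilityMeasure (haar.map (· * g)) :=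
    Measure.isProbabilityMeasure_map (measurable_mul_const g).aemeasurable
  have h := Measure.isMulInvariant_eq_smul_of_compactSpace (haar.map (· * g)) haar
  have h2 := congrArg (fun m : Measure UQ => m Set.univ) h
  simp only [measure_univ, Measure.smul_apply] at h2
  rw [h]
  have h3 : Measure.haarScalarFactor (haar.map (· * g)) haar = 1 := by
    have : (1 : ENNReal) = (Measure.haarScalarFactor (haar.map (· * g)) haar : ENNReal) := by
      simpa [ENNReal.smul_def] using h2
    exact_mod_cast this.symm
  rw [h3, one_smul]

lemma exists_smul_act_unitI {a : ℍ[ℝ]} (ha : a.re = 0) :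
    ∃ (r : ℝ) (k : UQ), a = r • act k unitI := by
  by_cases h0 : a = 0
  · exact ⟨0, 1, by simp [h0]⟩
  have hpos : 0 < normSq a := lt_of_le_of_ne normSq_nonneg (Ne.symm (normSq_ne_zero.2 h0))
  obtain ⟨k, hk⟩ := exists_act_unitI ((Real.sqrt (normSq a))⁻¹ • a) (by simp [ha])
    (normSq_inv_sqrt_smul hpos)
  refine ⟨Real.sqrt (normSq a), k, ?_⟩
  rw [hk, smul_smul, mul_inv_cancel₀ (Real.sqrt_pos.2 hpos).ne', one_smul]

/-- The spectral gap of the action of the integer quaternions of norm `7` on the orbits of purely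
imaginary quaternions. -/
theorem exists_act_displacement_bound : ∃ C : ℝ, 0 < C ∧ ∀ φ : ℍ[ℝ] → ℝ, Continuous φ →
    ∀ a : ℍ[ℝ], a.re = 0 → ∀ h : UQ, ∫ g, (φ (act (h * g) a) - φ (act g a)) ^ 2 ∂haar ≤
      C * ∑ q ∈ shell 7, ∫ g, (φ (act (direction q * g) a) - φ (act g a)) ^ 2 ∂haar := by
  obtain ⟨C, hC, H⟩ := exists_orbit_displacement_bound
  refine ⟨C, hC, fun φ hφ a ha h => ?_⟩
  obtain ⟨r, k, rfl⟩ := exists_smul_act_unitI ha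
  have key := H (fun x => φ (r • x)) (hφ.comp (continuous_const_smul r)) h
  have e : ∀ h : UQ, ∫ g, (φ (act (h * g) (r • act k unitI)) - φ (act g (r • act k unitI))) ^ 2
      ∂haar = ∫ g, (φ (r • orbit (h * g)) - φ (r • orbit g)) ^ 2 ∂haar := by
    intro h
    rw [← integral_mul_right_eq_self (μ := haar)
      (fun g => (φ (r • orbit (h * g)) - φ (r • orbit g)) ^ 2) k]
    refine integral_congr_ae (Filter.Eventually.of_forall fun g => ?_)
    simp only [orbit, ← mul_assoc, act_mul _ k, LinearMap.map_smul]
  simp only [e]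
  exact key

lemma exists_eq_mul_self (g : UQ) : ∃ k, g = k * k := by
  obtain ⟨k, φ, hk, -⟩ := exists_conj_diag g
  refine ⟨k * diag (φ / 2) * k⁻¹, ?_⟩
  have : diag (φ / 2) * diag (φ / 2) = diag φ := by
    apply Subtype.ext
    change (diag (φ / 2) : ℍ[ℝ]) * diag (φ / 2) = diag φ
    have hc : Real.cos φ = Real.cos (φ / 2) ^ 2 - Real.sin (φ / 2) ^ 2 := by
      rw [← Real.cos_two_mul']; congr 1; ring
    have hs : Real.sin φ = 2 * Real.sin (φ / 2) * Real.cos (φ / 2) := by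
      rw [← Real.sin_two_mul]; congr 1; ring
    refine Quaternion.ext _ _ ?_ ?_ ?_ ?_ <;> simp [diag] <;> linarith
  rw [hk, ← this]; group

/-- A unit quaternion acting as a rotation of the plane of the first two imaginary units. -/
lemma exists_act_planar (a b : ℝ) : ∃ g : UQ, ∃ c s : ℝ,
    (∀ x y z, act g (quat 0 x y z) = quat 0 (c * x - s * y) (s * x + c * y) z) ∧
    c * a - s * b = 0 ∧ 0 ≤ s * a + c * b := by
  set w : ℂ := ⟨b, a⟩ with hw
  set θ := w.arg with hθ
  refine ⟨mk' (quat (Real.cos (θ / 2)) 0 0 (Real.sin (θ / 2))) ?_, Real.cos θ, Real.sin θ,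
    fun x y z => ?_, ?_, ?_⟩
  · simp [normSq_def']
  · have hc : Real.cos θ = Real.cos (θ / 2) ^ 2 - Real.sin (θ / 2) ^ 2 := by
      rw [← Real.cos_two_mul']; congr 1; ring
    have hs : Real.sin θ = 2 * Real.sin (θ / 2) * Real.cos (θ / 2) := by
      rw [← Real.sin_two_mul]; congr 1; ring
    have h1 := Real.sin_sq_add_cos_sq (θ / 2)
    rw [hc, hs, act_apply, coe_mk']
    refine Quaternion.ext _ _ ?_ ?_ ?_ ?_ <;>
      simp only [re_mul, imI_mul, imJ_mul, imK_mul, re_star, imI_star, imJ_star, imK_star,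
        re_quat, imI_quat, imJ_quat, imK_quat]
    · ring
    · ring
    · ring
    · linear_combination z * h1
  · have h1 : ‖w‖ * Real.cos θ = b := Complex.norm_mul_cos_arg w
    have h2 : ‖w‖ * Real.sin θ = a := Complex.norm_mul_sin_arg w
    rw [← h1, ← h2]; ring
  · have h1 : ‖w‖ * Real.cos θ = b := Complex.norm_mul_cos_arg w
    have h2 : ‖w‖ * Real.sin θ = a := Complex.norm_mul_sin_arg w
    have : Real.sin θ * a + Real.cos θ * b = ‖w‖ := by
      rw [← h1, ← h2]; linear_combination ‖w‖ * Real.sin_sq_add_cos_sq θ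
    rw [this]; exact norm_nonneg _

end UQ

end

/-- The group of rotations of Euclidean space. -/
def rotationGroup (n : ℕ) : Subgroup (EucSp n ≃ₗᵢ[ℝ] EucSp n) where
  carrier := {γ | IsRotation γ}
  one_mem' := LinearMap.det_id
  mul_mem' {a b} ha hb := by
    have h : LinearMap.det ((a * b).toLinearEquiv.toLinearMap) =
      LinearMap.det (a.toLinearEquiv.toLinearMap) * LinearMap.det (b.toLinearEquiv.toLinearMap) :=
      LinearMap.det_comp _ _
    exact h.trans (by rw [ha, hb, one_mul])
  inv_mem' {a} ha := by
    have h : LinearMap.det ((a * a⁻¹).toLinearEquiv.toLinearMap) =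
      LinearMap.det (a.toLinearEquiv.toLinearMap) *
        LinearMap.det (a⁻¹.toLinearEquiv.toLinearMap) := LinearMap.det_comp _ _
    rw [ha, one_mul, mul_inv_cancel] at h
    exact h.symm.trans LinearMap.det_id

lemma mem_rotationGroup {n : ℕ} {γ : EucSp n ≃ₗᵢ[ℝ] EucSp n} :
    γ ∈ rotationGroup n ↔ IsRotation γ := Iff.rfl

lemma isRotation_mul_self {n : ℕ} (γ : EucSp n ≃ₗᵢ[ℝ] EucSp n) : IsRotation (γ * γ) := by
  have h : LinearMap.det ((γ * γ).toLinearEquiv.toLinearMap) =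
    LinearMap.det (γ.toLinearEquiv.toLinearMap) * LinearMap.det (γ.toLinearEquiv.toLinearMap) :=
    LinearMap.det_comp _ _
  have h2 : ‖LinearMap.det (γ.toLinearEquiv.toLinearMap)‖ = 1 := by
    rw [← LinearMap.normDet_eq_norm_det]
    exact γ.toLinearIsometry.normDet_eq_one
  rw [IsRotation, h, ← sq, ← sq_abs, ← Real.norm_eq_abs, h2, one_pow]

namespace Triple
open Quaternion UQ
variable {n : ℕ} (σ : Fin 3 ↪ Fin n)

/-- The purely imaginary quaternion formed by three coordinates. -/
def down : EucSp n →ₗ[ℝ] ℍ[ℝ] where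
  toFun v := quat 0 (v (σ 0)) (v (σ 1)) (v (σ 2))
  map_add' v w := by refine Quaternion.ext _ _ ?_ ?_ ?_ ?_ <;> simp
  map_smul' c v := by refine Quaternion.ext _ _ ?_ ?_ ?_ ?_ <;> simp

/-- The vector with three coordinates given by a quaternion. -/
def up : ℍ[ℝ] →ₗ[ℝ] EucSp n where
  toFun a := a.imI • EuclideanSpace.single (σ 0) 1 + a.imJ • EuclideanSpace.single (σ 1) 1 +
    a.imK • EuclideanSpace.single (σ 2) 1
  map_add' a b := by simp only [imI_add, imJ_add, imK_add]; module
  map_smul' c a := by simp only [imI_smul, imJ_smul, imK_smul, RingHom.id_apply]; module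

lemma down_apply (v : EucSp n) : down σ v = quat 0 (v (σ 0)) (v (σ 1)) (v (σ 2)) := rfl

lemma up_apply (a : ℍ[ℝ]) : up σ a = a.imI • EuclideanSpace.single (σ 0) 1 +
    a.imJ • EuclideanSpace.single (σ 1) 1 + a.imK • EuclideanSpace.single (σ 2) 1 := rfl

lemma up_apply_zero (a : ℍ[ℝ]) : up σ a (σ 0) = a.imI := by
  simp [up_apply, σ.injective.eq_iff]

lemma up_apply_one (a : ℍ[ℝ]) : up σ a (σ 1) = a.imJ := by
  simp [up_apply, σ.injective.eq_iff]

lemma up_apply_two (a : ℍ[ℝ]) : up σ a (σ 2) = a.imK := by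
  simp [up_apply, σ.injective.eq_iff]

lemma up_apply_of_ne (a : ℍ[ℝ]) {i : Fin n} (h0 : i ≠ σ 0) (h1 : i ≠ σ 1) (h2 : i ≠ σ 2) :
    up σ a i = 0 := by
  simp [up_apply, h0, h1, h2]

lemma down_up {a : ℍ[ℝ]} (ha : a.re = 0) : down σ (up σ a) = a := by
  rw [down_apply, up_apply_zero, up_apply_one, up_apply_two]
  refine Quaternion.ext _ _ ?_ ?_ ?_ ?_ <;> simp [ha]

lemma inner_up (a : ℍ[ℝ]) (v : EucSp n) :
    inner ℝ (up σ a) v = a.imI * v (σ 0) + a.imJ * v (σ 1) + a.imK * v (σ 2) := by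
  simp [up_apply, inner_add_left, inner_smul_left, EuclideanSpace.inner_single_left]

/-- The action of a unit quaternion on three coordinates. -/
def map (g : UQ) : EucSp n →ₗ[ℝ] EucSp n :=
  LinearMap.id + up σ ∘ₗ (act g - LinearMap.id) ∘ₗ down σ

lemma map_apply (g : UQ) (v : EucSp n) :
    map σ g v = v + up σ (act g (down σ v) - down σ v) := rfl

lemma re_act_down (g : UQ) (v : EucSp n) : (act g (down σ v)).re = 0 := by
  rw [re_act]; simp [down_apply]

lemma down_map (g : UQ) (v : EucSp n) : down σ (map σ g v) = act g (down σ v) := by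
  rw [map_apply, _root_.map_add, down_up, add_sub_cancel]
  rw [re_sub, re_act_down, down_apply]; simp

lemma map_mul (g h : UQ) (v : EucSp n) : map σ (g * h) v = map σ g (map σ h v) := by
  rw [map_apply σ g, down_map, map_apply, map_apply, act_mul, add_assoc, ← _root_.map_add]
  congr 2; abel

lemma map_one (v : EucSp n) : map σ 1 v = v := by
  rw [map_apply, act_one, sub_self, map_zero, add_zero]

lemma norm_map (g : UQ) (v : EucSp n) : ‖map σ g v‖ = ‖v‖ := by
  have h := normSq_act g (down σ v)
  have hre := re_act_down σ g v
  rw [normSq_def', normSq_def', hre] at h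
  set e := act g (down σ v) with he
  have h2 : ‖map σ g v‖ ^ 2 = ‖v‖ ^ 2 := by
    rw [map_apply, ← he, norm_add_sq_real, ← real_inner_self_eq_norm_sq (up σ _),
      real_inner_comm, inner_up, inner_up, up_apply_zero, up_apply_one, up_apply_two]
    simp only [imI_sub, imJ_sub, imK_sub]
    simp only [down_apply, imI_quat, imJ_quat, imK_quat, re_quat] at h ⊢
    linarith
  exact (sq_eq_sq₀ (norm_nonneg _) (norm_nonneg _)).1 h2

/-- The action of the unit quaternions on three coordinates by isometries. -/
def isom (g : UQ) : EucSp n ≃ₗᵢ[ℝ] EucSp n where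
  toLinearEquiv := LinearEquiv.ofLinearMap (map σ g) (map σ g⁻¹)
    (LinearMap.ext fun v => by
      rw [LinearMap.comp_apply, ← map_mul, mul_inv_cancel, map_one, LinearMap.id_apply])
    (LinearMap.ext fun v => by
      rw [LinearMap.comp_apply, ← map_mul, inv_mul_cancel, map_one, LinearMap.id_apply])
  norm_map' := norm_map σ g

lemma isom_apply (g : UQ) (v : EucSp n) :
    isom σ g v = v + up σ (act g (down σ v) - down σ v) := rfl

lemma isom_mul (g h : UQ) : isom σ (g * h) = isom σ g * isom σ h :=
  LinearIsometryEquiv.ext fun v => map_mul σ g h v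

lemma isRotation_isom (g : UQ) : IsRotation (isom σ g) := by
  obtain ⟨k, rfl⟩ := exists_eq_mul_self g
  rw [isom_mul]
  exact isRotation_mul_self _

lemma isom_mem (g : UQ) : isom σ g ∈ rotationGroup n := isRotation_isom σ g

end Triple

namespace IsometricAction

variable {G H : Type*} [NormedAddCommGroup H] [InnerProductSpace ℝ H]
  {U : G → H →ₗᵢ[ℝ] H}

/-- The displacement of a vector by every element of the set is controlled by its displacement by
finitely many elements of the group. -/
def Controlled (U : G → H →ₗᵢ[ℝ] H) (M : Set G) : Prop :=
  ∃ (S : Finset G) (C : ℝ), 0 ≤ C ∧ ∀ g ∈ M, ∀ f, ‖U g f - f‖ ≤ C * ∑ s ∈ S, ‖U s f - f‖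

lemma Controlled.mono {M N : Set G} (h : Controlled U N) (hMN : M ⊆ N) : Controlled U M := by
  obtain ⟨S, C, hC, h⟩ := h
  exact ⟨S, C, hC, fun g hg => h g (hMN hg)⟩

lemma controlled_one [Group G] (h1 : ∀ f, U 1 f = f) : Controlled U {1} :=
  ⟨∅, 0, le_rfl, fun g hg f => by rw [mem_singleton_iff.1 hg, h1]; simp⟩

lemma Controlled.mul [Group G] (hU : ∀ g h f, U (g * h) f = U h (U g f)) {M N : Set G}
    (hM : Controlled U M) (hN : Controlled U N) :
    Controlled U {γ | ∃ g ∈ M, ∃ h ∈ N, γ = g * h} := by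
  classical
  obtain ⟨S, C, hC, hM⟩ := hM
  obtain ⟨T, D, hD, hN⟩ := hN
  refine ⟨S ∪ T, C + D, add_nonneg hC hD, ?_⟩
  rintro _ ⟨g, hg, h, hh, rfl⟩ f
  have e1 : ∑ s ∈ S, ‖U s f - f‖ ≤ ∑ s ∈ S ∪ T, ‖U s f - f‖ :=
    Finset.sum_le_sum_of_subset_of_nonneg Finset.subset_union_left fun _ _ _ => norm_nonneg _
  have e2 : ∑ s ∈ T, ‖U s f - f‖ ≤ ∑ s ∈ S ∪ T, ‖U s f - f‖ :=
    Finset.sum_le_sum_of_subset_of_nonneg Finset.subset_union_right fun _ _ _ => norm_nonneg _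
  have e3 : ‖U (g * h) f - f‖ ≤ ‖U g f - f‖ + ‖U h f - f‖ := by
    have : U (g * h) f - f = U h (U g f - f) + (U h f - f) := by
      rw [hU, map_sub]; abel
    rw [this]
    exact (norm_add_le _ _).trans_eq (by rw [LinearIsometry.norm_map])
  calc _ ≤ _ := e3
    _ ≤ C * ∑ s ∈ S, ‖U s f - f‖ + D * ∑ s ∈ T, ‖U s f - f‖ :=
      add_le_add (hM g hg f) (hN h hh f)
    _ ≤ (C + D) * ∑ s ∈ S ∪ T, ‖U s f - f‖ := by
      rw [add_mul]
      exact add_le_add (mul_le_mul_of_nonneg_left e1 hC) (mul_le_mul_of_nonneg_left e2 hD)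

/-- A vector which is moved little by the whole group is close to an invariant vector. -/
lemma exists_invariant_near [Group G] [CompleteSpace H]
    (hU : ∀ g h f, U (g * h) f = U h (U g f)) {K : Submodule ℝ H} (hK : IsClosed (K : Set H))
    (hKU : ∀ g, ∀ f ∈ K, U g f ∈ K) {f : H} (hf : f ∈ K) {D : ℝ} (hD : ∀ g, ‖U g f - f‖ ≤ D) :
    ∃ q ∈ K, (∀ g, U g q = q) ∧ ‖q - f‖ ≤ D := by
  set A : Set H := closure (convexHull ℝ (range fun g => U g f)) with hA
  have hne : A.Nonempty := ⟨U 1 f, subset_closure (subset_convexHull ℝ _ ⟨1, rfl⟩)⟩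
  have hconv : Convex ℝ A := (convex_convexHull ℝ _).closure
  have hAK : A ⊆ K := closure_minimal
    (convexHull_min (range_subset_iff.2 fun g => hKU g f hf) K.convex) hK
  have hAD : A ⊆ closedBall f D := closure_minimal
    (convexHull_min (range_subset_iff.2 fun g => by
      rw [mem_closedBall, dist_eq_norm]; exact hD g) (convex_closedBall f D)) isClosed_closedBall
  have hinv : ∀ g, ∀ x ∈ A, U g x ∈ A := by
    intro g x hx
    refine map_mem_closure (U g).continuous hx fun y hy => ?_
    have : U g y ∈ (U g).toLinearMap '' convexHull ℝ (range fun g => U g f) := ⟨y, hy, rfl⟩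
    rw [LinearMap.image_convexHull] at this
    refine convexHull_mono ?_ this
    rintro _ ⟨_, ⟨k, rfl⟩, rfl⟩
    exact ⟨k * g, hU k g f⟩
  obtain ⟨q, hq, hmin⟩ := exists_norm_eq_iInf_of_complete_convex hne
    isClosed_closure.isComplete hconv 0
  have hinner := (norm_eq_iInf_iff_real_inner_le_zero hconv hq).1 hmin
  refine ⟨q, hAK hq, fun g => ?_, by simpa [dist_eq_norm] using hAD hq⟩
  have h2 := hinner _ (hinv g q hq)
  have h3 : ‖U g q - q‖ ^ 2 ≤ 0 := by
    rw [norm_sub_sq_real, LinearIsometry.norm_map]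
    rw [zero_sub, inner_neg_left, inner_sub_right, real_inner_self_eq_norm_sq] at h2
    rw [real_inner_comm] at h2
    linarith
  exact sub_eq_zero.1 (norm_eq_zero.1 (pow_eq_zero_iff two_ne_zero |>.1
    (le_antisymm h3 (sq_nonneg _))))

/-- The average of a vector over a finite subset of the group. -/
def groupAverage (U : G → H →ₗᵢ[ℝ] H) (S : Finset G) (f : H) : H :=
  (S.card : ℝ)⁻¹ • ∑ s ∈ S, U s f

lemma groupAverage_mem {K : Submodule ℝ H} (hKU : ∀ g, ∀ f ∈ K, U g f ∈ K) (S : Finset G) {f : H}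
    (hf : f ∈ K) : groupAverage U S f ∈ K :=
  K.smul_mem _ (K.sum_mem fun s _ => hKU s f hf)

/-- If every displacement is controlled by finitely many ones, averaging over a finite set contracts
an invariant closed subspace without invariant vectors. -/
theorem exists_groupAverage_contraction [Group G] [CompleteSpace H]
    (hU : ∀ g h f, U (g * h) f = U h (U g f)) (h1 : ∀ f, U 1 f = f)
    {K : Submodule ℝ H} (hK : IsClosed (K : Set H))
    (hKU : ∀ g, ∀ f ∈ K, U g f ∈ K) (hfix : ∀ f ∈ K, (∀ g, U g f = f) → f = 0)
    (hctrl : Controlled U univ) :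
    ∃ (S : Finset G) (ρ : ℝ), S.Nonempty ∧ 0 ≤ ρ ∧ ρ < 1 ∧
      ∀ f ∈ K, ‖groupAverage U S f‖ ≤ ρ * ‖f‖ := by
  classical
  obtain ⟨S, C, hC, h⟩ := hctrl
  have hbound : ∀ f ∈ K, ‖f‖ ≤ C * ∑ s ∈ S, ‖U s f - f‖ := by
    intro f hf
    obtain ⟨q, hqK, hq, hqf⟩ := exists_invariant_near hU hK hKU hf fun g => h g trivial f
    rw [hfix q hqK hq, zero_sub, norm_neg] at hqf
    exact hqf
  set c : ℝ := (C * S.card + 1)⁻¹ with hc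
  have hc0 : 0 < c := by positivity
  have hc1 : c ≤ 1 := inv_le_one_of_one_le₀ (by
    have : 0 ≤ C * S.card := by positivity
    linarith)
  have hexists : ∀ f ∈ K, f ≠ 0 → ∃ s ∈ S, c * ‖f‖ < ‖U s f - f‖ := by
    intro f hf hf0
    by_contra! hcon
    have h2 := hbound f hf
    have h3 : ∑ s ∈ S, ‖U s f - f‖ ≤ S.card * (c * ‖f‖) := by
      rw [← nsmul_eq_mul]; exact Finset.sum_le_card_nsmul _ _ _ hcon
    have h4 : ‖f‖ ≤ (C * S.card) * c * ‖f‖ :=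
      h2.trans ((mul_le_mul_of_nonneg_left h3 hC).trans_eq (by ring))
    have h5 : (C * S.card + 1) * c = 1 := mul_inv_cancel₀ (by positivity)
    have h6 : (C * S.card) * c = 1 - c := by linarith
    rw [h6] at h4
    have h7 : 0 < c * ‖f‖ := mul_pos hc0 (norm_pos_iff.2 hf0)
    linarith
  set T := insert 1 S with hT
  have hTpos : (0 : ℝ) < T.card := by exact_mod_cast (Finset.insert_nonempty 1 S).card_pos
  have hsqrt : Real.sqrt (4 - c ^ 2) < 2 := by
    rw [Real.sqrt_lt' two_pos]
    have := pow_pos hc0 2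
    linarith
  set r := 2 - Real.sqrt (4 - c ^ 2) with hr
  have hr2 : r ≤ 2 := by have := Real.sqrt_nonneg (4 - c ^ 2); linarith
  have main : ∀ f ∈ K, f ≠ 0 → (2 : ℝ) ≤ T.card ∧ ‖∑ s ∈ T, U s f‖ ≤ (T.card - r) * ‖f‖ := by
    intro f hf hf0
    obtain ⟨s, hs, hlt⟩ := hexists f hf hf0
    have hs1 : s ≠ 1 := by
      rintro rfl
      rw [h1, sub_self, norm_zero] at hlt
      have := mul_pos hc0 (norm_pos_iff.2 hf0)
      linarith
    have hsub : {1, s} ⊆ T := by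
      intro x hx
      rcases Finset.mem_insert.1 hx with rfl | hx
      · exact Finset.mem_insert_self _ _
      · exact Finset.mem_insert_of_mem (Finset.mem_singleton.1 hx ▸ hs)
    have hcard : ({1, s} : Finset G).card = 2 := Finset.card_pair hs1.symm
    have hle := Finset.card_le_card hsub
    rw [hcard] at hle
    refine ⟨by exact_mod_cast hle, ?_⟩
    have hpair : ‖f + U s f‖ ≤ Real.sqrt (4 - c ^ 2) * ‖f‖ := by
      have e1 : ‖f + U s f‖ ^ 2 + ‖U s f - f‖ ^ 2 = 4 * ‖f‖ ^ 2 := by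
        rw [norm_add_sq_real, norm_sub_sq_real, LinearIsometry.norm_map, real_inner_comm]
        ring
      have e2 : (c * ‖f‖) ^ 2 ≤ ‖U s f - f‖ ^ 2 :=
        pow_le_pow_left₀ (by positivity) hlt.le 2
      refine (pow_le_pow_iff_left₀ (norm_nonneg _) (by positivity) two_ne_zero).1 ?_
      rw [mul_pow, Real.sq_sqrt (by nlinarith)]
      linarith
    rw [← Finset.sum_sdiff hsub, Finset.sum_pair hs1.symm, h1]
    have hrest : ‖∑ x ∈ T \ {1, s}, U x f‖ ≤ (T.card - 2) * ‖f‖ := by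
      refine (norm_sum_le _ _).trans (le_of_eq ?_)
      simp only [LinearIsometry.norm_map, Finset.sum_const, nsmul_eq_mul]
      rw [Finset.card_sdiff_of_subset hsub, hcard, Nat.cast_sub hle]
      norm_num
    refine (norm_add_le _ _).trans ((add_le_add hrest hpair).trans_eq ?_)
    rw [hr]; ring
  refine ⟨T, max 0 ((T.card - r) / T.card), Finset.insert_nonempty _ _, le_max_left _ _, ?_, ?_⟩
  · refine max_lt one_pos ?_
    rw [div_lt_one hTpos]; linarith
  · intro f hf
    by_cases hf0 : f = 0
    · simp [hf0, groupAverage]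
    rw [groupAverage, norm_smul, norm_inv, Real.norm_natCast]
    refine le_trans ?_ (mul_le_mul_of_nonneg_right (le_max_right _ _) (norm_nonneg _))
    rw [div_mul_eq_mul_div, inv_mul_eq_div]
    exact div_le_div_of_nonneg_right (main f hf hf0).2 hTpos.le

lemma norm_iterate_groupAverage_le {K : Submodule ℝ H}
    (hKU : ∀ g, ∀ f ∈ K, U g f ∈ K) {S : Finset G}
    {ρ : ℝ} (hρ : 0 ≤ ρ) (h : ∀ f ∈ K, ‖groupAverage U S f‖ ≤ ρ * ‖f‖) (k : ℕ) :
    ∀ f ∈ K, ‖(groupAverage U S)^[k] f‖ ≤ ρ ^ k * ‖f‖ := by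
  induction k with
  | zero => intro f _; simp
  | succ k ih =>
    intro f hf
    rw [Function.iterate_succ_apply, pow_succ, mul_assoc]
    exact (ih _ (groupAverage_mem hKU S hf)).trans
      (mul_le_mul_of_nonneg_left (h f hf) (pow_nonneg hρ k))

end IsometricAction

namespace Triple
open Quaternion UQ
variable {n : ℕ} (σ : Fin 3 ↪ Fin n)

lemma isom_apply_zero (g : UQ) (v : EucSp n) :
    isom σ g v (σ 0) = (act g (down σ v)).imI := by
  rw [isom_apply, PiLp.add_apply, up_apply_zero, imI_sub, down_apply, imI_quat]; ring

lemma isom_apply_one (g : UQ) (v : EucSp n) :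
    isom σ g v (σ 1) = (act g (down σ v)).imJ := by
  rw [isom_apply, PiLp.add_apply, up_apply_one, imJ_sub, down_apply, imJ_quat]; ring

lemma isom_apply_two (g : UQ) (v : EucSp n) :
    isom σ g v (σ 2) = (act g (down σ v)).imK := by
  rw [isom_apply, PiLp.add_apply, up_apply_two, imK_sub, down_apply, imK_quat]; ring

lemma isom_apply_of_ne (g : UQ) (v : EucSp n) {i : Fin n} (h0 : i ≠ σ 0) (h1 : i ≠ σ 1)
    (h2 : i ≠ σ 2) : isom σ g v i = v i := by
  rw [isom_apply, PiLp.add_apply, up_apply_of_ne σ _ h0 h1 h2, add_zero]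

/-- A rotation of a coordinate plane that moves the first coordinate of a vector to zero and the
second one to a nonnegative number. -/
lemma exists_planar (v : EucSp n) : ∃ g : UQ,
    (isom σ g v (σ 0) = 0) ∧ (0 ≤ isom σ g v (σ 1)) ∧
    (∀ u i, i ≠ σ 0 → i ≠ σ 1 → isom σ g u i = u i) ∧
    ∀ u, u (σ 0) = 0 → u (σ 1) = 0 → isom σ g u = u := by
  obtain ⟨g, c, s, hg, h0, h1⟩ := exists_act_planar (v (σ 0)) (v (σ 1))
  have hne : ∀ u i, i ≠ σ 0 → i ≠ σ 1 → isom σ g u i = u i := by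
    intro u i hi0 hi1
    by_cases hi2 : i = σ 2
    · rw [hi2, isom_apply_two, down_apply, hg, imK_quat]
    · exact isom_apply_of_ne σ g u hi0 hi1 hi2
  refine ⟨g, ?_, ?_, hne, fun u hu0 hu1 => ?_⟩
  · rw [isom_apply_zero, down_apply, hg, imI_quat, h0]
  · rwa [isom_apply_one, down_apply, hg, imJ_quat]
  · ext i
    by_cases hi0 : i = σ 0
    · rw [hi0, isom_apply_zero, down_apply, hg, imI_quat, hu0, hu1]; ring
    by_cases hi1 : i = σ 1
    · rw [hi1, isom_apply_one, down_apply, hg, imJ_quat, hu0, hu1]; ring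
    exact hne u i hi0 hi1

lemma isom_inv (g : UQ) : isom σ g⁻¹ = (isom σ g)⁻¹ := by
  rw [eq_inv_iff_mul_eq_one, ← isom_mul, inv_mul_cancel]
  exact LinearIsometryEquiv.ext fun v => map_one σ v

/-- The rotations of three coordinates. -/
def subset : Set (rotationGroup n) := {γ | ∃ g, (γ : EucSp n ≃ₗᵢ[ℝ] EucSp n) = isom σ g}

lemma exists_embedding (hn : 3 ≤ n) {j k : Fin n} (hjk : j ≠ k) :
    ∃ σ : Fin 3 ↪ Fin n, σ 0 = j ∧ σ 1 = k := by
  obtain ⟨l, hl⟩ : ∃ l, l ∉ ({j, k} : Finset (Fin n)) := by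
    refine Finset.exists_mem_notMem_of_card_lt_card (s := {j, k}) (t := Finset.univ) ?_ |>.imp
      fun _ h => h.2
    rw [Finset.card_univ, Fintype.card_fin]
    exact Finset.card_le_two.trans_lt hn
  simp only [Finset.mem_insert, Finset.mem_singleton, not_or] at hl
  refine ⟨⟨![j, k, l], ?_⟩, rfl, rfl⟩
  intro a b hab
  fin_cases a <;> fin_cases b <;> simp_all [eq_comm]

end Triple

namespace RotationGroup
open IsometricAction

variable {n : ℕ}

/-- A standard basis vector. -/
abbrev basisVec (i : Fin n) : EucSp n := EuclideanSpace.single i 1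

/-- The rotations fixing the basis vectors from a given index on. -/
def fixing (n k : ℕ) : Set (rotationGroup n) :=
  {γ | ∀ i : Fin n, k ≤ i → γ.1 (basisVec i) = basisVec i}

/-- The rotations fixing the basis vectors after a given index, and moving the basis vector of this
index to a vector whose first coordinates vanish. -/
def vanishing (k : Fin n) (j : ℕ) : Set (rotationGroup n) :=
  {γ | γ ∈ fixing n (k + 1) ∧ (∀ i : Fin n, (i : ℕ) < j → γ.1 (basisVec k) i = 0) ∧
    (j = 0 ∨ 0 ≤ γ.1 (basisVec k) k)}

lemma apply_eq_inner (v : EucSp n) (i : Fin n) : v i = inner ℝ (basisVec i) v := by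
  simp [EuclideanSpace.inner_single_left]

lemma eq_one_of_smul {k : Fin n} (hk : (k : ℕ) = 0) {γ : rotationGroup n}
    (hγ : γ ∈ fixing n (k + 1)) {t : ℝ} (ht : γ.1 (basisVec k) = t • basisVec k) : t = 1 := by
  have hdet : LinearMap.det (γ.1.toLinearEquiv.toLinearMap) = 1 := γ.2
  set b := (EuclideanSpace.basisFun (Fin n) ℝ).toBasis with hb
  have hM : LinearMap.toMatrix b b γ.1.toLinearEquiv.toLinearMap =
      Matrix.diagonal fun i => if i = k then t else 1 := by
    ext i j
    have : LinearMap.toMatrix b b γ.1.toLinearEquiv.toLinearMap i j = γ.1 (basisVec j) i := by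
      rw [LinearMap.toMatrix_apply]
      simp [hb]
    rw [this, Matrix.diagonal_apply]
    by_cases hj : j = k
    · subst hj
      rw [ht]
      by_cases hij : i = j <;> simp [hij]
    · have : (k : ℕ) + 1 ≤ j := by
        have : (j : ℕ) ≠ k := fun h => hj (Fin.ext h)
        omega
      rw [hγ j this]
      by_cases hij : i = j <;> simp [hij, hj]
  rw [← LinearMap.det_toMatrix b, hM, Matrix.det_diagonal,
    Finset.prod_ite_eq' Finset.univ k] at hdet
  simpa using hdet

lemma vanishing_self_subset (k : Fin n) : vanishing k k ⊆ fixing n k := by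
  rintro γ ⟨hγ, hlow, hsign⟩
  have hcoord : ∀ i : Fin n, i ≠ k → γ.1 (basisVec k) i = 0 := by
    intro i hi
    rcases lt_or_gt_of_ne (fun h => hi (Fin.ext h) : (i : ℕ) ≠ k) with h | h
    · exact hlow i h
    · rw [apply_eq_inner, ← hγ i h, LinearIsometryEquiv.inner_map_map, ← apply_eq_inner]
      simp [hi]
  set t := γ.1 (basisVec k) k with ht
  have hsmul : γ.1 (basisVec k) = t • basisVec k := by
    ext i
    by_cases hi : i = k
    · subst hi; simp [ht]
    · rw [hcoord i hi]; simp [hi]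
  have habs : |t| = 1 := by
    have h := γ.1.norm_map (basisVec k)
    rw [hsmul, norm_smul] at h
    simpa using h
  have ht1 : t = 1 := by
    rcases hsign with h | h
    · exact eq_one_of_smul h hγ hsmul
    · rwa [abs_of_nonneg h] at habs
  rw [ht1, one_smul] at hsmul
  intro i hi
  rcases hi.eq_or_lt with h | h
  · rwa [← Fin.ext h]
  · exact hγ i h

lemma exists_mul_of_mem_vanishing (hn : 3 ≤ n) {k : Fin n} {j : ℕ} (hjk : j < k) :
    ∃ σ : Fin 3 ↪ Fin n, vanishing k j ⊆
      {γ | ∃ g ∈ Triple.subset σ, ∃ h ∈ vanishing k (j + 1), γ = g * h} := by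
  obtain ⟨σ, h0, h1⟩ := Triple.exists_embedding hn (j := ⟨j, hjk.trans k.2⟩) (k := k)
    (fun h => hjk.ne (congrArg Fin.val h))
  refine ⟨σ, ?_⟩
  rintro γ ⟨hγ, hlow, -⟩
  obtain ⟨g, hg0, hg1, hgne, hgfix⟩ := Triple.exists_planar σ (γ.1 (basisVec k))
  set w : rotationGroup n := ⟨Triple.isom σ g, Triple.isom_mem σ g⟩ with hw
  refine ⟨w⁻¹, ⟨g⁻¹, (Triple.isom_inv σ g).symm⟩, w * γ, ⟨?_, ?_, Or.inr ?_⟩, by group⟩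
  · intro i hi
    change Triple.isom σ g (γ.1 (basisVec i)) = _
    rw [hγ i hi]
    refine hgfix _ ?_ ?_
    · rw [h0]
      have : i ≠ ⟨j, hjk.trans k.2⟩ := fun h => by
        have := congrArg Fin.val h
        simp only at this
        omega
      simp [this.symm]
    · rw [h1]
      have : i ≠ k := fun h => by
        have := congrArg Fin.val h
        omega
      simp [this.symm]
  · intro i hi
    change Triple.isom σ g (γ.1 (basisVec k)) i = 0
    rcases Nat.lt_succ_iff_lt_or_eq.1 hi with h | h
    · rw [hgne _ i (by rw [h0]; exact fun e => h.ne (congrArg Fin.val e))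
        (by rw [h1]; exact fun e => (h.trans hjk).ne (congrArg Fin.val e))]
      exact hlow i h
    · have : i = σ 0 := by rw [h0]; exact Fin.ext h
      rw [this]; exact hg0
  · change 0 ≤ Triple.isom σ g (γ.1 (basisVec k)) k
    rw [← h1]; rwa [← h1] at hg1

/-- The rotations of three coordinates boundedly generate the rotation group. -/
theorem controlled_univ (hn : 3 ≤ n) {H : Type*} [NormedAddCommGroup H] [InnerProductSpace ℝ H]
    {U : rotationGroup n → H →ₗᵢ[ℝ] H} (hU : ∀ g h f, U (g * h) f = U h (U g f))
    (h1 : ∀ f, U 1 f = f) (h : ∀ σ, Controlled U (Triple.subset σ)) : Controlled U univ := by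
  have hvan : ∀ k : Fin n, Controlled U (fixing n k) → ∀ d j : ℕ, j + d = k →
      Controlled U (vanishing k j) := by
    intro k hk d
    induction d with
    | zero =>
      intro j hj
      rw [add_zero] at hj
      exact hj ▸ hk.mono (vanishing_self_subset k)
    | succ d ih =>
      intro j hj
      obtain ⟨σ, hσ⟩ := exists_mul_of_mem_vanishing hn (k := k) (j := j) (by omega)
      exact ((h σ).mul hU (ih (j + 1) (by omega))).mono hσ
  have hfix : ∀ k ≤ n, Controlled U (fixing n k) := by
    intro k
    induction k with
    | zero =>
      refine fun _ => (controlled_one h1).mono fun γ hγ => ?_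
      refine Subtype.ext (LinearIsometryEquiv.toLinearEquiv_injective
        (LinearEquiv.toLinearMap_injective
        ((EuclideanSpace.basisFun (Fin n) ℝ).toBasis.ext fun i => ?_)))
      have := hγ i (Nat.zero_le _)
      simpa using this
    | succ k ih =>
      intro hk
      refine (hvan ⟨k, hk⟩ (ih (by omega)) k 0 (by simp)).mono fun γ hγ => ⟨hγ, ?_, Or.inl rfl⟩
      intro i hi
      exact absurd hi (Nat.not_lt_zero _)
  exact (hfix n le_rfl).mono fun γ _ i hi => absurd i.2 (not_lt.2 hi)

end RotationGroup

namespace RotationGroup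
open IsometricAction UQ Quaternion

variable {n : ℕ} {ν : Measure (EucSp n)}

/-- The action of rotations on square-integrable functions. -/
def koopman (hν : ∀ γ : rotationGroup n, MeasurePreserving γ.1 ν ν) (γ : rotationGroup n) :
    Lp ℝ 2 ν →ₗᵢ[ℝ] Lp ℝ 2 ν :=
  Lp.compMeasurePreservingₗᵢ ℝ γ.1 (hν γ)

variable (hν : ∀ γ : rotationGroup n, MeasurePreserving γ.1 ν ν)

lemma koopman_one (f : Lp ℝ 2 ν) : koopman hν 1 f = f := Lp.compMeasurePreserving_id_apply f

lemma koopman_mul (γ δ : rotationGroup n) (f : Lp ℝ 2 ν) :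
    koopman hν (γ * δ) f = koopman hν δ (koopman hν γ f) :=
  Lp.compMeasurePreserving_comp_apply f (hν γ) (hν δ)

lemma coeFn_koopman (γ : rotationGroup n) (f : Lp ℝ 2 ν) : koopman hν γ f =ᵐ[ν] f ∘ γ.1 :=
  Lp.coeFn_compMeasurePreserving f (hν γ)

lemma norm_sq_eq_integral (f : Lp ℝ 2 ν) : ‖f‖ ^ 2 = ∫ v, f v ^ 2 ∂ν := by
  rw [← real_inner_self_eq_norm_sq, L2.inner_def]
  refine integral_congr_ae (Filter.Eventually.of_forall fun v => ?_)
  simp [sq]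

lemma norm_sq_koopman_sub (γ : rotationGroup n) {f : Lp ℝ 2 ν} {F : EucSp n → ℝ}
    (hF : f =ᵐ[ν] F) : ‖koopman hν γ f - f‖ ^ 2 = ∫ v, (F (γ.1 v) - F v) ^ 2 ∂ν := by
  rw [norm_sq_eq_integral]
  refine integral_congr_ae ?_
  filter_upwards [Lp.coeFn_sub (koopman hν γ f) f, coeFn_koopman hν γ f, hF,
    (hν γ).quasiMeasurePreserving.ae_eq_comp hF] with v h1 h2 h3 h4
  rw [h1, Pi.sub_apply, h2, h4, h3, Function.comp_apply]

lemma isom_apply_eq (σ : Fin 3 ↪ Fin n) (g : UQ) (v : EucSp n) :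
    Triple.isom σ g v = v - Triple.up σ (Triple.down σ v) +
      Triple.up σ (act g (Triple.down σ v)) := by
  rw [Triple.isom_apply, map_sub]; abel

lemma continuous_isom (σ : Fin 3 ↪ Fin n) :
    Continuous fun p : UQ × EucSp n => Triple.isom σ p.1 p.2 := by
  have hu : Continuous (Triple.up σ) := LinearMap.continuous_of_finiteDimensional _
  have hd : Continuous (Triple.down σ) := LinearMap.continuous_of_finiteDimensional _
  simp only [isom_apply_eq, act_apply]
  fun_prop

/-- The rotation of three coordinates given by a unit quaternion. -/
abbrev tripleRot (σ : Fin 3 ↪ Fin n) (g : UQ) : rotationGroup n :=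
  ⟨Triple.isom σ g, Triple.isom_mem σ g⟩

open BoundedContinuousFunction in
lemma integrable_displacement [IsFiniteMeasure ν] (σ : Fin 3 ↪ Fin n) (F : EucSp n →ᵇ ℝ) (h : UQ) :
    Integrable (fun p : UQ × EucSp n =>
      (F (Triple.isom σ (h * p.1) p.2) - F (Triple.isom σ p.1 p.2)) ^ 2) (haar.prod ν) := by
  have hc := continuous_isom σ
  have hmul : Continuous fun p : UQ × EucSp n => (h * p.1, p.2) :=
    ((continuous_const_mul h).comp continuous_fst).prodMk continuous_snd
  have hc2 : Continuous fun p : UQ × EucSp n => Triple.isom σ (h * p.1) p.2 :=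
    Continuous.comp (g := fun p : UQ × EucSp n => Triple.isom σ p.1 p.2)
      (f := fun p : UQ × EucSp n => (h * p.1, p.2)) hc hmul
  have hcont : Continuous fun p : UQ × EucSp n =>
      (F (Triple.isom σ (h * p.1) p.2) - F (Triple.isom σ p.1 p.2)) ^ 2 :=
    ((F.continuous.comp hc2).sub (F.continuous.comp hc)).pow 2
  refine Integrable.of_bound hcont.aestronglyMeasurable ((2 * ‖F‖) ^ 2)
    (Filter.Eventually.of_forall fun p => ?_)
  rw [norm_pow]
  refine pow_le_pow_left₀ (norm_nonneg _) ?_ 2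
  rw [two_mul]
  exact (norm_sub_le _ _).trans (add_le_add (F.norm_coe_le_norm _) (F.norm_coe_le_norm _))

open BoundedContinuousFunction in
lemma integral_integral_displacement
    (hν : ∀ γ : rotationGroup n, MeasurePreserving γ.1 ν ν)
    [IsFiniteMeasure ν] (σ : Fin 3 ↪ Fin n) (F : EucSp n →ᵇ ℝ)
    (h : UQ) :
    ∫ v, ∫ g, (F (Triple.isom σ (h * g) v) - F (Triple.isom σ g v)) ^ 2 ∂haar ∂ν =
      ∫ v, (F (Triple.isom σ h v) - F v) ^ 2 ∂ν := by
  rw [← integral_integral_swap (integrable_displacement σ F h)]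
  have e : ∀ g, ∫ v, (F (Triple.isom σ (h * g) v) - F (Triple.isom σ g v)) ^ 2 ∂ν =
      ∫ v, (F (Triple.isom σ h v) - F v) ^ 2 ∂ν := by
    intro g
    rw [← (hν (tripleRot σ g)).integral_comp
      (Triple.isom σ g).toHomeomorph.measurableEmbedding
      (fun v => (F (Triple.isom σ h v) - F v) ^ 2)]
    refine integral_congr_ae (Filter.Eventually.of_forall fun v => ?_)
    simp only [Triple.isom_mul]
    rfl
  simp only [e, integral_const, probReal_univ, one_smul]

/-- The rotations of three coordinates are controlled by the integer quaternions of norm `7`. -/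
theorem controlled_triple [IsFiniteMeasure ν] (σ : Fin 3 ↪ Fin n) :
    Controlled (koopman hν) (Triple.subset σ) := by
  classical
  obtain ⟨C, hC, H⟩ := exists_act_displacement_bound
  have hdense := Lp.boundedContinuousFunction_dense (E := ℝ) (p := 2) (μ := ν) (by norm_num)
  have hsq : ∀ f : Lp ℝ 2 ν, ∀ h, ‖koopman hν (tripleRot σ h) f - f‖ ^ 2 ≤
      C * ∑ q ∈ shell 7, ‖koopman hν (tripleRot σ (direction q)) f - f‖ ^ 2 := by
    intro f h
    have hcont : ∀ γ, Continuous fun f : Lp ℝ 2 ν => ‖koopman hν γ f - f‖ ^ 2 := fun γ =>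
      (((koopman hν γ).continuous.sub continuous_id).norm).pow 2
    refine hdense.induction (P := fun f => ‖koopman hν (tripleRot σ h) f - f‖ ^ 2 ≤
      C * ∑ q ∈ shell 7, ‖koopman hν (tripleRot σ (direction q)) f - f‖ ^ 2) ?_
      (isClosed_le (hcont _) (continuous_const.mul
        (continuous_finsetSum _ fun q _ => hcont _))) f
    intro f hf
    obtain ⟨F, hF⟩ := Lp.mem_boundedContinuousFunction_iff.1 hf
    have hfF : f =ᵐ[ν] F := by
      have := ContinuousMap.coeFn_toAEEqFun ν F.toContinuousMap
      rw [hF] at this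
      exact this
    simp only [norm_sq_koopman_sub hν _ hfF]
    rw [← integral_integral_displacement hν σ F h]
    simp only [← integral_integral_displacement hν σ F (direction _)]
    have hintg : ∀ k, Integrable (fun v =>
        ∫ g, (F (Triple.isom σ (k * g) v) - F (Triple.isom σ g v)) ^ 2 ∂haar) ν :=
      fun k => (integrable_displacement σ F k).integral_prod_right
    rw [← integral_finsetSum _ fun q _ => hintg _, ← integral_const_mul]
    refine integral_mono (hintg h) ((integrable_finsetSum _ fun q _ => hintg _).const_mul C)
      fun v => ?_
    have := H (fun b => F (v - Triple.up σ (Triple.down σ v) + Triple.up σ b))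
      (F.continuous.comp (continuous_const.add (LinearMap.continuous_of_finiteDimensional _)))
      (Triple.down σ v) (by simp [Triple.down_apply]) h
    simpa only [isom_apply_eq] using this
  refine ⟨(shell 7).image fun q => tripleRot σ (direction q),
    Real.sqrt C * (shell 7).card, by positivity, ?_⟩
  rintro ⟨γ, hγ⟩ ⟨h, rfl⟩ f
  set T := (shell 7).image fun q => tripleRot σ (direction q) with hT
  set D := ∑ s ∈ T, ‖koopman hν s f - f‖ with hD
  have h1 : ∑ q ∈ shell 7, ‖koopman hν (tripleRot σ (direction q)) f - f‖ ^ 2 ≤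
      ((shell 7).card * D) ^ 2 := by
    refine (Finset.sum_sq_le_sq_sum_of_nonneg fun q _ => norm_nonneg _).trans ?_
    refine pow_le_pow_left₀ (Finset.sum_nonneg fun q _ => norm_nonneg _) ?_ 2
    rw [← nsmul_eq_mul]
    refine Finset.sum_le_card_nsmul _ _ _ fun q hq => ?_
    exact Finset.single_le_sum (f := fun s => ‖koopman hν s f - f‖)
      (fun s _ => norm_nonneg _) (Finset.mem_image_of_mem _ hq)
  have hD0 : 0 ≤ D := Finset.sum_nonneg fun s _ => norm_nonneg _
  refine (pow_le_pow_iff_left₀ (norm_nonneg _) (by positivity) two_ne_zero).1 ?_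
  refine (hsq f h).trans ?_
  rw [mul_assoc, mul_pow, Real.sq_sqrt hC.le]
  exact mul_le_mul_of_nonneg_left h1 hC.le

end RotationGroup

namespace RotationGroup
open IsometricAction

variable {n : ℕ} {ν : Measure (EucSp n)}

lemma det_reflection_orthogonal_span {z : EucSp n} (hz : z ≠ 0) :
    LinearMap.det ((Submodule.span ℝ {z})ᗮ.reflection.toLinearEquiv.toLinearMap) = -1 := by
  have h := Submodule.det_reflection (Submodule.span ℝ {z})ᗮ
  rw [Submodule.orthogonal_orthogonal, finrank_span_singleton hz, pow_one] at h
  exact h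

lemma exists_apply_eq (hn : 3 ≤ n) {x y : EucSp n} (hx : ‖x‖ = 1) (hy : ‖y‖ = 1) :
    ∃ γ : rotationGroup n, γ.1 x = y := by
  by_cases hxy : x = y
  · exact ⟨1, hxy⟩
  obtain ⟨z, hz, hz0⟩ : ∃ z ∈ (Submodule.span ℝ {y})ᗮ, z ≠ 0 := by
    refine Submodule.exists_mem_ne_zero_of_ne_bot fun h => ?_
    have h1 := Submodule.finrank_add_finrank_orthogonal (Submodule.span ℝ {y})
    have h2 := finrank_span_singleton (K := ℝ) (v := y) (by rintro rfl; simp at hy)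
    rw [h, finrank_bot, h2, finrank_euclideanSpace, Fintype.card_fin] at h1
    omega
  set a : EucSp n ≃ₗᵢ[ℝ] EucSp n := (Submodule.span ℝ {z})ᗮ.reflection with ha
  set b : EucSp n ≃ₗᵢ[ℝ] EucSp n := (Submodule.span ℝ {x - y})ᗮ.reflection with hb
  refine ⟨⟨a * b, ?_⟩, ?_⟩
  · have h : LinearMap.det ((a * b).toLinearEquiv.toLinearMap) =
      LinearMap.det (a.toLinearEquiv.toLinearMap) * LinearMap.det (b.toLinearEquiv.toLinearMap) :=
      LinearMap.det_comp _ _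
    rw [mem_rotationGroup, IsRotation, h, ha, hb, det_reflection_orthogonal_span hz0,
      det_reflection_orthogonal_span (sub_ne_zero.2 hxy)]
    norm_num
  · change a (b x) = y
    rw [hb, Submodule.reflection_sub (hx.trans hy.symm), ha]
    refine Submodule.reflection_mem_subspace_eq_self ?_
    rw [Submodule.mem_orthogonal_singleton_iff_inner_right]
    rw [Submodule.mem_orthogonal_singleton_iff_inner_right, real_inner_comm] at hz
    exact hz

variable (hν : ∀ γ : rotationGroup n, MeasurePreserving γ.1 ν ν)

/-- Rotations act ergodically on the sphere. -/
lemma ae_eq_const_of_invariant [IsProbabilityMeasure ν] (hn : 3 ≤ n) (hsph : ∀ᵐ v ∂ν, ‖v‖ = 1)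
    {f : Lp ℝ 2 ν} (hf : ∀ γ, koopman hν γ f = f) : ∃ c : ℝ, f =ᵐ[ν] fun _ => c := by
  have hintg : Integrable f ν := (Lp.memLp f).integrable one_le_two
  have hlim := (Besicovitch.vitaliFamily ν).ae_tendsto_average hintg.locallyIntegrable
  have havg : ∀ (γ : rotationGroup n) x r,
      ⨍ v in closedBall (γ.1 x) r, f v ∂ν = ⨍ v in closedBall x r, f v ∂ν := by
    intro γ x r
    have hpre : γ.1 ⁻¹' closedBall (γ.1 x) r = closedBall x r := by
      ext v; simp [mem_closedBall]
    have hemb := γ.1.toHomeomorph.measurableEmbedding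
    have h1 := (hν γ).setIntegral_preimage_emb hemb f (closedBall (γ.1 x) r)
    have h2 := (hν γ).measure_preimage_emb hemb (closedBall (γ.1 x) r)
    have h3 : ∫ v in closedBall x r, f (γ.1 v) ∂ν = ∫ v in closedBall x r, f v ∂ν := by
      refine integral_congr_ae (ae_restrict_of_ae ?_)
      have := coeFn_koopman hν γ f
      rw [hf γ] at this
      exact this.symm
    rw [hpre] at h1 h2
    rw [setAverage_eq, setAverage_eq, ← h1, h3, Measure.real, Measure.real, h2]
  obtain ⟨x, hx, hx1⟩ := (hlim.and hsph).exists
  refine ⟨f x, ?_⟩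
  filter_upwards [hlim, hsph] with y hy hy1
  obtain ⟨γ, rfl⟩ := exists_apply_eq hn hx1 hy1
  have e1 := hx.comp (Besicovitch.tendsto_filterAt ν x)
  have e2 := hy.comp (Besicovitch.tendsto_filterAt ν (γ.1 x))
  refine tendsto_nhds_unique e2 (e1.congr fun r => ?_)
  exact (havg γ x r).symm

variable [IsProbabilityMeasure ν]

/-- The class of the indicator function of a set. -/
abbrev chi (ν : Measure (EucSp n)) [IsProbabilityMeasure ν] {A : Set (EucSp n)}
    (hA : MeasurableSet A) : Lp ℝ 2 ν :=
  indicatorConstLp 2 hA (measure_ne_top ν A) 1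

lemma inner_chi {A B : Set (EucSp n)} (hA : MeasurableSet A) (hB : MeasurableSet B) :
    inner ℝ (chi ν hA) (chi ν hB) = ν.real (A ∩ B) := by
  rw [L2.inner_indicatorConstLp_one, integral_congr_ae
    (ae_restrict_of_ae indicatorConstLp_coeFn), setIntegral_indicator hB]
  simp

lemma measurableSet_preimage (γ : rotationGroup n) {A : Set (EucSp n)} (hA : MeasurableSet A) :
    MeasurableSet (γ.1 ⁻¹' A) := γ.1.continuous.measurable hA

lemma koopman_chi (γ : rotationGroup n) {A : Set (EucSp n)} (hA : MeasurableSet A) :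
    koopman hν γ (chi ν hA) = chi ν (measurableSet_preimage γ hA) :=
  Lp.indicatorConstLp_compMeasurePreserving hA (measure_ne_top ν A) 1 (hν γ)

/-- The constant function. -/
abbrev constOne (ν : Measure (EucSp n)) [IsProbabilityMeasure ν] : Lp ℝ 2 ν :=
  chi ν MeasurableSet.univ

lemma koopman_constOne (γ : rotationGroup n) : koopman hν γ (constOne ν) = constOne ν :=
  koopman_chi hν γ MeasurableSet.univ

/-- The functions of mean zero. -/
abbrev meanZero (ν : Measure (EucSp n)) [IsProbabilityMeasure ν] : Submodule ℝ (Lp ℝ 2 ν) :=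
  (Submodule.span ℝ {constOne ν})ᗮ

lemma mem_meanZero {f : Lp ℝ 2 ν} : f ∈ meanZero ν ↔ inner ℝ (constOne ν) f = 0 :=
  Submodule.mem_orthogonal_singleton_iff_inner_right

lemma koopman_mem_meanZero (γ : rotationGroup n) (f : Lp ℝ 2 ν) (hf : f ∈ meanZero ν) :
    koopman hν γ f ∈ meanZero ν := by
  rw [mem_meanZero] at hf ⊢
  rw [← koopman_constOne hν γ, LinearIsometry.inner_map_map, hf]

lemma eq_zero_of_invariant (hn : 3 ≤ n) (hsph : ∀ᵐ v ∂ν, ‖v‖ = 1) (f : Lp ℝ 2 ν)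
    (hf : f ∈ meanZero ν) (hinv : ∀ γ, koopman hν γ f = f) : f = 0 := by
  obtain ⟨c, hc⟩ := ae_eq_const_of_invariant hν hn hsph hinv
  rw [mem_meanZero, L2.inner_indicatorConstLp_one, setIntegral_univ, integral_congr_ae hc] at hf
  simp only [integral_const, probReal_univ, one_smul] at hf
  subst hf
  exact (Lp.eq_zero_iff_ae_eq_zero).2 hc

/-- Averaging over a suitable finite set of rotations has a spectral gap. -/
theorem exists_spectral_gap (hn : 3 ≤ n) (hsph : ∀ᵐ v ∂ν, ‖v‖ = 1) :
    ∃ (S : Finset (rotationGroup n)) (ρ : ℝ), S.Nonempty ∧ 0 ≤ ρ ∧ ρ < 1 ∧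
      ∀ f ∈ meanZero ν, ‖groupAverage (koopman hν) S f‖ ≤ ρ * ‖f‖ :=
  exists_groupAverage_contraction (koopman_mul hν) (koopman_one hν)
    (Submodule.isClosed_orthogonal _) (koopman_mem_meanZero hν)
    (eq_zero_of_invariant hν hn hsph)
    (controlled_univ hn (koopman_mul hν) (koopman_one hν) (controlled_triple hν))

open scoped Classical in
/-- The products of a given number of elements of a finite set. -/
def words (S : Finset (rotationGroup n)) : ℕ → Finset (rotationGroup n)
  | 0 => {1}
  | k + 1 => Finset.image₂ (fun w s => w * s) (words S k) S

lemma inner_iterate_groupAverage_chi (S : Finset (rotationGroup n)) {A : Set (EucSp n)}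
    (hA : MeasurableSet A) (k : ℕ) : ∀ {B : Set (EucSp n)} (hB : MeasurableSet B),
    (∀ w ∈ words S k, Disjoint (w.1 ⁻¹' A) B) →
    inner ℝ ((groupAverage (koopman hν) S)^[k] (chi ν hA)) (chi ν hB) = 0 := by
  classical
  induction k with
  | zero =>
    intro B hB h
    have : Disjoint A B := h 1 (Finset.mem_singleton_self 1)
    rw [Function.iterate_zero, id, inner_chi, this.inter_eq]
    simp
  | succ k ih =>
    intro B hB h
    rw [Function.iterate_succ_apply', groupAverage, inner_smul_left, sum_inner,
      Finset.sum_eq_zero, mul_zero]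
    intro s hs
    have hB' := measurableSet_preimage s⁻¹ hB
    have hpre : ∀ v, (s⁻¹).1 (s.1 v) = v := fun v => s.1.symm_apply_apply v
    have e : chi ν hB = koopman hν s (chi ν hB') := by
      rw [koopman_chi]
      congr 1
      ext v
      simp only [mem_preimage, hpre]
    rw [e, LinearIsometry.inner_map_map]
    refine ih hB' fun w hw => ?_
    have h2 := h (w * s) (Finset.mem_image₂_of_mem hw hs)
    rw [Set.disjoint_left] at h2 ⊢
    intro v hv hvB
    refine h2 (a := (s⁻¹).1 v) ?_ hvB
    have hpre' : s.1 ((s⁻¹).1 v) = v := s.1.apply_symm_apply v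
    change w.1 (s.1 ((s⁻¹).1 v)) ∈ A
    rwa [hpre']

lemma iterate_groupAverage_add {S : Finset (rotationGroup n)} (hS : S.Nonempty) (f : Lp ℝ 2 ν)
    (a : ℝ)
    (k : ℕ) : (groupAverage (koopman hν) S)^[k] (f + a • constOne ν) =
      (groupAverage (koopman hν) S)^[k] f + a • constOne ν := by
  induction k with
  | zero => rfl
  | succ k ih =>
    have hc : (S.card : ℝ) ≠ 0 := by exact_mod_cast hS.card_pos.ne'
    rw [Function.iterate_succ_apply', Function.iterate_succ_apply', ih]
    simp only [groupAverage, map_add, map_smul, koopman_constOne, Finset.sum_add_distrib,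
      Finset.sum_const, smul_add]
    rw [← Nat.cast_smul_eq_nsmul ℝ, smul_smul, inv_mul_cancel₀ hc, one_smul]

lemma iterate_groupAverage_mem {S : Finset (rotationGroup n)} {f : Lp ℝ 2 ν} (hf : f ∈ meanZero ν)
    (k : ℕ) : (groupAverage (koopman hν) S)^[k] f ∈ meanZero ν := by
  induction k with
  | zero => exact hf
  | succ k ih =>
    rw [Function.iterate_succ_apply']
    exact groupAverage_mem (koopman_mem_meanZero hν) S ih

lemma inner_constOne_chi {A : Set (EucSp n)} (hA : MeasurableSet A) :
    inner ℝ (constOne ν) (chi ν hA) = ν.real A := by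
  rw [inner_chi, univ_inter]

lemma inner_constOne_self : inner ℝ (constOne ν) (constOne ν) = 1 := by
  rw [inner_constOne_chi, probReal_univ]

lemma chi_sub_mem_meanZero {A : Set (EucSp n)} (hA : MeasurableSet A) :
    chi ν hA - ν.real A • constOne ν ∈ meanZero ν := by
  rw [mem_meanZero, inner_sub_right, inner_smul_right, inner_constOne_chi, inner_constOne_self]
  ring

lemma norm_sq_chi_sub {A : Set (EucSp n)} (hA : MeasurableSet A) :
    ‖chi ν hA - ν.real A • constOne ν‖ ^ 2 = ν.real A * (1 - ν.real A) := by
  rw [← real_inner_self_eq_norm_sq, inner_sub_left, inner_smul_left,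
    mem_meanZero.1 (chi_sub_mem_meanZero hA), inner_sub_right, inner_smul_right, inner_chi,
    real_inner_comm, inner_constOne_chi, inter_self]
  ring

/-- The expansion property for measures on Euclidean space supported by the unit sphere. -/
theorem exists_expansion (hν : ∀ γ : rotationGroup n, MeasurePreserving γ.1 ν ν) (hn : 3 ≤ n)
    (hsph : ∀ᵐ v ∂ν, ‖v‖ = 1) {η : ℝ} (hη : 0 < η) :
    ∃ S : Finset (rotationGroup n), ∀ A : Set (EucSp n), MeasurableSet A →
      min (1 - η) (ν.real A / η) ≤ ν.real (⋃ w ∈ S, w.1 ⁻¹' A) := by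
  obtain ⟨S, ρ, hS, hρ0, hρ1, hgap⟩ := exists_spectral_gap hν hn hsph
  obtain ⟨k, hk⟩ := exists_pow_lt_of_lt_one hη hρ1
  refine ⟨words S k, fun A hA => ?_⟩
  set V := ⋃ w ∈ words S k, w.1 ⁻¹' A with hV
  have hVm : MeasurableSet V :=
    Finset.measurableSet_biUnion _ fun w _ => measurableSet_preimage w hA
  have h0 := inner_iterate_groupAverage_chi hν S hA k hVm.compl fun w hw =>
    disjoint_compl_right.mono_left (subset_biUnion_of_mem (u := fun w => w.1 ⁻¹' A) hw)
  set a := ν.real A with ha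
  set w := ν.real Vᶜ with hw
  have hVw : ν.real V = 1 - w := by rw [hw, probReal_compl_eq_one_sub hVm]; ring
  set f := chi ν hA - a • constOne ν with hf
  set h := chi ν hVm.compl - w • constOne ν with hh
  set g := (groupAverage (koopman hν) S)^[k] f with hg
  have hgm : g ∈ meanZero ν := iterate_groupAverage_mem hν (chi_sub_mem_meanZero hA) k
  have hdec : chi ν hA = f + a • constOne ν := by rw [hf, sub_add_cancel]
  have hinner : a * w = -inner ℝ g h := by
    rw [hdec, iterate_groupAverage_add hν hS, inner_add_left, inner_smul_left,
      inner_constOne_chi] at h0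
    rw [hh, inner_sub_right, inner_smul_right, real_inner_comm (constOne ν) g, mem_meanZero.1 hgm]
    simp only [conj_trivial] at h0
    linarith
  have hcs : a * w ≤ ρ ^ k * ‖f‖ * ‖h‖ := by
    rw [hinner]
    refine (neg_le_abs _).trans ((abs_real_inner_le_norm g h).trans ?_)
    exact mul_le_mul_of_nonneg_right
      (norm_iterate_groupAverage_le (koopman_mem_meanZero hν) hρ0 hgap k f
        (chi_sub_mem_meanZero hA))
      (norm_nonneg _)
  have ha0 : 0 ≤ a := measureReal_nonneg
  have hw0 : 0 ≤ w := measureReal_nonneg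
  have hw1 : w ≤ 1 := measureReal_le_one
  have hsq : (a * w) ^ 2 ≤ η ^ 2 * (a * (w * (1 - w))) := by
    have e1 : ‖f‖ ^ 2 ≤ a := by
      rw [norm_sq_chi_sub]; nlinarith
    have e2 : ‖h‖ ^ 2 = w * (1 - w) := norm_sq_chi_sub hVm.compl
    calc (a * w) ^ 2 ≤ (ρ ^ k * ‖f‖ * ‖h‖) ^ 2 := pow_le_pow_left₀ (mul_nonneg ha0 hw0) hcs 2
      _ = (ρ ^ k) ^ 2 * (‖f‖ ^ 2 * ‖h‖ ^ 2) := by ring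
      _ ≤ η ^ 2 * (a * (w * (1 - w))) := by
        rw [e2]
        have : 0 ≤ w * (1 - w) := mul_nonneg hw0 (by linarith)
        gcongr
  rw [hVw]
  rcases le_total w η with hwη | hwη
  · exact (min_le_left _ _).trans (by linarith)
  · refine (min_le_right _ _).trans ?_
    rw [div_le_iff₀ hη]
    rcases ha0.eq_or_lt with h | hapos
    · rw [← h]; exact mul_nonneg (by linarith) hη.le
    have hwpos : 0 < w := hη.trans_le hwη
    have e : a * w ≤ η ^ 2 * (1 - w) :=
      le_of_mul_le_mul_left (by nlinarith) (mul_pos hapos hwpos)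
    refine le_of_mul_le_mul_left ?_ hη
    nlinarith

end RotationGroup

lemma continuous_rotateSphere {n : ℕ} (γ : EucSp n ≃ₗᵢ[ℝ] EucSp n) : Continuous (rotateSphere γ) :=
  (γ.continuous.comp continuous_subtype_val).subtype_mk _

namespace RotationGroup

variable {n : ℕ}

lemma isRotation_inv (γ : rotationGroup n) : IsRotation (γ⁻¹).1 := mem_rotationGroup.1 (γ⁻¹).2

lemma preimage_rotateSphere (γ : rotationGroup n) (U : Set (Sph n)) :
    rotateSphere γ.1 ⁻¹' U = rotateSphere (γ⁻¹).1 '' U := by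
  refine (congrFun (image_eq_preimage_of_inverse (f := rotateSphere (γ⁻¹).1)
    (g := rotateSphere γ.1) (fun x => ?_) (fun x => ?_)) U).symm
  · exact Subtype.ext (γ.1.apply_symm_apply x)
  · exact Subtype.ext (γ.1.symm_apply_apply x)

lemma measurePreserving_map_coe {μ : Measure (Sph n)}
    (hinv : ∀ γ : EucSp n ≃ₗᵢ[ℝ] EucSp n, IsRotation γ →
      ∀ U : Set (Sph n), μ (rotateSphere γ '' U) = μ U) (γ : rotationGroup n) :
    MeasurePreserving γ.1 (μ.map Subtype.val) (μ.map Subtype.val) := by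
  have hr : MeasurePreserving (rotateSphere γ.1) μ μ := by
    refine ⟨(continuous_rotateSphere γ.1).measurable, Measure.ext fun U hU => ?_⟩
    rw [Measure.map_apply (continuous_rotateSphere γ.1).measurable hU, preimage_rotateSphere,
      hinv _ (isRotation_inv γ)]
  refine ⟨γ.1.continuous.measurable, ?_⟩
  conv_rhs => rw [← hr.map_eq]
  rw [Measure.map_map γ.1.continuous.measurable measurable_subtype_coe,
    Measure.map_map measurable_subtype_coe hr.measurable]
  rfl

end RotationGroup

open RotationGroup in
/-- The expansion property of the rotation action on the sphere: for every `n ≥ 3` and every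
`η > 0` there is a finite set `S` of rotations of `SO(n)` such that every measurable set
`U ⊆ S^{n-1}` satisfies `μ(⋃_{γ ∈ S} γ(U)) ≥ min (1 - η) (μ(U) / η)`. -/
theorem expansion_property_sphere (n : ℕ) (hn : 3 ≤ n)
    (μ : Measure (Sph n)) [IsProbabilityMeasure μ]
    (hinv : ∀ γ : EucSp n ≃ₗᵢ[ℝ] EucSp n, IsRotation γ →
      ∀ U : Set (Sph n), μ (rotateSphere γ '' U) = μ U)
    (η : ℝ) (hη : 0 < η) :
    ∃ S : Finset (EucSp n ≃ₗᵢ[ℝ] EucSp n),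
      (∀ γ ∈ S, IsRotation γ) ∧
      ∀ U : Set (Sph n), NullMeasurableSet U μ →
        μ (⋃ γ ∈ S, rotateSphere γ '' U) ≥
          min (ENNReal.ofReal (1 - η)) (μ U / ENNReal.ofReal η) := by
  classical
  have hcoe : MeasurableEmbedding (Subtype.val : Sph n → EucSp n) :=
    MeasurableEmbedding.subtype_coe isClosed_sphere.measurableSet
  set ν := μ.map (Subtype.val : Sph n → EucSp n)
  have : IsProbabilityMeasure ν :=
    Measure.isProbabilityMeasure_map measurable_subtype_coe.aemeasurable
  have hsph : ∀ᵐ v ∂ν, ‖v‖ = 1 := by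
    rw [hcoe.ae_map_iff]
    exact Filter.Eventually.of_forall fun x => norm_eq_of_mem_sphere x
  obtain ⟨S, hS⟩ := exists_expansion (measurePreserving_map_coe hinv) hn hsph hη
  refine ⟨S.image fun w => (w⁻¹).1, ?_, fun U hU => ?_⟩
  · simp only [Finset.mem_image]
    rintro _ ⟨w, -, rfl⟩
    exact isRotation_inv w
  obtain ⟨U', hUU', hU', hae⟩ := hU.exists_measurable_subset_ae_eq
  have hA : MeasurableSet (Subtype.val '' U') := hcoe.measurableSet_image.2 hU'
  have hνA : ν (Subtype.val '' U') = μ U := by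
    rw [hcoe.map_apply, preimage_image_eq _ Subtype.val_injective, measure_congr hae]
  have hsub : Subtype.val ⁻¹' (⋃ w ∈ S, w.1 ⁻¹' (Subtype.val '' U')) ⊆
      ⋃ γ ∈ S.image fun w => (w⁻¹).1, rotateSphere γ '' U := by
    intro x hx
    simp only [preimage_iUnion, mem_iUnion] at hx
    obtain ⟨w, hw, y, hy, hyx⟩ := hx
    have hxU : x ∈ rotateSphere w.1 ⁻¹' U := by
      have : rotateSphere w.1 x = y := Subtype.ext hyx.symm
      rw [mem_preimage, this]
      exact hUU' hy
    rw [preimage_rotateSphere] at hxU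
    exact mem_biUnion (Finset.mem_image_of_mem _ hw) hxU
  calc min (ENNReal.ofReal (1 - η)) (μ U / ENNReal.ofReal η)
      = ENNReal.ofReal (min (1 - η) (ν.real (Subtype.val '' U') / η)) := by
        rw [ENNReal.ofReal_min, ENNReal.ofReal_div_of_pos hη, ofReal_measureReal, hνA]
    _ ≤ ENNReal.ofReal (ν.real (⋃ w ∈ S, w.1 ⁻¹' (Subtype.val '' U'))) :=
        ENNReal.ofReal_le_ofReal (hS _ hA)
    _ = μ (Subtype.val ⁻¹' (⋃ w ∈ S, w.1 ⁻¹' (Subtype.val '' U'))) := by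
        rw [ofReal_measureReal (measure_ne_top ν _), hcoe.map_apply]
    _ ≤ _ := measure_mono hsub
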